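/- arXiv:math/0502271 — 2 statements merged into one kernel-verified Lean document; each statement's English description precedes it below -/
import Mathlib

section
/- Let (W,S) be a Coxeter system such that: (0) for all s,t ∈ S with m(s,t) even, m(s,t) ∈ {2} ∪ 4ℕ; (1) for all distinct s,t ∈ S with m(s,t) odd, {s,t} is a maximal spherical subset of S; (2) there is no three-element subset {s,t,u} ⊆ S with both m(s,t) and m(t,u) odd; (3) for all distinct s,t ∈ S with m(s,t) odd, at most two maximal spherical subsets of S intersect {s,t}. Then W is rigid. -/
open Subgroup

/-- `S` is a Coxeter generating set for the group `W`: there is a Coxeter matrix on `S` and a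
Coxeter system on `W` whose simple reflections are exactly the elements of `S`. -/
def IsCoxGenSet {W : Type*} [Group W] (S : Set W) : Prop :=
  S.Finite ∧ ∃ (M : CoxeterMatrix S) (cs : CoxeterSystem M W), ∀ s : S, cs.simple s = (s : W)

/-- `T` is a spherical subset of the generating set `S`: the parabolic subgroup `W_T` is finite. -/
def IsSpherical {W : Type*} [Group W] (S T : Set W) : Prop :=
  T ⊆ S ∧ ((Subgroup.closure T : Subgroup W) : Set W).Finite

/-- `T` is a maximal spherical subset of `S`. -/
def IsMaxSpherical {W : Type*} [Group W] (S T : Set W) : Prop :=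
  IsSpherical S T ∧ ∀ U : Set W, IsSpherical S U → T ⊆ U → U = T

/-- `T` is independent: all pairwise orders `m(s,t)` equal `2`. -/
def IsIndep {W : Type*} [Group W] (T : Set W) : Prop :=
  ∀ s ∈ T, ∀ t ∈ T, s ≠ t → orderOf (s * t) = 2

/-- `T` is a maximal independent subset of `Sb`. -/
def IsMaxIndep {W : Type*} [Group W] (Sb T : Set W) : Prop :=
  IsIndep T ∧ T ⊆ Sb ∧ ∀ U : Set W, IsIndep U → U ⊆ Sb → T ⊆ U → U = T

/-- all pairwise orders lie in `{2} ∪ 4ℕ` (with `orderOf = 0` meaning `∞`). -/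
def IsStrongEvenSet {W : Type*} [Group W] (T : Set W) : Prop :=
  ∀ s ∈ T, ∀ t ∈ T, s ≠ t → (orderOf (s * t) = 2 ∨ 4 ∣ orderOf (s * t))

/-- all pairwise orders are even (with `orderOf = 0` meaning `∞`). -/
def IsEvenSet {W : Type*} [Group W] (T : Set W) : Prop :=
  ∀ s ∈ T, ∀ t ∈ T, s ≠ t → Even (orderOf (s * t))

/-- `S̄`: the union of all maximal spherical subsets `T` of `S` with `(W_T, T)` strong even. -/
def Sbar {W : Type*} [Group W] (S : Set W) : Set W :=
  ⋃₀ {T | IsMaxSpherical S T ∧ IsStrongEvenSet T}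

/-- Condition (0): even orders lie in `{2} ∪ 4ℕ`. -/
def Cond0 {W : Type*} [Group W] (S : Set W) : Prop :=
  ∀ s ∈ S, ∀ t ∈ S, s ≠ t → Even (orderOf (s * t)) →
    (orderOf (s * t) = 2 ∨ 4 ∣ orderOf (s * t))

/-- Condition (1): odd-order pairs are maximal spherical subsets. -/
def Cond1 {W : Type*} [Group W] (S : Set W) : Prop :=
  ∀ s ∈ S, ∀ t ∈ S, s ≠ t → Odd (orderOf (s * t)) → IsMaxSpherical S {s, t}

/-- Condition (2): no three-element subset `{s,t,u}` with `m(s,t)`, `m(t,u)` both odd. -/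
def Cond2 {W : Type*} [Group W] (S : Set W) : Prop :=
  ¬ ∃ s ∈ S, ∃ t ∈ S, ∃ u ∈ S, s ≠ t ∧ t ≠ u ∧ s ≠ u ∧
    Odd (orderOf (s * t)) ∧ Odd (orderOf (t * u))

/-- Condition (3): each odd pair meets at most two maximal spherical subsets. -/
def Cond3 {W : Type*} [Group W] (S : Set W) : Prop :=
  ∀ s ∈ S, ∀ t ∈ S, s ≠ t → Odd (orderOf (s * t)) →
    ∀ T₁ T₂ T₃ : Set W,
      (IsMaxSpherical S T₁ ∧ (T₁ ∩ {s, t}).Nonempty) →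
      (IsMaxSpherical S T₂ ∧ (T₂ ∩ {s, t}).Nonempty) →
      (IsMaxSpherical S T₃ ∧ (T₃ ∩ {s, t}).Nonempty) →
      T₁ = T₂ ∨ T₁ = T₃ ∨ T₂ = T₃

/-- Conditions (0)–(3) of the main theorem. -/
def Conds {W : Type*} [Group W] (S : Set W) : Prop :=
  Cond0 S ∧ Cond1 S ∧ Cond2 S ∧ Cond3 S

/-- `A τ A'`: equality of images in the abelianization of `W'`:
`π'(φ(W_A)) = π'(W'_{A'})`. -/
def Tau {W W' : Type*} [Group W] [Group W'] (φ : W →* W') (A : Set W) (A' : Set W') : Prop :=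
  Subgroup.map ((Abelianization.of).comp φ) (Subgroup.closure A) =
  Subgroup.map Abelianization.of (Subgroup.closure A')

namespace RG

section geom
variable {B : Type*} (M : CoxeterMatrix B)

noncomputable def cc (i j : B) : ℝ := -2 * Real.cos (Real.pi / M i j)

theorem cc_self (i : B) : cc M i i = 2 := by
  simp [cc]

theorem cc_comm (i j : B) : cc M i j = cc M j i := by
  simp [cc, M.symmetric i j]

theorem M_ge_two {i j : B} (h : i ≠ j) (h0 : M i j ≠ 0) : 2 ≤ M i j := by
  have := M.off_diagonal i j h
  omega

theorem cc_nonpos {i j : B} (h : i ≠ j) : cc M i j ≤ 0 := by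
  unfold cc
  rcases Nat.eq_zero_or_pos (M i j) with h0 | h0
  · simp [h0]
  · have h2 := M_ge_two M h (by omega)
    have h2' : (2:ℝ) ≤ M i j := by exact_mod_cast h2
    have : 0 ≤ Real.cos (Real.pi / M i j) := by
      apply Real.cos_nonneg_of_neg_pi_div_two_le_of_le
      · have : 0 ≤ Real.pi / M i j := by positivity
        linarith [Real.pi_pos]
      · apply div_le_div_of_nonneg_left Real.pi_pos.le (by norm_num) h2'
    linarith

/-- if `M i j` is not `2`, then `cc ≤ -1`. -/
theorem cc_le {i j : B} (h : i ≠ j) (n : ℕ) (hn : 2 ≤ n) (h2 : M i j = 0 ∨ n ≤ M i j) :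
    cc M i j ≤ -2 * Real.cos (Real.pi / n) := by
  unfold cc
  have : Real.cos (Real.pi / n) ≤ Real.cos (Real.pi / M i j) := by
    rcases h2 with h2 | h2
    · simp [h2, Real.cos_le_one]
    · have hn' : (2:ℝ) ≤ n := by exact_mod_cast hn
      have h2' : (n:ℝ) ≤ M i j := by exact_mod_cast h2
      apply Real.cos_le_cos_of_nonneg_of_le_pi (by positivity)
      · exact div_le_self Real.pi_pos.le (by linarith)
      · exact div_le_div_of_nonneg_left Real.pi_pos.le (by linarith) h2'
  linarith

noncomputable def phi (i : B) : (B →₀ ℝ) →ₗ[ℝ] ℝ := Finsupp.linearCombination ℝ (cc M i)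

noncomputable def al (i : B) : B →₀ ℝ := Finsupp.single i 1

@[simp] theorem phi_al (i j : B) : phi M i (al j) = cc M i j := by
  simp [phi, al]

noncomputable def sig (i : B) : Module.End ℝ (B →₀ ℝ) :=
  LinearMap.id - (phi M i).smulRight (al i)

theorem sig_apply (i : B) (v : B →₀ ℝ) : sig M i v = v - phi M i v • al i := by
  simp [sig]

theorem sig_al (i j : B) : sig M i (al j) = al j - cc M i j • al i := by
  simp [sig_apply]

theorem sig_al_self (i : B) : sig M i (al i) = - al i := by
  rw [sig_al, cc_self]; module

theorem sig_sig (i : B) (v : B →₀ ℝ) : sig M i (sig M i v) = v := by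
  simp only [sig_apply, map_sub, map_smul, phi_al, cc_self, smul_eq_mul]
  module

theorem sig_mul_self (i : B) : sig M i * sig M i = 1 := by
  ext1 v
  exact LinearMap.ext fun x => by simp [sig_sig]

def qq (u : ℝ) : ℕ → ℝ
  | 0 => 0
  | 1 => 1
  | (n+2) => u * qq u (n+1) - qq u n

theorem qq_sin (θ : ℝ) (n : ℕ) : qq (2 * Real.cos θ) n * Real.sin θ = Real.sin (n * θ) := by
  induction n using Nat.strong_induction_on with
  | _ n ih =>
    match n with
    | 0 => simp [qq]
    | 1 => simp [qq]
    | (n+2) =>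
      have h1 := ih (n+1) (by omega)
      have h0 := ih n (by omega)
      simp only [qq]
      have e1 : ((n+2 : ℕ) : ℝ) * θ = ((n+1:ℕ):ℝ) * θ + θ := by push_cast; ring
      have e0 : ((n : ℕ) : ℝ) * θ = ((n+1:ℕ):ℝ) * θ - θ := by push_cast; ring
      rw [e0, Real.sin_sub] at h0
      rw [e1, Real.sin_add, sub_mul, h0, mul_assoc, h1]
      ring

theorem qq_two (n : ℕ) : qq 2 n = n := by
  induction n using Nat.strong_induction_on with
  | _ n ih =>
    match n with
    | 0 => simp [qq]
    | 1 => simp [qq]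
    | (n+2) =>
      simp only [qq, ih (n+1) (by omega), ih n (by omega)]
      push_cast; ring

theorem sin_pos_M {i j : B} (h : i ≠ j) (h0 : M i j ≠ 0) : 0 < Real.sin (Real.pi / M i j) := by
  have h2 := M_ge_two M h h0
  have h2' : (2:ℝ) ≤ M i j := by exact_mod_cast h2
  apply Real.sin_pos_of_pos_of_lt_pi (by positivity)
  exact div_lt_self Real.pi_pos (by linarith)

theorem qq_nonneg {i j : B} (h : i ≠ j) (n : ℕ) (hn : M i j = 0 ∨ n ≤ M i j) :
    0 ≤ qq (-cc M i j) n := by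
  by_cases h0 : M i j = 0
  · have : -cc M i j = 2 := by simp [cc, h0]
    rw [this, qq_two]; positivity
  · have hs := sin_pos_M M h h0
    have e : -cc M i j = 2 * Real.cos (Real.pi / M i j) := by simp [cc]
    have hq := qq_sin (Real.pi / M i j) n
    rw [← e] at hq
    have hn' : n ≤ M i j := by tauto
    have hM : (0:ℝ) < M i j := by positivity
    have : 0 ≤ Real.sin (n * (Real.pi / M i j)) := by
      apply Real.sin_nonneg_of_nonneg_of_le_pi (by positivity)
      have : (n:ℝ) ≤ M i j := by exact_mod_cast hn'
      calc (n:ℝ) * (Real.pi / M i j) ≤ M i j * (Real.pi / M i j) := by gcongr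
        _ = Real.pi := by field_simp
    rw [← hq] at this
    exact nonneg_of_mul_nonneg_left this hs

theorem sig_step_i (i j : B) (a b : ℝ) :
    sig M i (a • al i + b • al j) = ((-cc M i j) * b - a) • al i + b • al j := by
  simp only [map_add, map_smul, sig_al_self, sig_al]
  module

theorem sig_step_j (i j : B) (a b : ℝ) :
    sig M j (a • al i + b • al j) = a • al i + ((-cc M i j) * a - b) • al j := by
  simp only [map_add, map_smul, sig_al_self, sig_al, cc_comm M j i]
  module

theorem pow_al (i j : B) (k : ℕ) : ((sig M i * sig M j) ^ k) (al i) =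
    qq (-cc M i j) (2*k+1) • al i + qq (-cc M i j) (2*k) • al j := by
  induction k with
  | zero => simp [qq]
  | succ k ih =>
    rw [pow_succ']
    rw [Module.End.mul_apply, ih, Module.End.mul_apply, sig_step_j, sig_step_i]
    rfl

theorem qq_M {i j : B} (h : i ≠ j) (h0 : M i j ≠ 0) :
    qq (-cc M i j) (2 * M i j) = 0 ∧ qq (-cc M i j) (2 * M i j + 1) = 1 := by
  have hs := sin_pos_M M h h0
  have e : -cc M i j = 2 * Real.cos (Real.pi / M i j) := by simp [cc]
  have hM : (M i j : ℝ) ≠ 0 := by exact_mod_cast h0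
  constructor
  · have hq := qq_sin (Real.pi / M i j) (2 * M i j)
    rw [← e] at hq
    have : ((2 * M i j : ℕ) : ℝ) * (Real.pi / M i j) = 2 * Real.pi := by
      push_cast; field_simp
    rw [this, Real.sin_two_pi] at hq
    rcases mul_eq_zero.1 hq with h | h
    · exact h
    · exact absurd h hs.ne'
  · have hq := qq_sin (Real.pi / M i j) (2 * M i j + 1)
    rw [← e] at hq
    have : ((2 * M i j + 1: ℕ) : ℝ) * (Real.pi / M i j) = (Real.pi / M i j) + 2 * Real.pi := by
      push_cast; field_simp; ring
    rw [this, Real.sin_add_two_pi] at hq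
    exact mul_right_cancel₀ hs.ne' (hq.trans (one_mul _).symm)

theorem four_sub_ne {i j : B} (h : i ≠ j) (h0 : M i j ≠ 0) : 4 - cc M i j ^ 2 ≠ 0 := by
  have hs := sin_pos_M M h h0
  have : 4 - cc M i j ^ 2 = 4 * Real.sin (Real.pi / M i j) ^ 2 := by
    rw [Real.sin_sq, cc]; ring
  rw [this]; positivity

theorem sig_liftable : M.IsLiftable (sig M) := by
  intro i j
  by_cases hij : i = j
  · subst hij; simp [sig_mul_self]
  by_cases h0 : M i j = 0
  · simp [h0]
  have hinv : ∀ k : ℕ, (sig M i * sig M j) ^ k * (sig M j * sig M i) ^ k = 1 := by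
    intro k
    induction k with
    | zero => simp
    | succ k ih =>
      rw [pow_succ, pow_succ']
      calc _ = (sig M i * sig M j) ^ k * (sig M i * (sig M j * sig M j) * sig M i) *
          (sig M j * sig M i) ^ k := by noncomm_ring
        _ = 1 := by rw [sig_mul_self, mul_one, sig_mul_self, mul_one, ih]
  have h1 : ((sig M i * sig M j) ^ M i j) (al i) = al i := by
    rw [pow_al, (qq_M M hij h0).1, (qq_M M hij h0).2]; simp
  have h2' : ((sig M j * sig M i) ^ M i j) (al j) = al j := by
    have h0' : M j i ≠ 0 := by rwa [M.symmetric]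
    rw [M.symmetric i j, pow_al, (qq_M M (Ne.symm hij) h0').1, (qq_M M (Ne.symm hij) h0').2]; simp
  have h2 : ((sig M i * sig M j) ^ M i j) (al j) = al j := by
    have := congrArg (fun f => f (al j)) (hinv (M i j))
    simp only [Module.End.mul_apply, Module.End.one_apply] at this
    rwa [h2'] at this
  apply LinearMap.ext
  intro v
  have hd := four_sub_ne M hij h0
  set c := cc M i j with hc
  obtain ⟨a, b, ha, hb⟩ : ∃ a b : ℝ, 2 * a + c * b = phi M i v ∧ c * a + 2 * b = phi M j v := by
    refine ⟨(2 * phi M i v - c * phi M j v) / (4 - c^2), (2 * phi M j v - c * phi M i v)/(4 - c^2),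
      ?_, ?_⟩ <;> field_simp <;> ring
  set z := v - (a • al i + b • al j) with hz
  have zi : sig M i z = z := by
    rw [sig_apply]
    have : phi M i z = 0 := by
      simp [hz, cc_self, ← hc]; linarith
    simp [this]
  have zj : sig M j z = z := by
    rw [sig_apply]
    have : phi M j z = 0 := by
      simp [hz, cc_self, cc_comm M j i, ← hc]; linarith
    simp [this]
  have zp : ∀ k : ℕ, ((sig M i * sig M j) ^ k) z = z := by
    intro k
    induction k with
    | zero => simp
    | succ k ih => rw [pow_succ, Module.End.mul_apply, Module.End.mul_apply, zj, zi, ih]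
  have hv : v = z + (a • al i + b • al j) := by simp [hz]
  rw [hv, map_add, map_add, map_smul, map_smul, h1, h2, zp]
  simp

end geom

section rep
variable {B W : Type*} [Group W] {M : CoxeterMatrix B} (cs : CoxeterSystem M W)

noncomputable def rho : W →* Module.End ℝ (B →₀ ℝ) := cs.lift ⟨sig M, sig_liftable M⟩

@[simp] theorem rho_simple (i : B) : rho cs (cs.simple i) = sig M i := by
  simp [rho]

theorem rho_mul (v w : W) (x : B →₀ ℝ) : rho cs (v * w) x = rho cs v (rho cs w x) := by
  rw [map_mul]; rfl

@[simp] theorem rho_inv_self (w : W) (x : B →₀ ℝ) : rho cs w⁻¹ (rho cs w x) = x := by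
  rw [← rho_mul]; simp

@[simp] theorem rho_self_inv (w : W) (x : B →₀ ℝ) : rho cs w (rho cs w⁻¹ x) = x := by
  rw [← rho_mul]; simp

theorem orderOf_simple_mul (i j : B) : orderOf (cs.simple i * cs.simple j) = M i j := by
  by_cases hij : i = j
  · subst hij; simp
  have key : ∀ k : ℕ, (cs.simple i * cs.simple j) ^ k = 1 →
      qq (-cc M i j) (2*k+1) = 1 ∧ qq (-cc M i j) (2*k) = 0 := by
    intro k hk
    have := congrArg (fun w => rho cs w (al i)) hk
    simp only [map_pow, map_mul, rho_simple, pow_al, map_one, Module.End.one_apply] at this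
    have h1 := congrArg (fun f => f i) this
    have h2 := congrArg (fun f => f j) this
    simp [al, hij, Ne.symm hij] at h1 h2
    exact ⟨h1, h2⟩
  by_cases h0 : M i j = 0
  · rw [h0, orderOf_eq_zero_iff']
    intro n hn hk
    have h := (key n hk).2
    have : -cc M i j = 2 := by simp [cc, h0]
    rw [this, qq_two] at h
    have : 2 * n = 0 := by exact_mod_cast h
    omega
  · rw [orderOf_eq_iff (Nat.pos_of_ne_zero h0)]
    refine ⟨cs.simple_mul_simple_pow i j, ?_⟩
    intro k hk hk0 h
    obtain ⟨h1, h2⟩ := key k h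
    have hs := sin_pos_M M hij h0
    have e : -cc M i j = 2 * Real.cos (Real.pi / M i j) := by simp [cc]
    have q1 := qq_sin (Real.pi / M i j) (2*k+1)
    have q2 := qq_sin (Real.pi / M i j) (2*k)
    rw [← e, h1] at q1
    rw [← e, h2] at q2
    set θ := Real.pi / M i j
    have e1 : ((2 * k + 1 : ℕ):ℝ) * θ = ((2*k:ℕ):ℝ) * θ + θ := by push_cast; ring
    rw [e1, Real.sin_add, ← q2] at q1
    have hc : Real.cos (((2*k:ℕ):ℝ) * θ) = 1 := by
      have : Real.sin θ * (Real.cos (((2*k:ℕ):ℝ) * θ) - 1) = 0 := by linarith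
      rcases mul_eq_zero.1 this with h | h
      · exact absurd h hs.ne'
      · linarith
    have hM : (0:ℝ) < M i j := by positivity
    have hk' : (k:ℝ) < M i j := by exact_mod_cast hk
    have hkp : (0:ℝ) < k := by exact_mod_cast hk0
    rw [Real.cos_eq_one_iff_of_lt_of_lt] at hc
    · have : ((2*k:ℕ):ℝ) * θ > 0 := by
        have : 0 < θ := div_pos Real.pi_pos hM
        push_cast; positivity
      linarith
    · have : 0 ≤ ((2*k:ℕ):ℝ) * θ := by
        have : 0 < θ := div_pos Real.pi_pos hM
        positivity
      linarith [Real.pi_pos]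
    · have : (M i j : ℝ) * θ = Real.pi := by simp only [θ]; field_simp
      push_cast
      have hθ : 0 < θ := div_pos Real.pi_pos hM
      nlinarith

theorem alt_al (i j : B) (n : ℕ) :
    rho cs (cs.wordProd (CoxeterSystem.alternatingWord i j n)) (al i) =
    if Even n then qq (-cc M i j) (n+1) • al i + qq (-cc M i j) n • al j
    else qq (-cc M i j) n • al i + qq (-cc M i j) (n+1) • al j := by
  induction n with
  | zero => simp [CoxeterSystem.alternatingWord, qq]
  | succ n ih =>
    rw [CoxeterSystem.alternatingWord_succ', cs.wordProd_cons, rho_mul, ih]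
    by_cases hn : Even n
    · have : ¬ Even (n+1) := by simpa [Nat.even_add_one] using hn
      simp only [hn, this, if_true, if_false, rho_simple]
      rw [sig_step_j]; rfl
    · have : Even (n+1) := by simpa [Nat.even_add_one] using hn
      simp only [hn, this, if_true, if_false, rho_simple]
      rw [sig_step_i]; rfl

theorem rho_pos (w : W) (i : B) (h : cs.length w < cs.length (w * cs.simple i)) :
    0 ≤ rho cs w (al i) := by
  induction hl : cs.length w using Nat.strong_induction_on generalizing w i with
  | _ l ih =>
  by_cases hw : w = 1
  · subst hw; simp [al]
  obtain ⟨j, hj⟩ := cs.exists_rightDescent_of_ne_one hw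
  unfold CoxeterSystem.IsRightDescent at hj
  have hij : i ≠ j := by rintro rfl; omega
  -- maximal alternating suffix
  let P : ℕ → Prop := fun n => ∃ v, w = v * cs.wordProd (CoxeterSystem.alternatingWord i j n) ∧
    cs.length w = cs.length v + n
  have hP1 : P 1 := by
    refine ⟨w * cs.simple j, by simp [CoxeterSystem.alternatingWord], ?_⟩
    rcases cs.length_mul_simple w j with h | h <;> omega
  have hPb : ∀ n, P n → n ≤ cs.length w := by rintro n ⟨v, -, h⟩; omega
  classical
  obtain ⟨n, hn1, hPn, hmax⟩ : ∃ n, 1 ≤ n ∧ P n ∧ ¬ P (n+1) := by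
    by_contra! hcon
    have : ∀ n, 1 ≤ n → P n := by
      intro n hn
      induction n, hn using Nat.le_induction with
      | base => exact hP1
      | succ n hn ihn => exact hcon n hn ihn
    have := hPb _ (this (cs.length w + 1) (by omega))
    omega
  obtain ⟨v, hwv, hlv⟩ := hPn
  -- the first letter and the other letter
  have hup : ∀ k : B, (k = i ∨ k = j) → cs.length v < cs.length (v * cs.simple k) := by
    intro k hk
    by_contra hlt
    have hlt : cs.length (v * cs.simple k) + 1 = cs.length v := by
      rcases cs.length_mul_simple v k with h | h <;> omega
    by_cases hkn : k = if Even n then j else i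
    · apply hmax
      refine ⟨v * cs.simple k, ?_, by omega⟩
      rw [CoxeterSystem.alternatingWord_succ', cs.wordProd_cons, ← hkn]
      simp [mul_assoc, hwv]
    · obtain ⟨n, rfl⟩ : ∃ m, n = m + 1 := ⟨n-1, by omega⟩
      have hk2 : k = if Even n then j else i := by
        by_cases he : Even n
        · have : ¬ Even (n+1) := by simpa [Nat.even_add_one] using he
          simp only [he, this, if_true, if_false] at hkn ⊢; tauto
        · have : Even (n+1) := by simpa [Nat.even_add_one] using he
          simp only [he, this, if_true, if_false] at hkn ⊢; tauto
      rw [CoxeterSystem.alternatingWord_succ', cs.wordProd_cons, ← hk2, ← mul_assoc] at hwv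
      have h1 := cs.length_mul_le (v * cs.simple k)
        (cs.wordProd (CoxeterSystem.alternatingWord i j n))
      have h2 := cs.length_wordProd_le (CoxeterSystem.alternatingWord i j n)
      rw [CoxeterSystem.length_alternatingWord] at h2
      rw [← hwv] at h1
      omega
  have hvi := ih (cs.length v) (by omega) v i (hup i (Or.inl rfl)) rfl
  have hvj := ih (cs.length v) (by omega) v j (hup j (Or.inr rfl)) rfl
  have hred : cs.IsReduced (CoxeterSystem.alternatingWord i j n) := by
    unfold CoxeterSystem.IsReduced
    have h2 := cs.length_wordProd_le (CoxeterSystem.alternatingWord i j n)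
    have h1 := cs.length_mul_le v (cs.wordProd (CoxeterSystem.alternatingWord i j n))
    rw [CoxeterSystem.length_alternatingWord] at h2 ⊢
    rw [← hwv] at h1
    omega
  have hnM : M i j = 0 ∨ n + 1 ≤ M i j := by
    by_contra! hcon
    obtain ⟨h0, h1⟩ := hcon
    have hnle : n ≤ M i j := by
      by_contra hlt
      exact cs.not_isReduced_alternatingWord i j h0 (by omega) hred
    have hnM : n = M i j := by omega
    have hb := cs.wordProd_braidWord_eq i j
    unfold CoxeterSystem.braidWord at hb
    rw [hnM, hb, M.symmetric j i, ← hnM] at hwv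
    obtain ⟨n, rfl⟩ : ∃ m, n = m + 1 := ⟨n-1, by omega⟩
    rw [CoxeterSystem.alternatingWord_succ, cs.wordProd_concat] at hwv
    have hws : w * cs.simple i = v * cs.wordProd (CoxeterSystem.alternatingWord i j n) := by
      rw [hwv]; simp [mul_assoc]
    have h1 := cs.length_mul_le v (cs.wordProd (CoxeterSystem.alternatingWord i j n))
    have h2 := cs.length_wordProd_le (CoxeterSystem.alternatingWord i j n)
    rw [CoxeterSystem.length_alternatingWord] at h2
    rw [← hws] at h1
    omega
  have q1 := qq_nonneg M hij (n+1) hnM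
  have q0 := qq_nonneg M hij n (by omega)
  rw [hwv, rho_mul, alt_al]
  split_ifs <;> simp only [map_add, map_smul] <;>
    exact add_nonneg (smul_nonneg (by assumption) hvi) (smul_nonneg (by assumption) hvj)

end rep
end RG

namespace RG

section form
variable {B : Type*} (M : CoxeterMatrix B)

noncomputable def bf : (B →₀ ℝ) →ₗ[ℝ] (B →₀ ℝ) →ₗ[ℝ] ℝ := Finsupp.linearCombination ℝ (phi M)

theorem bf_al_left (i : B) (v : B →₀ ℝ) : bf M (al i) v = phi M i v := by
  simp [bf, al]

theorem bf_al_right (v : B →₀ ℝ) (i : B) : bf M v (al i) = phi M i v := by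
  induction v using Finsupp.induction_linear with
  | zero => simp
  | add f g hf hg => simp [hf, hg]
  | single j a =>
    have : (Finsupp.single j a : B →₀ ℝ) = a • al j := by simp [al]
    rw [this]
    simp [bf_al_left, cc_comm M i j]

theorem bf_sig (i : B) (v w : B →₀ ℝ) : bf M (sig M i v) (sig M i w) = bf M v w := by
  simp only [sig_apply, map_sub, map_smul, LinearMap.sub_apply, LinearMap.smul_apply,
    bf_al_left, bf_al_right, phi_al, cc_self, smul_eq_mul]
  ring

end form

section rep
variable {B W : Type*} [Group W] {M : CoxeterMatrix B} (cs : CoxeterSystem M W)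

theorem bf_rho (g : W) (v w : B →₀ ℝ) : bf M (rho cs g v) (rho cs g w) = bf M v w := by
  induction g using cs.simple_induction_left with
  | one => simp
  | mul_simple_left w i ih => simp only [rho_mul, rho_simple, bf_sig, ih]

theorem rho_inj (w : W) : Function.Injective (rho cs w) := by
  intro x y h
  have := congrArg (rho cs w⁻¹) h
  simpa using this

theorem al_ne_zero (i : B) : (al i : B →₀ ℝ) ≠ 0 := by simp [al]

theorem al_nonneg (i : B) : (0 : B →₀ ℝ) ≤ al i := by simp [al]

theorem rho_al_ne (w : W) (i : B) : rho cs w (al i) ≠ 0 := by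
  intro h
  exact al_ne_zero i (rho_inj cs w (by simpa using h))

theorem rho_mul_simple_al (w : W) (i : B) :
    rho cs (w * cs.simple i) (al i) = - rho cs w (al i) := by
  rw [rho_mul, rho_simple, sig_al_self, map_neg]

theorem rho_neg (w : W) (i : B) (h : cs.length (w * cs.simple i) < cs.length w) :
    rho cs w (al i) ≤ 0 := by
  have := rho_pos cs (w * cs.simple i) i (by simpa using h)
  rw [rho_mul_simple_al] at this
  simpa using this

theorem rho_pos' (w : W) (i : B) (h : ¬ rho cs w (al i) ≤ 0) :
    cs.length w < cs.length (w * cs.simple i) := by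
  by_contra hcon
  apply h
  apply rho_neg
  have := cs.length_mul_simple_ne w i
  omega

theorem not_pos_neg {v : B →₀ ℝ} (h : 0 ≤ v) (h' : v ≤ 0) : v = 0 := le_antisymm h' h

theorem faithful (w : W) (h : ∀ i, rho cs w (al i) = al i) : w = 1 := by
  by_contra hw
  obtain ⟨i, hi⟩ := cs.exists_rightDescent_of_ne_one hw
  have := rho_neg cs w i hi
  rw [h i] at this
  exact al_ne_zero i (not_pos_neg (al_nonneg i) this)

def Rts : Set (B →₀ ℝ) := {β | ∃ w i, β = rho cs w (al i)}

theorem Rts_rho {β : B →₀ ℝ} (h : β ∈ Rts cs) (w : W) : rho cs w β ∈ Rts cs := by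
  obtain ⟨v, i, rfl⟩ := h
  exact ⟨w * v, i, by rw [rho_mul]⟩

theorem Rts_al (i : B) : al i ∈ Rts cs := ⟨1, i, by simp⟩

theorem Rts_ne {β : B →₀ ℝ} (h : β ∈ Rts cs) : β ≠ 0 := by
  obtain ⟨v, i, rfl⟩ := h; exact rho_al_ne cs v i

theorem Rts_pm {β : B →₀ ℝ} (h : β ∈ Rts cs) : 0 ≤ β ∨ β ≤ 0 := by
  obtain ⟨v, i, rfl⟩ := h
  by_cases h : rho cs v (al i) ≤ 0
  · exact Or.inr h
  · exact Or.inl (rho_pos cs v i (rho_pos' cs v i h))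

theorem Rts_neg {β : B →₀ ℝ} (h : β ∈ Rts cs) : -β ∈ Rts cs := by
  obtain ⟨v, i, rfl⟩ := h
  exact ⟨v * cs.simple i, i, by rw [rho_mul_simple_al]⟩

theorem Rts_mul {c : ℝ} {i : B} (h : c • al i ∈ Rts cs) (h0 : 0 ≤ c) : c = 1 := by
  obtain ⟨v, j, hv⟩ := h
  have h1 := bf_rho cs v (al j) (al j)
  rw [← hv] at h1
  simp [bf_al_left, cc_self] at h1
  nlinarith

theorem Rts_sig {β : B →₀ ℝ} (h : β ∈ Rts cs) (hp : 0 ≤ β) (i : B) (hn : ¬ 0 ≤ sig M i β) :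
    β = al i := by
  have hr : sig M i β ∈ Rts cs := by
    have := Rts_rho cs h (cs.simple i); rwa [rho_simple] at this
  have hneg : sig M i β ≤ 0 := (Rts_pm cs hr).resolve_left hn
  have hb : β = (β i) • al i := by
    ext j
    by_cases hj : j = i
    · subst hj; simp [al]
    · have h1 := hneg j
      have h2 := hp j
      rw [sig_apply] at h1
      simp [al, Ne.symm hj] at h1 h2 ⊢
      linarith
  have := Rts_mul cs (hb ▸ h : (β i) • al i ∈ Rts cs) (by simpa using hp i)
  rw [hb, this, one_smul]

def Inv (w : W) : Set (B →₀ ℝ) := {β | β ∈ Rts cs ∧ 0 ≤ β ∧ ¬ 0 ≤ rho cs w β}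

theorem Inv_finite (w : W) : (Inv cs w).Finite := by
  induction w using cs.simple_induction_left with
  | one =>
    have : Inv cs (1 : W) = ∅ := by
      ext β; simp only [Inv, map_one, Module.End.one_apply, Set.mem_setOf_eq]; tauto
    rw [this]; exact Set.finite_empty
  | mul_simple_left w i ih =>
    apply (ih.union (Set.finite_singleton (rho cs w⁻¹ (al i)))).subset
    rintro β ⟨h1, h2, h3⟩
    by_cases h : 0 ≤ rho cs w β
    · right
      rw [rho_mul, rho_simple] at h3
      have := Rts_sig cs (Rts_rho cs h1 w) h i h3
      simp [← this]
    · left; exact ⟨h1, h2, h⟩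

/-! parabolic subgroups -/

def Par (T : Set B) : Subgroup W := Subgroup.closure (cs.simple '' T)

theorem simple_mem_Par {T : Set B} {i : B} (h : i ∈ T) : cs.simple i ∈ Par cs T :=
  Subgroup.subset_closure ⟨i, h, rfl⟩

theorem Par_mono {T U : Set B} (h : T ⊆ U) : Par cs T ≤ Par cs U :=
  Subgroup.closure_mono (Set.image_mono h)

theorem Par_induction {T : Set B} {p : W → Prop} (one : p 1)
    (step : ∀ w, w ∈ Par cs T → ∀ i ∈ T, p w → p (cs.simple i * w)) {w : W} (hw : w ∈ Par cs T) :
    p w := by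
  have := Subgroup.closure_induction_left (p := fun w _ => p w) one
    (fun x hx y hy ih => by
      obtain ⟨i, hi, rfl⟩ := hx
      exact step y hy i hi ih)
    (fun x hx y hy ih => by
      obtain ⟨i, hi, rfl⟩ := hx
      rw [cs.inv_simple]
      exact step y hy i hi ih) hw
  exact this

theorem Par_coord {T : Set B} {w : W} (hw : w ∈ Par cs T) (v : B →₀ ℝ) {b : B} (hb : b ∉ T) :
    (rho cs w v) b = v b := by
  refine Par_induction cs (p := fun w => (rho cs w v) b = v b) (by simp) ?_ hw
  intro w hw i hi ih
  rw [rho_mul, rho_simple, sig_apply]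
  have : i ≠ b := by rintro rfl; exact hb hi
  simp [al, this, ih]

variable (M) in
def resM (T : Set B) : CoxeterMatrix T where
  M := fun a b => M a b
  isSymm := by ext a b; exact M.symmetric _ _
  diagonal := fun a => M.diagonal a
  off_diagonal := fun a b h => M.off_diagonal a b (fun h' => h (Subtype.ext h'))

@[simp] theorem resM_apply (T : Set B) (a b : T) : resM M T a b = M a b := rfl

theorem res_liftable (T : Set B) : (resM M T).IsLiftable (fun t => cs.simple t) := by
  intro a b; exact cs.simple_mul_simple_pow a b

noncomputable def resHom (T : Set B) : (resM M T).Group →* W :=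
  (resM M T).toCoxeterSystem.lift ⟨fun t => cs.simple t, res_liftable cs T⟩

theorem resHom_simple (T : Set B) (t : T) :
    resHom cs T ((resM M T).toCoxeterSystem.simple t) = cs.simple t := by
  simp only [resHom]
  exact (resM M T).toCoxeterSystem.lift_apply_simple (res_liftable cs T) t

noncomputable def iot (T : Set B) : (T →₀ ℝ) →ₗ[ℝ] (B →₀ ℝ) := Finsupp.lmapDomain ℝ ℝ Subtype.val

theorem iot_al (T : Set B) (t : T) : iot T (al t) = al (t : B) := by
  simp [iot, al]

theorem iot_inj (T : Set B) : Function.Injective (iot T) :=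
  Finsupp.mapDomain_injective Subtype.val_injective

theorem iot_sig (T : Set B) (t : T) (v : T →₀ ℝ) :
    iot T (sig (resM M T) t v) = sig M t (iot T v) := by
  have : phi M t (iot T v) = phi (resM M T) t v := by
    induction v using Finsupp.induction_linear with
    | zero => simp
    | add f g hf hg => simp [hf, hg]
    | single j a =>
      have : (Finsupp.single j a : T →₀ ℝ) = a • al j := by simp [al]
      rw [this]
      simp [iot_al, cc]
  rw [sig_apply, sig_apply, this, map_sub, map_smul, iot_al]

theorem iot_rho (T : Set B) (g : (resM M T).Group) (v : T →₀ ℝ) :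
    iot T (rho (resM M T).toCoxeterSystem g v) = rho cs (resHom cs T g) (iot T v) := by
  induction g using (resM M T).toCoxeterSystem.simple_induction_left with
  | one => simp
  | mul_simple_left w i ih =>
    rw [rho_mul, rho_simple, iot_sig, ih, map_mul, rho_mul, resHom_simple, rho_simple]

theorem resHom_inj (T : Set B) : Function.Injective (resHom cs T) := by
  rw [injective_iff_map_eq_one]
  intro g hg
  apply faithful (resM M T).toCoxeterSystem
  intro i
  apply iot_inj T
  rw [iot_rho cs, hg]; simp

theorem resHom_range (T : Set B) : (resHom cs T).range = Par cs T := by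
  rw [MonoidHom.range_eq_map, ← (resM M T).toCoxeterSystem.subgroup_closure_range_simple,
    MonoidHom.map_closure, Par]
  congr 1
  ext w
  constructor
  · rintro ⟨_, ⟨t, rfl⟩, rfl⟩
    exact ⟨t, t.2, (resHom_simple cs T t).symm⟩
  · rintro ⟨i, hi, rfl⟩
    exact ⟨_, ⟨⟨i, hi⟩, rfl⟩, resHom_simple cs T ⟨i, hi⟩⟩

/-- A parabolic subgroup is a Coxeter group. -/
noncomputable def parCS (T : Set B) : CoxeterSystem (resM M T) (Par cs T) :=
  (resM M T).toCoxeterSystem.map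
    ((MonoidHom.ofInjective (resHom_inj cs T)).trans (MulEquiv.subgroupCongr (resHom_range cs T)))

theorem parCS_simple (T : Set B) (t : T) : ((parCS cs T).simple t : W) = cs.simple t := by
  simp only [parCS, CoxeterSystem.map_simple, MulEquiv.trans_apply]
  exact resHom_simple cs T t

theorem Par_finite (T : Set B) [Finite B] (h : {β | β ∈ Rts cs ∧ ∀ b ∉ T, β b = 0}.Finite) :
    Finite (Par cs T) := by
  have := h.to_subtype
  let f : Par cs T → (T → {β | β ∈ Rts cs ∧ ∀ b ∉ T, β b = 0}) := fun w t =>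
    ⟨rho cs w (al (t:B)), Rts_rho cs (Rts_al cs _) _, fun b hb => by
      rw [Par_coord cs w.2 _ hb]
      have : (t:B) ≠ b := by rintro rfl; exact hb t.2
      simp [al, this]⟩
  apply Finite.of_injective f
  intro w w' hww
  have key : ∀ t : T, rho cs (w : W) (al (t:B)) = rho cs (w' : W) (al (t:B)) := fun t => by
    have := congrFun hww t
    simpa [f] using this
  -- pull back to the group of T
  obtain ⟨g, hg⟩ : (w : W) ∈ (resHom cs T).range := by rw [resHom_range]; exact w.2
  obtain ⟨g', hg'⟩ : (w' : W) ∈ (resHom cs T).range := by rw [resHom_range]; exact w'.2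
  have : g'⁻¹ * g = 1 := by
    apply faithful (resM M T).toCoxeterSystem
    intro i
    apply iot_inj T
    rw [iot_rho cs, iot_al, map_mul, map_inv, hg, hg', rho_mul, key]
    simp
  have : g = g' := by rwa [inv_mul_eq_one, eq_comm] at this
  apply Subtype.ext
  rw [← hg, ← hg', this]

/-- dominance -/
theorem exists_dominant (f : (B →₀ ℝ) →ₗ[ℝ] ℝ) (hf : {β | β ∈ Rts cs ∧ 0 ≤ β ∧ f β < 0}.Finite) :
    ∃ w : W, ∀ i, 0 ≤ f (rho cs w (al i)) := by
  induction hn : {β | β ∈ Rts cs ∧ 0 ≤ β ∧ f β < 0}.ncard using Nat.strong_induction_on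
    generalizing f with
  | _ n ih =>
  by_cases hd : ∀ i, 0 ≤ f (al i)
  · exact ⟨1, by simpa using hd⟩
  push Not at hd
  obtain ⟨i, hi⟩ := hd
  set f' := f ∘ₗ sig M i with hf'
  have hsub : {β | β ∈ Rts cs ∧ 0 ≤ β ∧ f' β < 0} ⊆
      (sig M i) '' ({β | β ∈ Rts cs ∧ 0 ≤ β ∧ f β < 0} \ {al i}) := by
    rintro β ⟨h1, h2, h3⟩
    refine ⟨sig M i β, ⟨⟨?_, ?_, h3⟩, ?_⟩, sig_sig M i β⟩
    · have := Rts_rho cs h1 (cs.simple i); rwa [rho_simple] at this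
    · by_contra hcon
      have := Rts_sig cs h1 h2 i hcon
      subst this
      simp only [hf', LinearMap.comp_apply, sig_al_self, map_neg] at h3
      linarith
    · intro h
      have h : sig M i β = al i := h
      have : β = - al i := by rw [← sig_sig M i β, h, sig_al_self]
      rw [this] at h2
      have h2 : al i ≤ (0 : B →₀ ℝ) := by simpa using h2
      exact al_ne_zero i (not_pos_neg (al_nonneg i) h2)
  have hfin' : ({β | β ∈ Rts cs ∧ 0 ≤ β ∧ f β < 0} \ {al i}).Finite := hf.subset Set.diff_subset
  have hlt : {β | β ∈ Rts cs ∧ 0 ≤ β ∧ f' β < 0}.ncard < n := by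
    calc _ ≤ _ := Set.ncard_le_ncard hsub (hfin'.image _)
      _ ≤ _ := Set.ncard_image_le hfin'
      _ < n := by
        rw [← hn]
        exact Set.ncard_diff_singleton_lt_of_mem ⟨Rts_al cs i, al_nonneg i, hi⟩ hf
  obtain ⟨w, hw⟩ := ih _ hlt f' ((hfin'.image _).subset hsub) rfl
  refine ⟨cs.simple i * w, fun j => ?_⟩
  rw [rho_mul, rho_simple]
  exact hw j

theorem stab_dominant (f : (B →₀ ℝ) →ₗ[ℝ] ℝ) (hf : ∀ i, 0 ≤ f (al i)) (v : W)
    (hv : ∀ x, f (rho cs v x) = f x) : v ∈ Par cs {i | f (al i) = 0} := by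
  induction hl : cs.length v using Nat.strong_induction_on generalizing v with
  | _ l ih =>
  by_cases h1 : v = 1
  · subst h1; exact one_mem _
  obtain ⟨i, hi⟩ := cs.exists_rightDescent_of_ne_one h1
  have hpos : ∀ x : B →₀ ℝ, 0 ≤ x → 0 ≤ f x := by
    intro x hx
    have : x = x.sum fun i a => a • al i := by
      conv_lhs => rw [← Finsupp.sum_single x]
      simp [al]
    rw [this, map_finsuppSum]
    apply Finsupp.sum_nonneg
    intro i _
    simp only [map_smul, smul_eq_mul]
    exact mul_nonneg (hx i) (hf i)
  have hneg := rho_neg cs v i hi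
  have h2 := hpos (- rho cs v (al i)) (by simpa using hneg)
  rw [map_neg, hv] at h2
  have h0 : f (al i) = 0 := le_antisymm (by linarith) (hf i)
  have hs : v * cs.simple i ∈ Par cs {i | f (al i) = 0} := by
    apply ih _ (by unfold CoxeterSystem.IsRightDescent at hi; omega) _ _ rfl
    intro x
    rw [rho_mul, hv, rho_simple, sig_apply, map_sub, map_smul, h0]; simp
  have := mul_mem hs (simple_mem_Par cs (T := {i | f (al i) = 0}) h0)
  simpa using this

/-- Every finite subgroup is conjugate into a finite parabolic subgroup. -/
theorem finite_subgroup [Finite B] (F : Subgroup W) [Finite F] :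
    ∃ (w : W) (T : Set B), Finite (Par cs T) ∧ ∀ g ∈ F, w⁻¹ * g * w ∈ Par cs T := by
  have := Fintype.ofFinite F
  let f0 : (B →₀ ℝ) →ₗ[ℝ] ℝ := Finsupp.linearCombination ℝ (fun _ => (1:ℝ))
  have hf0 : ∀ x : B →₀ ℝ, 0 ≤ x → x ≠ 0 → 0 < f0 x := by
    intro x hx hne
    have e : f0 x = ∑ i ∈ x.support, x i := by
      simp [f0, Finsupp.linearCombination_apply, Finsupp.sum]
    rw [e]
    apply Finset.sum_pos
    · intro i hi
      exact lt_of_le_of_ne (hx i) (Ne.symm (Finsupp.mem_support_iff.1 hi))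
    · rwa [Finsupp.support_nonempty_iff]
  let y : (B →₀ ℝ) →ₗ[ℝ] ℝ := ∑ g : F, f0 ∘ₗ rho cs (g : W)
  have hy : ∀ x, y x = ∑ g : F, f0 (rho cs (g : W) x) := by
    intro x; simp [y]
  have hyinv : ∀ h ∈ F, ∀ x, y (rho cs h x) = y x := by
    intro h hh x
    rw [hy, hy]
    rw [← Equiv.sum_comp (Equiv.mulRight (⟨h, hh⟩ : F)) (fun g : F => f0 (rho cs (g : W) x))]
    simp [rho_mul]
  have hfin : {β | β ∈ Rts cs ∧ 0 ≤ β ∧ y β ≤ 0}.Finite := by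
    apply (Set.finite_iUnion (fun g : F => Inv_finite cs (g : W))).subset
    rintro β ⟨h1, h2, h3⟩
    by_contra hcon
    simp only [Set.mem_iUnion, not_exists] at hcon
    have : 0 < y β := by
      rw [hy]
      apply Finset.sum_pos _ ⟨1, Finset.mem_univ _⟩
      intro g _
      apply hf0
      · by_contra h; exact hcon g ⟨h1, h2, h⟩
      · exact Rts_ne cs (Rts_rho cs h1 _)
    linarith
  obtain ⟨w, hw⟩ := exists_dominant cs y (hfin.subset (fun β h => ⟨h.1, h.2.1, h.2.2.le⟩))
  refine ⟨w, {i | (y ∘ₗ rho cs w) (al i) = 0}, ?_, ?_⟩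
  · apply Par_finite
    have hA : {β | β ∈ Rts cs ∧ 0 ≤ β ∧ y (rho cs w β) ≤ 0}.Finite := by
      have h1 : (rho cs w ⁻¹' {β | β ∈ Rts cs ∧ 0 ≤ β ∧ y β ≤ 0}).Finite :=
        hfin.preimage (rho_inj cs w).injOn
      apply (h1.union (Inv_finite cs w)).subset
      rintro β ⟨h1, h2, h3⟩
      by_cases h : 0 ≤ rho cs w β
      · exact Or.inl ⟨Rts_rho cs h1 w, h, h3⟩
      · exact Or.inr ⟨h1, h2, h⟩
    apply (hA.union (hA.image (fun β => -β))).subset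
    rintro β ⟨h1, h2⟩
    have h0 : y (rho cs w β) = 0 := by
      have : β = β.sum fun i a => a • al i := by
        conv_lhs => rw [← Finsupp.sum_single β]
        simp [al]
      rw [this, map_finsuppSum, map_finsuppSum]
      apply Finset.sum_eq_zero
      intro i _
      simp only [map_smul, smul_eq_mul]
      by_cases hi : y (rho cs w (al i)) = 0
      · simp [hi]
      · rw [h2 i hi]; simp
    rcases Rts_pm cs h1 with h | h
    · exact Or.inl ⟨h1, h, h0.le⟩
    · exact Or.inr ⟨-β, ⟨Rts_neg cs h1, by simpa using h, by simp [h0]⟩, by simp⟩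
  · intro g hg
    apply stab_dominant cs _ hw
    intro x
    simp [rho_mul, hyinv g hg]

end rep
end RG

namespace RG

section lin
variable {B : Type*}
theorem sum_al (x : B →₀ ℝ) : x = x.sum fun i a => a • al i := by
  conv_lhs => rw [← Finsupp.sum_single x]
  simp [al]

theorem lin_eval (L : Module.End ℝ (B →₀ ℝ)) (x : B →₀ ℝ) (b : B) :
    (L x) b = ∑ i ∈ x.support, x i * (L (al i)) b := by
  conv_lhs => rw [sum_al x]
  rw [Finsupp.sum, map_sum, Finsupp.finsetSum_apply]
  simp
end lin

section par
variable {B W : Type*} [Group W] {M : CoxeterMatrix B} (cs : CoxeterSystem M W)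

theorem longest {T : Set B} (h : Finite (Par cs T)) :
    ∃ w ∈ Par cs T, ∀ t ∈ T, rho cs w (al t) ≤ 0 := by
  obtain ⟨w, hw⟩ := Finite.exists_max (fun w : Par cs T => cs.length (w : W))
  refine ⟨w, w.2, fun t ht => ?_⟩
  apply rho_neg
  have h1 := hw ⟨w * cs.simple t, mul_mem w.2 (simple_mem_Par cs ht)⟩
  have := cs.length_mul_simple_ne w t
  simp only at h1
  omega

theorem of_simple_mem_Par {T : Set B} {t : B} (h : cs.simple t ∈ Par cs T) : t ∈ T := by
  by_contra hn
  have := Par_coord cs h (al t) hn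
  rw [rho_simple, sig_al_self] at this
  simp [al] at this
  linarith

def MaxSph (T : Set B) : Prop := Finite (Par cs T) ∧ ∀ U, Finite (Par cs U) → T ⊆ U → U = T

theorem maxsph_conj [Finite B] {T T' : Set B} (hT : MaxSph cs T) (hT' : Finite (Par cs T')) (w : W)
    (hw : ∀ g ∈ Par cs T, w * g * w⁻¹ ∈ Par cs T') : T = T' := by
  obtain ⟨d, hd, hmin⟩ := WellFounded.has_min (measure cs.length).wf
    {d | ∀ g ∈ Par cs T, d * g * d⁻¹ ∈ Par cs T'} ⟨w, hw⟩
  have hmin : ∀ x, (∀ g ∈ Par cs T, x * g * x⁻¹ ∈ Par cs T') → cs.length d ≤ cs.length x := by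
    intro x hx
    have := hmin x hx
    exact not_lt.1 this
  have hd : ∀ g ∈ Par cs T, d * g * d⁻¹ ∈ Par cs T' := hd
  have hpos : ∀ t ∈ T, 0 ≤ rho cs d (al t) := by
    intro t ht
    apply rho_pos
    have h1 := hmin (d * cs.simple t) (by
      intro g hg
      have := hd (cs.simple t * g * cs.simple t)
        (mul_mem (mul_mem (simple_mem_Par cs ht) hg) (simple_mem_Par cs ht))
      convert this using 1
      simp [mul_assoc])
    have := cs.length_mul_simple_ne d t
    omega
  have hpos' : ∀ u ∈ T', 0 ≤ rho cs d⁻¹ (al u) := by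
    intro u hu
    apply rho_pos
    have h1 := hmin (cs.simple u * d) (by
      intro g hg
      have := mul_mem (mul_mem (simple_mem_Par cs hu) (hd g hg)) (simple_mem_Par cs hu)
      convert this using 1
      simp [mul_assoc])
    have h2 := cs.length_mul_simple_ne d⁻¹ u
    have h3 : cs.length (d⁻¹ * cs.simple u) = cs.length (cs.simple u * d) := by
      rw [← cs.length_inv]; simp
    rw [cs.length_inv] at h2 ⊢
    omega
  have hsingle : ∀ t ∈ T, ∃ u ∈ T', rho cs d (al t) = al u := by
    intro t ht
    set β := rho cs d (al t) with hβ
    have hsupp : ∀ b ∉ T', β b = 0 := by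
      intro b hb
      have h1 := Par_coord cs (hd _ (simple_mem_Par cs ht)) β hb
      rw [hβ, rho_mul, rho_mul, rho_inv_self, rho_simple, sig_al_self, map_neg] at h1
      simp only [Finsupp.neg_apply] at h1
      rw [hβ]; linarith
    have hne : β ≠ 0 := rho_al_ne cs d t
    obtain ⟨u, hu⟩ := Finsupp.support_nonempty_iff.2 hne
    have hu0 : β u ≠ 0 := Finsupp.mem_support_iff.1 hu
    have huT : u ∈ T' := by by_contra h; exact hu0 (hsupp u h)
    refine ⟨u, huT, ?_⟩
    have hz : ∀ b, b ≠ t → (rho cs d⁻¹ (al u)) b = 0 := by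
      intro b hb
      have h1 := lin_eval (rho cs d⁻¹) β b
      rw [hβ, rho_inv_self, ← hβ] at h1
      have h2 : (al t : B →₀ ℝ) b = 0 := by simp [al, Ne.symm hb]
      rw [h2] at h1
      have h3 := (Finset.sum_eq_zero_iff_of_nonneg (by
        intro i hi
        have : i ∈ T' := by
          by_contra h; exact (Finsupp.mem_support_iff.1 hi) (hsupp i h)
        exact mul_nonneg (hpos t ht i) (hpos' i this b))).1 h1.symm u hu
      exact (mul_eq_zero.1 h3).resolve_left hu0
    have he : rho cs d⁻¹ (al u) = ((rho cs d⁻¹ (al u)) t) • al t := by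
      ext b
      by_cases hb : b = t
      · subst hb; simp [al]
      · rw [hz b hb]; simp [al, Ne.symm hb]
    have hr : rho cs d⁻¹ (al u) ∈ Rts cs := Rts_rho cs (Rts_al cs u) _
    rw [he] at hr
    have := Rts_mul cs hr (hpos' u huT t)
    rw [this, one_smul] at he
    rw [hβ, ← he, rho_self_inv]
  by_cases hd1 : d = 1
  · subst hd1
    have hsub : T ⊆ T' := fun t ht => by
      apply of_simple_mem_Par cs
      simpa using hd _ (simple_mem_Par cs ht)
    exact (hT.2 T' hT' hsub).symm
  exfalso
  obtain ⟨s, hs⟩ := cs.exists_rightDescent_of_ne_one hd1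
  have hneg := rho_neg cs d s hs
  have hsT : s ∉ T := fun h => rho_al_ne cs d s (not_pos_neg (hpos s h) hneg)
  set γ := rho cs d (al s) with hγ
  obtain ⟨u, hu, huT⟩ : ∃ u, γ u < 0 ∧ ∀ t ∈ T, (rho cs d (al t)) u = 0 := by
    by_contra! hcon
    have h1 := lin_eval (rho cs d⁻¹) γ s
    rw [hγ, rho_inv_self, ← hγ] at h1
    rw [Finset.sum_eq_zero] at h1
    · simp [al] at h1
    · intro u hu
      have hu0 := Finsupp.mem_support_iff.1 hu
      obtain ⟨t, ht, htu⟩ := hcon u (lt_of_le_of_ne (hneg u) hu0)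
      obtain ⟨u', hu', he⟩ := hsingle t ht
      rw [he] at htu
      have : u' = u := by
        by_contra h; apply htu; simp [al, h]
      subst this
      rw [← he, rho_inv_self]
      have : t ≠ s := by rintro rfl; exact hsT ht
      simp [al, this]
  obtain ⟨w0, hw0, hw0n⟩ := longest cs hT.1
  have hfinp : {β | β ∈ Rts cs ∧ 0 ≤ β ∧ ∀ b ∉ insert s T, β b = 0}.Finite := by
    apply ((Inv_finite cs d).union (Inv_finite cs w0)).subset
    rintro β ⟨h1, h2, h3⟩
    by_cases hs0 : β s = 0
    · right
      refine ⟨h1, h2, fun h4 => ?_⟩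
      apply Rts_ne cs (Rts_rho cs h1 w0)
      refine not_pos_neg h4 ?_
      intro b
      rw [lin_eval]
      apply Finset.sum_nonpos
      intro i hi
      have hi0 := Finsupp.mem_support_iff.1 hi
      have : i ∈ T := by
        by_contra hiT
        by_cases his : i = s
        · subst his; exact hi0 hs0
        · exact hi0 (h3 i (by simp [his, hiT]))
      exact mul_nonpos_of_nonneg_of_nonpos (h2 i) (hw0n i this b)
    · left
      refine ⟨h1, h2, fun h4 => ?_⟩
      have h5 := h4 u
      rw [lin_eval, Finset.sum_eq_single s] at h5
      · have : 0 < β s := lt_of_le_of_ne (h2 s) (Ne.symm hs0)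
        have := mul_neg_of_pos_of_neg this hu
        have h5 : 0 ≤ β s * γ u := h5
        linarith
      · intro i hi his
        have hi0 := Finsupp.mem_support_iff.1 hi
        have : i ∈ T := by
          by_contra hiT; exact hi0 (h3 i (by simp [his, hiT]))
        rw [huT i this, mul_zero]
      · intro h
        rw [Finsupp.notMem_support_iff] at h
        exact absurd h hs0
  have hfin : Finite (Par cs (insert s T)) := by
    apply Par_finite
    apply (hfinp.union (hfinp.image (fun β => -β))).subset
    rintro β ⟨h1, h2⟩
    rcases Rts_pm cs h1 with h | h
    · exact Or.inl ⟨h1, h, h2⟩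
    · exact Or.inr ⟨-β, ⟨Rts_neg cs h1, by simpa using h, fun b hb => by simp [h2 b hb]⟩, by simp⟩
  have := hT.2 _ hfin (Set.subset_insert s T)
  exact hsT (this ▸ Set.mem_insert s T)

theorem cc_pos {a b : B} (h : a ≠ b) (h2 : M a b ≠ 2) : cc M a b ≤ -1 := by
  have h3 : M a b = 0 ∨ 3 ≤ M a b := by
    by_cases h0 : M a b = 0
    · exact Or.inl h0
    · have := M_ge_two M h h0; omega
  have := cc_le M h 3 (by norm_num) h3
  push_cast at this
  rw [Real.cos_pi_div_three] at this
  linarith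

theorem comm_noncomm {a b c : B} (hab : a ≠ b) (hbc : b ≠ c) (hac : a ≠ c) (h0 : M a b ≠ 0)
    (h2 : M a b ≠ 2) (h2' : M b c ≠ 2) :
    ¬ Commute ((cs.simple a * cs.simple b) ^ 2) ((cs.simple b * cs.simple c) ^ 2) := by
  intro hcomm
  set u := - cc M a b with hu
  set k := - cc M b c with hk
  set v := - cc M a c with hv
  have hu1 : 1 ≤ u := by have := cc_pos hab h2; linarith
  have hk1 : 1 ≤ k := by have := cc_pos hbc h2'; linarith
  have hv0 : 0 ≤ v := by have := cc_nonpos M hac; linarith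
  set x := (cs.simple a * cs.simple b) ^ 2 with hx
  set y := (cs.simple b * cs.simple c) ^ 2 with hy
  have sa : ∀ p q : ℝ, sig M a (p • al a + q • al b) = (u * q - p) • al a + q • al b :=
    fun p q => sig_step_i M a b p q
  have sb : ∀ p q : ℝ, sig M b (p • al a + q • al b) = p • al a + (u * p - q) • al b :=
    fun p q => sig_step_j M a b p q
  have hxv : rho cs x (u^2 • al a + (u^3 - 2 * u) • al b)
      = (u^2 • al a + (u^3 - 2 * u) • al b) + (u^2 * (u^2 - 4)) • al a := by
    rw [hx, pow_two]
    simp only [rho_mul, rho_simple, sa, sb]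
    module
  have hya : (rho cs y (al a)) c = k * (u + v * k) := by
    rw [hy, pow_two]
    simp only [rho_mul, rho_simple, sig_al, map_sub, map_smul, cc_self]
    have e1 : cc M c a = -v := by rw [cc_comm]; simp [hv]
    have e2 : cc M c b = -k := by rw [cc_comm]; simp [hk]
    have e3 : cc M b a = -u := by rw [cc_comm]; simp [hu]
    have e4 : cc M b c = -k := by simp [hk]
    rw [e1, e2, e3, e4]
    simp [al, hac, hbc, Ne.symm hac, Ne.symm hbc, sig_apply]
    try ring
  have hxP : x ∈ Par cs {a, b} := pow_mem (mul_mem (simple_mem_Par cs (by simp))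
    (simple_mem_Par cs (by simp))) 2
  have hc : c ∉ ({a, b} : Set B) := by simp [Ne.symm hac, Ne.symm hbc]
  set z := (u^2 • al a + (u^3 - 2 * u) • al b : B →₀ ℝ) with hz
  have h3 : rho cs x (rho cs y z) = rho cs y (rho cs x z) := by
    rw [← rho_mul, ← rho_mul, hcomm]
  have h4 := Par_coord cs hxP (rho cs y z) hc
  rw [h3, hxv, map_add, map_smul] at h4
  simp [hya] at h4
  have hne := four_sub_ne M hab h0
  have e : cc M a b ^ 2 = u ^ 2 := by simp [hu]
  rw [e] at hne
  rcases h4 with h4 | h4 | h4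
  · rcases h4 with h4 | h4
    · linarith
    · apply hne; linarith
  · linarith
  · nlinarith

theorem not_fin_of_path {a b c : B} {T : Set B} (ha : a ∈ T) (hb : b ∈ T) (hc : c ∈ T)
    (hab : a ≠ b) (hbc : b ≠ c) (hac : a ≠ c) (h1 : M a b = 0 ∨ 4 ≤ M a b)
    (h2 : M b c = 0 ∨ 4 ≤ M b c) : ¬ Finite (Par cs T) := by
  intro hfin
  have c1 := cc_le M hab 4 (by norm_num) h1
  have c2 := cc_le M hbc 4 (by norm_num) h2
  push_cast at c1 c2
  rw [Real.cos_pi_div_four] at c1 c2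
  have hsq : Real.sqrt 2 * Real.sqrt 2 = 2 := Real.mul_self_sqrt (by norm_num)
  have hs0 : 0 < Real.sqrt 2 := by positivity
  set r := Real.sqrt 2
  set δ : B →₀ ℝ := al a + r • al b + al c with hδ
  have hphi : ∀ s, phi M s δ ≤ 0 := by
    intro s
    simp only [hδ, map_add, map_smul, phi_al, smul_eq_mul]
    by_cases hsa : s = a
    · subst hsa
      have := cc_nonpos M hac
      rw [cc_self]; nlinarith
    by_cases hsb : s = b
    · subst hsb
      rw [cc_self, cc_comm M s a]; nlinarith
    by_cases hsc : s = c
    · subst hsc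
      have := cc_nonpos M (Ne.symm hac)
      rw [cc_self, cc_comm M s b]; nlinarith
    have := cc_nonpos M hsa
    have := cc_nonpos M hsb
    have := cc_nonpos M hsc
    nlinarith
  have hge : ∀ n, ∀ w : W, cs.length w = n → δ ≤ rho cs w δ := by
    intro n
    induction n with
    | zero =>
      intro w hw
      rw [cs.length_eq_zero_iff] at hw
      subst hw; simp
    | succ n ih =>
      intro w hw
      have h1 : w ≠ 1 := by rintro rfl; simp at hw
      obtain ⟨s, hs⟩ := cs.exists_rightDescent_of_ne_one h1
      rw [cs.isRightDescent_iff] at hs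
      have h3 := ih (w * cs.simple s) (by omega)
      have h4 := rho_pos cs (w * cs.simple s) s (by simp; omega)
      have e : rho cs w δ = rho cs (w * cs.simple s) δ +
          (- phi M s δ) • rho cs (w * cs.simple s) (al s) := by
        conv_lhs => rw [show w = (w * cs.simple s) * cs.simple s by simp]
        rw [rho_mul cs (w * cs.simple s), rho_simple, sig_apply, map_sub, map_smul]
        module
      rw [e]
      exact le_trans h3 (le_add_of_nonneg_right (smul_nonneg (by linarith [hphi s]) h4))
  obtain ⟨w, hw, hwn⟩ := longest cs hfin
  have h5 := hge _ w rfl a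
  have h6 : rho cs w δ a ≤ 0 := by
    simp only [hδ, map_add, map_smul, Finsupp.add_apply, Finsupp.smul_apply, smul_eq_mul]
    have e1 : (rho cs w (al a)) a ≤ 0 := hwn a ha a
    have e2 : (rho cs w (al b)) a ≤ 0 := hwn b hb a
    have e3 : (rho cs w (al c)) a ≤ 0 := hwn c hc a
    nlinarith
  have h7 : δ a = 1 := by simp [hδ, al, Ne.symm hab, Ne.symm hac]
  linarith

end par

section dih
theorem dih_decomp {G : Type*} [Group G] {b c : G} (hb : b * b = 1) (hc : c * c = 1)
    (K : Subgroup G) (hKb : ∀ k ∈ K, Commute k b) (hKc : ∀ k ∈ K, Commute k c) (X : Set G)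
    (hX : ∀ x ∈ X, x = b ∨ x = c ∨ x ∈ K) {g : G} (hg : g ∈ Subgroup.closure X) :
    ∃ j : ℤ, ∃ k ∈ K, g = (b * c) ^ j * k ∨ g = (b * c) ^ j * b * k := by
  have hbi : b⁻¹ = b := inv_eq_of_mul_eq_one_right hb
  have hci : c⁻¹ = c := inv_eq_of_mul_eq_one_right hc
  have hconj : ∀ j : ℤ, b * (b * c) ^ j = (b * c) ^ (-j) * b := by
    intro j
    have h1 : b * (b * c) * b⁻¹ = (b * c)⁻¹ := by
      rw [mul_inv_rev, hci, hbi, ← mul_assoc, hb, one_mul]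
    have h2 := conj_zpow (i := j) (a := b) (b := b * c)
    rw [h1, inv_zpow, ← zpow_neg] at h2
    rw [h2]; group
  have hKr : ∀ k ∈ K, ∀ j : ℤ, k * (b * c) ^ j = (b * c) ^ j * k := fun k hk j =>
    (((hKb k hk).mul_right (hKc k hk)).zpow_right j)
  have hbs : ∀ g : G, (∃ j : ℤ, ∃ k ∈ K, g = (b * c) ^ j * k ∨ g = (b * c) ^ j * b * k) →
      (∃ j : ℤ, ∃ k ∈ K, b * g = (b * c) ^ j * k ∨ b * g = (b * c) ^ j * b * k) := by
    rintro g ⟨j, k, hk, rfl | rfl⟩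
    · refine ⟨-j, k, hk, Or.inr ?_⟩
      rw [← mul_assoc, hconj]
    · refine ⟨-j, k, hk, Or.inl ?_⟩
      rw [← mul_assoc, ← mul_assoc, hconj, mul_assoc _ b b, hb, mul_one]
  have hrs : ∀ g : G, (∃ j : ℤ, ∃ k ∈ K, g = (b * c) ^ j * k ∨ g = (b * c) ^ j * b * k) →
      (∃ j : ℤ, ∃ k ∈ K, (b * c) * g = (b * c) ^ j * k ∨ (b * c) * g = (b * c) ^ j * b * k) := by
    rintro g ⟨j, k, hk, rfl | rfl⟩
    · exact ⟨1 + j, k, hk, Or.inl (by rw [zpow_add, zpow_one, ← mul_assoc])⟩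
    · exact ⟨1 + j, k, hk, Or.inr (by rw [zpow_add, zpow_one]; simp only [mul_assoc])⟩
  have hxs : ∀ x, (x = b ∨ x = c ∨ x ∈ K) → ∀ g : G,
      (∃ j : ℤ, ∃ k ∈ K, g = (b * c) ^ j * k ∨ g = (b * c) ^ j * b * k) →
      (∃ j : ℤ, ∃ k ∈ K, x * g = (b * c) ^ j * k ∨ x * g = (b * c) ^ j * b * k) := by
    rintro x (rfl | rfl | hx) g hg
    · exact hbs g hg
    · have := hbs _ (hrs g hg)
      have e : b * (b * x * g) = x * g := by rw [← mul_assoc, ← mul_assoc, hb, one_mul]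
      rwa [e] at this
    · obtain ⟨j, k, hk, rfl | rfl⟩ := hg
      · exact ⟨j, x * k, mul_mem hx hk, Or.inl (by rw [← mul_assoc, hKr x hx, mul_assoc])⟩
      · refine ⟨j, x * k, mul_mem hx hk, Or.inr ?_⟩
        rw [← mul_assoc, ← mul_assoc, hKr x hx, mul_assoc _ x b, (hKb x hx).eq]
        simp only [mul_assoc]
  refine Subgroup.closure_induction_left (p := fun g _ => ∃ j : ℤ, ∃ k ∈ K,
    g = (b * c) ^ j * k ∨ g = (b * c) ^ j * b * k) ⟨0, 1, one_mem _, Or.inl (by simp)⟩ ?_ ?_ hg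
  · intro x hx y _ ih; exact hxs x (hX x hx) y ih
  · intro x hx y _ ih
    apply hxs _ _ y ih
    rcases hX x hx with rfl | rfl | h
    · exact Or.inl hbi
    · exact Or.inr (Or.inl hci)
    · exact Or.inr (Or.inr (inv_mem h))
end dih

section cor
variable {B W : Type*} [Group W] {M : CoxeterMatrix B} (cs : CoxeterSystem M W)

theorem Par_pair_finite {s t : B} (h : M s t ≠ 0) : Finite (Par cs {s, t}) := by
  set r := cs.simple s * cs.simple t with hr
  have hfo : IsOfFinOrder r := by
    rw [← orderOf_pos_iff, orderOf_simple_mul]; omega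
  have hfin : ((Subgroup.zpowers r : Set W)).Finite := by
    rw [← Set.finite_coe_iff]
    exact (finite_zpowers.2 hfo).to_subtype
  have : ((Par cs {s, t} : Subgroup W) : Set W).Finite := by
    apply (hfin.union (hfin.image (fun x => x * cs.simple s))).subset
    intro g hg
    obtain ⟨j, k, hk, h | h⟩ := dih_decomp (b := cs.simple s) (c := cs.simple t) (by simp) (by simp)
      (⊥ : Subgroup W) (by rintro k hk; rw [Subgroup.mem_bot.1 hk]; exact Commute.one_left _)
      (by rintro k hk; rw [Subgroup.mem_bot.1 hk]; exact Commute.one_left _)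
      (cs.simple '' {s, t}) (by rintro x ⟨i, rfl | rfl, rfl⟩ <;> simp) hg
    · left; rw [Subgroup.mem_bot.1 hk] at h
      exact ⟨j, by simp [h, hr]⟩
    · right; rw [Subgroup.mem_bot.1 hk] at h
      exact ⟨r ^ j, ⟨j, rfl⟩, by simp [h, hr]⟩
  exact this.to_subtype

theorem M_ne_zero_of_fin {T : Set B} (hT : Finite (Par cs T)) {s t : B} (hs : s ∈ T) (ht : t ∈ T) :
    M s t ≠ 0 := by
  rw [← orderOf_simple_mul cs]
  have := orderOf_pos (⟨cs.simple s * cs.simple t,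
    mul_mem (simple_mem_Par cs hs) (simple_mem_Par cs ht)⟩ : Par cs T)
  rw [← Subgroup.orderOf_coe] at this
  simp only at this
  omega

theorem ext_max [Finite B] {T : Set B} (hT : Finite (Par cs T)) : ∃ U, MaxSph cs U ∧ T ⊆ U := by
  obtain ⟨U, hTU, hU⟩ := Set.Finite.exists_le_maximal
    (Set.toFinite {T : Set B | Finite (Par cs T)}) (show T ∈ {T : Set B | Finite (Par cs T)} from hT)
  exact ⟨U, ⟨hU.1, fun V hV h => le_antisymm (hU.2 hV h) h⟩, hTU⟩

variable {B' : Type*} {M' : CoxeterMatrix B'} (cs' : CoxeterSystem M' W)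

def Cor (T : Set B) (T' : Set B') : Prop := ∃ w : W, ∀ g, g ∈ Par cs T ↔ w⁻¹ * g * w ∈ Par cs' T'

theorem Cor.symm {T : Set B} {T' : Set B'} (h : Cor cs cs' T T') : Cor cs' cs T' T := by
  obtain ⟨w, hw⟩ := h
  exact ⟨w⁻¹, fun g => by rw [hw]; simp [mul_assoc]⟩

theorem Cor_exists [Finite B] [Finite B'] {T : Set B} (hT : MaxSph cs T) :
    ∃ T', MaxSph cs' T' ∧ Cor cs cs' T T' := by
  have := hT.1
  obtain ⟨w, T1', hf1, h1⟩ := finite_subgroup cs' (Par cs T)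
  obtain ⟨T', hT', hsub⟩ := ext_max cs' hf1
  have := hT'.1
  obtain ⟨v, T2, hf2, h2⟩ := finite_subgroup cs (Par cs' T')
  have hmap : ∀ g ∈ Par cs T, (v⁻¹ * w⁻¹) * g * (v⁻¹ * w⁻¹)⁻¹ ∈ Par cs T2 := by
    intro g hg
    have := h2 _ (Par_mono cs' hsub (h1 g hg))
    convert this using 1
    group
  have hTT := maxsph_conj cs hT hf2 _ hmap
  subst hTT
  refine ⟨T', hT', w, fun g => ⟨fun hg => Par_mono cs' hsub (h1 g hg), fun hg => ?_⟩⟩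
  let f : Par cs T → Par cs T := fun g => ⟨_, hmap g g.2⟩
  have hinj : Function.Injective f := by
    intro x y hxy
    have := congrArg Subtype.val hxy
    simp only [f] at this
    exact Subtype.ext (mul_left_cancel (mul_right_cancel this))
  have hsurj := Finite.injective_iff_surjective.1 hinj
  have h3 := h2 _ hg
  obtain ⟨x, hx⟩ := hsurj ⟨_, h3⟩
  have hx := congrArg Subtype.val hx
  simp only [f] at hx
  have : (x : W) = g := by
    have e : v⁻¹ * (w⁻¹ * g * w) * v = (v⁻¹ * w⁻¹) * g * (v⁻¹ * w⁻¹)⁻¹ := by group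
    rw [e] at hx
    exact mul_left_cancel (mul_right_cancel hx)
  rw [← this]; exact x.2

theorem Cor_unique [Finite B'] {T : Set B} {T1 T2 : Set B'} (h1 : MaxSph cs' T1)
    (h2 : MaxSph cs' T2) (c1 : Cor cs cs' T T1) (c2 : Cor cs cs' T T2) : T1 = T2 := by
  obtain ⟨w, hw⟩ := c1
  obtain ⟨v, hv⟩ := c2
  apply maxsph_conj cs' h1 h2.1 (v⁻¹ * w)
  intro g hg
  have : w * g * w⁻¹ ∈ Par cs T := by rw [hw]; simpa [mul_assoc] using hg
  rw [hv] at this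
  convert this using 1
  group

end cor
end RG

namespace RG

abbrev Z2 := Multiplicative (ZMod 2)

theorem Z2_sq (x : Z2) : x * x = 1 := by revert x; decide

theorem Z2_zpow_even (x : Z2) {j : ℤ} (h : Even j) : x ^ j = 1 := by
  obtain ⟨i, rfl⟩ := h
  rw [zpow_add, Z2_sq]

def Matching {B : Type*} (M : CoxeterMatrix B) : Prop :=
  ∀ a b c, a ≠ b → b ≠ c → a ≠ c → M a b = 2 ∨ M b c = 2

def StrongEven {B : Type*} (M : CoxeterMatrix B) : Prop :=
  ∀ a b, a ≠ b → M a b = 2 ∨ 4 ∣ M a b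

section frame
variable {B G : Type*} [Group G] {M : CoxeterMatrix B} (cs : CoxeterSystem M G)

theorem M_fin (cs : CoxeterSystem M G) [Finite G] (a b : B) : M a b ≠ 0 := by
  rw [← orderOf_simple_mul cs]
  exact (orderOf_pos _).ne'

theorem comm_of_two {a b : B} (h : M a b = 2) : Commute (cs.simple a) (cs.simple b) := by
  have h1 := cs.simple_mul_simple_pow a b
  rw [h, pow_two] at h1
  have h2 := eq_inv_of_mul_eq_one_left h1
  rw [mul_inv_rev, cs.inv_simple, cs.inv_simple] at h2
  exact h2

theorem two_of_comm {a b : B} (hab : a ≠ b) (h : Commute (cs.simple a) (cs.simple b)) :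
    M a b = 2 := by
  have h1 : (cs.simple a * cs.simple b) ^ 2 = 1 := by
    rw [pow_two]
    nth_rw 2 [h.eq]
    simp [mul_assoc]
  have h2 := orderOf_dvd_of_pow_eq_one h1
  rw [orderOf_simple_mul] at h2
  have h3 := M.off_diagonal a b hab
  rcases (Nat.dvd_prime Nat.prime_two).1 h2 with h | h
  · exact absurd h h3
  · exact h

theorem simple_inj {a b : B} (h : cs.simple a = cs.simple b) : a = b := by
  have : cs.simple a ∈ Par cs {b} := by rw [h]; exact simple_mem_Par cs rfl
  exact of_simple_mem_Par cs (T := {b}) this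

theorem central_of {z : G} (h : ∀ b, Commute z (cs.simple b)) (g : G) : Commute z g := by
  induction g using cs.simple_induction_left with
  | one => exact Commute.one_right z
  | mul_simple_left w i ih => exact (h i).mul_right ih

theorem Par_disj {T : Set B} {g : G} (h : g ∈ Par cs T) (h' : g ∈ Par cs Tᶜ) : g = 1 := by
  apply faithful cs
  intro i
  ext b
  by_cases hb : b ∈ T
  · exact Par_coord cs h' _ (by simpa using hb)
  · exact Par_coord cs h _ hb

variable {b c : B}

theorem match_comm (hM : Matching M) (hbc : b ≠ c) (h2 : M b c ≠ 2) {x : B} (hb : x ≠ b)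
    (hc : x ≠ c) : Commute (cs.simple x) (cs.simple b) ∧ Commute (cs.simple x) (cs.simple c) := by
  constructor
  · exact comm_of_two cs ((hM x b c hb hbc hc).resolve_right h2)
  · have := (hM b c x hbc (Ne.symm hc) (Ne.symm hb)).resolve_left h2
    exact (comm_of_two cs this).symm

theorem match_K (hM : Matching M) (hbc : b ≠ c) (h2 : M b c ≠ 2) {k : G}
    (hk : k ∈ Par cs ({b, c} : Set B)ᶜ) :
    Commute k (cs.simple b) ∧ Commute k (cs.simple c) := by
  refine Par_induction cs (p := fun k => Commute k (cs.simple b) ∧ Commute k (cs.simple c))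
    ⟨Commute.one_left _, Commute.one_left _⟩ ?_ hk
  intro w _ i hi ih
  simp only [Set.mem_compl_iff, Set.mem_insert_iff, Set.mem_singleton_iff, not_or] at hi
  have := match_comm cs hM hbc h2 hi.1 hi.2
  exact ⟨this.1.mul_left ih.1, this.2.mul_left ih.2⟩

theorem frame_decomp (hM : Matching M) (hbc : b ≠ c) (h2 : M b c ≠ 2) (g : G) :
    ∃ j : ℤ, ∃ k ∈ Par cs ({b, c} : Set B)ᶜ, g = (cs.simple b * cs.simple c) ^ j * k ∨
      g = (cs.simple b * cs.simple c) ^ j * cs.simple b * k := by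
  apply dih_decomp (by simp) (by simp) _ (fun k hk => (match_K cs hM hbc h2 hk).1)
    (fun k hk => (match_K cs hM hbc h2 hk).2) (Set.range cs.simple)
  · rintro _ ⟨x, rfl⟩
    by_cases hb : x = b
    · left; rw [hb]
    by_cases hc : x = c
    · right; left; rw [hc]
    · right; right; exact simple_mem_Par cs (by simp [hb, hc])
  · rw [cs.subgroup_closure_range_simple]; trivial

variable (b c) in
theorem conj_r (j : ℤ) : cs.simple b * (cs.simple b * cs.simple c) ^ j =
    (cs.simple b * cs.simple c) ^ (-j) * cs.simple b := by
  have h1 : cs.simple b * (cs.simple b * cs.simple c) * (cs.simple b)⁻¹ =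
      (cs.simple b * cs.simple c)⁻¹ := by
    simp [mul_assoc]
  have h2 := conj_zpow (i := j) (a := cs.simple b) (b := cs.simple b * cs.simple c)
  rw [h1, inv_zpow, ← zpow_neg] at h2
  rw [h2]; group

variable (b c) in
theorem r_mem (j : ℤ) : (cs.simple b * cs.simple c) ^ j ∈ Par cs {b, c} :=
  zpow_mem (mul_mem (simple_mem_Par cs (by simp)) (simple_mem_Par cs (by simp))) j

/-- reflections square -/
theorem refl_sq (j : ℤ) : ((cs.simple b * cs.simple c) ^ j * cs.simple b) *
    ((cs.simple b * cs.simple c) ^ j * cs.simple b) = 1 := by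
  rw [mul_assoc, ← mul_assoc (cs.simple b), conj_r]
  simp

theorem r_comm_iff (j : ℤ) : Commute ((cs.simple b * cs.simple c) ^ j) (cs.simple b) ↔
    (cs.simple b * cs.simple c) ^ (2 * j) = 1 := by
  rw [Commute, SemiconjBy, conj_r, mul_left_inj, zpow_neg, eq_inv_iff_mul_eq_one, ← zpow_add,
    two_mul]

theorem r_central (hM : Matching M) (hbc : b ≠ c) (h2 : M b c ≠ 2) (j : ℤ)
    (h : (cs.simple b * cs.simple c) ^ (2 * j) = 1) (g : G) :
    Commute ((cs.simple b * cs.simple c) ^ j) g := by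
  apply central_of cs
  have hb := (r_comm_iff cs j).2 h
  intro x
  by_cases hxb : x = b
  · rw [hxb]; exact hb
  by_cases hxc : x = c
  · rw [hxc]
    have e : cs.simple c = cs.simple b * (cs.simple b * cs.simple c) := by simp
    have h3 := hb.mul_right ((Commute.refl (cs.simple b * cs.simple c)).zpow_left j)
    rwa [← e] at h3
  have := match_comm cs hM hbc h2 hxb hxc
  exact ((this.1.mul_right this.2).zpow_right j).symm

/-- elements of square one, first kind, commute with `b` -/
theorem sq_first {j : ℤ} {k g : G} (hM : Matching M) (hbc : b ≠ c) (h2 : M b c ≠ 2)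
    (hk : k ∈ Par cs ({b, c} : Set B)ᶜ)
    (hg : g = (cs.simple b * cs.simple c) ^ j * k) (hgg : g * g = 1) :
    (cs.simple b * cs.simple c) ^ (2 * j) = 1 := by
  have hK := match_K cs hM hbc h2 hk
  have hkr : Commute k ((cs.simple b * cs.simple c) ^ j) :=
    (hK.1.mul_right hK.2).zpow_right j
  apply Par_disj cs (r_mem cs b c (2 * j))
  have : (cs.simple b * cs.simple c) ^ (2 * j) = (k * k)⁻¹ := by
    rw [eq_inv_iff_mul_eq_one, ← hgg, hg, two_mul, zpow_add, mul_assoc _ k, ← mul_assoc k,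
      hkr.eq]
    simp only [mul_assoc]
  rw [this]
  exact inv_mem (mul_mem hk hk)

theorem sq_first_comm {j : ℤ} {k g : G} (hM : Matching M) (hbc : b ≠ c) (h2 : M b c ≠ 2)
    (hk : k ∈ Par cs ({b, c} : Set B)ᶜ)
    (hg : g = (cs.simple b * cs.simple c) ^ j * k) (hgg : g * g = 1) :
    Commute g (cs.simple b) := by
  have h := sq_first cs hM hbc h2 hk hg hgg
  rw [hg]
  exact ((r_comm_iff cs j).2 h).mul_left (match_K cs hM hbc h2 hk).1

/-- conjugating `r^i` by a reflection -/
theorem refl_conj {j : ℤ} {k g : G} (hM : Matching M) (hbc : b ≠ c) (h2 : M b c ≠ 2)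
    (hk : k ∈ Par cs ({b, c} : Set B)ᶜ)
    (hg : g = (cs.simple b * cs.simple c) ^ j * cs.simple b * k) (i : ℤ) :
    g * (cs.simple b * cs.simple c) ^ i * g⁻¹ * ((cs.simple b * cs.simple c) ^ i)⁻¹ =
      (cs.simple b * cs.simple c) ^ (2 * -i) := by
  have hK := match_K cs hM hbc h2 hk
  have hkr : Commute k ((cs.simple b * cs.simple c) ^ i) :=
    (hK.1.mul_right hK.2).zpow_right i
  have e : g * (cs.simple b * cs.simple c) ^ i = (cs.simple b * cs.simple c) ^ (-i) * g := by
    rw [hg, mul_assoc _ k, hkr.eq, mul_assoc _ (cs.simple b), ← mul_assoc (cs.simple b), conj_r]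
    simp only [← mul_assoc]
    rw [← zpow_add, ← zpow_add, add_comm]
  rw [e, mul_inv_cancel_right, ← zpow_neg, ← zpow_add]
  congr 1; ring

/-- commutator of `b` with anything -/
theorem b_comm (hM : Matching M) (hbc : b ≠ c) (h2 : M b c ≠ 2) (g : G) :
    ∃ i : ℤ, cs.simple b * g * (cs.simple b)⁻¹ * g⁻¹ = (cs.simple b * cs.simple c) ^ (2 * i) := by
  obtain ⟨j, k, hk, h | h⟩ := frame_decomp cs hM hbc h2 g
  · have hK := match_K cs hM hbc h2 hk
    refine ⟨-j, ?_⟩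
    have e : cs.simple b * g = (cs.simple b * cs.simple c) ^ (-(2 * j)) * g * cs.simple b := by
      rw [h, ← mul_assoc, conj_r, mul_assoc _ (cs.simple b), ← hK.1.eq]
      simp only [← mul_assoc]
      rw [← zpow_add]
      congr 3; ring
    rw [e]
    simp
  · have hK := match_K cs hM hbc h2 hk
    refine ⟨-j, ?_⟩
    have e : cs.simple b * g = (cs.simple b * cs.simple c) ^ (-(2 * j)) * g * cs.simple b := by
      have e2 : g * cs.simple b = (cs.simple b * cs.simple c) ^ j * k := by
        rw [h, mul_assoc _ k, hK.1.eq]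
        simp [mul_assoc]
      rw [mul_assoc _ g, e2, h, ← mul_assoc, ← mul_assoc, conj_r, ← mul_assoc, ← zpow_add]
      have : -(2 * j) + j = - j := by ring
      rw [this]
      simp [mul_assoc]
    rw [e]
    simp

end frame

section L1
variable {B B' G : Type*} [Group G] {M : CoxeterMatrix B} (cs : CoxeterSystem M G)
  {M' : CoxeterMatrix B'} (cs' : CoxeterSystem M' G)

theorem sq_conj (hM : Matching M) (b c x : B) :
    cs.simple x * (cs.simple b * cs.simple c) ^ 2 * (cs.simple x)⁻¹ = (cs.simple b * cs.simple c) ^ 2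
    ∨ cs.simple x * (cs.simple b * cs.simple c) ^ 2 * (cs.simple x)⁻¹ =
      ((cs.simple b * cs.simple c) ^ 2)⁻¹ := by
  by_cases hbc : b = c
  · subst hbc; simp
  by_cases h2 : M b c = 2
  · have := cs.simple_mul_simple_pow b c
    rw [h2] at this
    rw [this]; simp
  by_cases hxb : x = b
  · right; subst hxb; simp [pow_two, mul_assoc]
  by_cases hxc : x = c
  · right; subst hxc; simp [pow_two, mul_assoc]
  · left
    have := match_comm cs hM hbc h2 hxb hxc
    have := (this.1.mul_right this.2).pow_right 2
    rw [this.eq]; simp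

theorem sq_comm (hM : Matching M) (b c d e : B) :
    Commute ((cs.simple b * cs.simple c) ^ 2) ((cs.simple d * cs.simple e) ^ 2) := by
  by_cases hbc : b = c
  · subst hbc; simp
  by_cases h2 : M b c = 2
  · have := cs.simple_mul_simple_pow b c
    rw [h2] at this
    rw [this]; simp
  by_cases hde : d = e
  · subst hde; simp
  by_cases h2' : M d e = 2
  · have := cs.simple_mul_simple_pow d e
    rw [h2'] at this
    rw [this]; simp
  have hinv : ∀ x y : B, (cs.simple y * cs.simple x) ^ 2 = ((cs.simple x * cs.simple y) ^ 2)⁻¹ := by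
    intro x y; rw [← inv_pow, mul_inv_rev, cs.inv_simple, cs.inv_simple]
  have h2s : M c b ≠ 2 := by rwa [M.symmetric]
  by_cases hdb : d = b
  · subst hdb
    have : e = c := by
      by_contra h
      rcases hM e d c (Ne.symm hde) hbc h with h1 | h1
      · rw [M.symmetric] at h1; exact h2' h1
      · exact h2 h1
    subst this
    exact Commute.refl _
  by_cases hdc : d = c
  · subst hdc
    have : e = b := by
      by_contra h
      rcases hM e d b (Ne.symm hde) (Ne.symm hbc) h with h1 | h1
      · rw [M.symmetric] at h1; exact h2' h1
      · exact h2s h1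
    subst this
    rw [hinv e d]
    exact (Commute.refl _).inv_right
  have m1 := match_comm cs hM hbc h2 hdb hdc
  by_cases heb : e = b
  · subst heb; exact absurd (two_of_comm cs hde m1.1) h2'
  by_cases hec : e = c
  · subst hec; exact absurd (two_of_comm cs hde m1.2) h2'
  have m2 := match_comm cs hM hbc h2 heb hec
  exact (((m1.1.mul_right m1.2).mul_left (m2.1.mul_right m2.2)).pow_pow 2 2).symm

theorem L1a (cs : CoxeterSystem M G) (cs' : CoxeterSystem M' G) [Finite G] (hM : Matching M) : Matching M' := by
  let X : Set G := {x | ∃ b c, x = (cs.simple b * cs.simple c) ^ 2}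
  let N := Subgroup.closure X
  have hN1 : ∀ g : G, ∀ n ∈ N, g * n * g⁻¹ ∈ N := by
    intro g
    induction g using cs.simple_induction_left with
    | one => intro n hn; simpa using hn
    | mul_simple_left w i ih =>
      intro n hn
      have h1 := ih n hn
      have h2 : ∀ n ∈ N, cs.simple i * n * (cs.simple i)⁻¹ ∈ N := by
        intro n hn
        induction hn using Subgroup.closure_induction with
        | mem x hx =>
          obtain ⟨b, c, rfl⟩ := hx
          have hm : (cs.simple b * cs.simple c) ^ 2 ∈ N := Subgroup.subset_closure ⟨b, c, rfl⟩
          rcases sq_conj cs hM b c i with h | h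
          · rw [h]; exact hm
          · rw [h]; exact inv_mem hm
        | one => simp
        | mul x y _ _ hx hy =>
          have := mul_mem hx hy
          rwa [conj_mul] at this
        | inv x _ hx =>
          have := inv_mem hx
          rwa [← conj_inv]
      have := h2 _ h1
      convert this using 1
      group
  have hNn : N.Normal := ⟨fun n hn g => hN1 g n hn⟩
  have hNc : ∀ x ∈ N, ∀ y ∈ N, Commute x y := by
    intro x hx y hy
    induction hx using Subgroup.closure_induction with
    | mem x hx =>
      obtain ⟨b, c, rfl⟩ := hx
      induction hy using Subgroup.closure_induction with
      | mem y hy => obtain ⟨d, e, rfl⟩ := hy; exact sq_comm cs hM b c d e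
      | one => exact Commute.one_right _
      | mul y z _ _ h1 h2 => exact h1.mul_right h2
      | inv y _ h => exact h.inv_right
    | one => exact Commute.one_left _
    | mul y z _ _ h1 h2 => exact h1.mul_left h2
    | inv y _ h => exact h.inv_left
  have hq1 : ∀ b c : B, Commute (QuotientGroup.mk' N (cs.simple b))
      (QuotientGroup.mk' N (cs.simple c)) := by
    intro b c
    rw [Commute, SemiconjBy, ← map_mul, ← map_mul, QuotientGroup.mk'_eq_mk']
    refine ⟨(cs.simple c * cs.simple b) ^ 2, Subgroup.subset_closure ⟨c, b, rfl⟩, ?_⟩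
    simp [pow_two, mul_assoc]
  have hq2 : ∀ (b : B) (g : G), Commute (QuotientGroup.mk' N (cs.simple b))
      (QuotientGroup.mk' N g) := by
    intro b g
    induction g using cs.simple_induction_left with
    | one => simp
    | mul_simple_left w i ih => rw [map_mul]; exact (hq1 b i).mul_right ih
  have hq3 : ∀ (h g : G), Commute (QuotientGroup.mk' N h) (QuotientGroup.mk' N g) := by
    intro h g
    induction h using cs.simple_induction_left with
    | one => simp
    | mul_simple_left w i ih => rw [map_mul]; exact (hq2 i g).mul_left ih
  have hmem : ∀ a b : B', (cs'.simple a * cs'.simple b) ^ 2 ∈ N := by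
    intro a b
    have := hq3 (cs'.simple a) (cs'.simple b)
    rw [Commute, SemiconjBy, ← map_mul, ← map_mul, QuotientGroup.mk'_eq_mk'] at this
    obtain ⟨z, hz, h⟩ := this
    have e : z⁻¹ = (cs'.simple a * cs'.simple b) ^ 2 := by
      have h3 : cs'.simple b * cs'.simple a = (cs'.simple a * cs'.simple b)⁻¹ := by simp
      rw [h3, ← eq_inv_mul_iff_mul_eq] at h
      rw [h]; simp [pow_two, mul_assoc]
    rw [← e]; exact inv_mem hz
  intro a b c hab hbc hac
  by_contra! hcon
  exact comm_noncomm cs' hab hbc hac (M_fin cs' a b) hcon.1 hcon.2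
    (hNc _ (hmem a b) _ (hmem b c))

theorem exists_partner {b : B} {g : G} (h : ¬ Commute g (cs.simple b)) :
    ∃ c, b ≠ c ∧ M b c ≠ 2 := by
  by_contra! hcon
  apply h
  apply Commute.symm
  apply central_of cs
  intro c
  by_cases hbc : b = c
  · rw [hbc]
  · exact comm_of_two cs (hcon c hbc)

theorem propQ (cs : CoxeterSystem M G) [Finite G] (hM : Matching M) (hE : StrongEven M) {g : G} (hgg : g * g = 1) {y : G}
    (hy : ¬ Commute g y) : ∃ x, (∀ z, Commute (g * x * g⁻¹ * x⁻¹) z) ∧ g * x * g⁻¹ * x⁻¹ ≠ 1 := by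
  obtain ⟨b, hb⟩ : ∃ b, ¬ Commute g (cs.simple b) := by
    by_contra! hcon; exact hy (central_of cs hcon y)
  obtain ⟨c, hbc, h2⟩ := exists_partner cs hb
  obtain ⟨n, hn⟩ := (hE b c hbc).resolve_left h2
  have hn0 : n ≠ 0 := by rintro rfl; exact M_fin cs b c (by omega)
  have hord := orderOf_simple_mul cs b c
  obtain ⟨j, k, hk, h | h⟩ := frame_decomp cs hM hbc h2 g
  · exact absurd (sq_first_comm cs hM hbc h2 hk h hgg) hb
  · refine ⟨(cs.simple b * cs.simple c) ^ (n : ℤ), ?_, ?_⟩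
    · intro z
      rw [refl_conj cs hM hbc h2 hk h]
      apply r_central cs hM hbc h2
      rw [← orderOf_dvd_iff_zpow_eq_one, hord, hn]
      exact ⟨-1, by push_cast; ring⟩
    · rw [refl_conj cs hM hbc h2 hk h, Ne, ← orderOf_dvd_iff_zpow_eq_one, hord, hn]
      intro hd
      have hd : ((4 * n : ℕ) : ℤ) ∣ ((2 * n : ℕ) : ℤ) := by
        push_cast at hd ⊢
        rw [mul_neg, dvd_neg] at hd
        exact hd
      have := Nat.le_of_dvd (by omega) (Int.natCast_dvd_natCast.1 hd)
      omega

theorem four_dvd {m j : ℤ} (h1 : m ∣ 4 * j) (h2 : ¬ m ∣ 2 * j) : 4 ∣ m := by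
  obtain ⟨q, hq⟩ := h1
  have hodd : ¬ Even q := by
    rintro ⟨p, rfl⟩
    exact h2 ⟨p, by linarith⟩
  have h4 : (4:ℤ) ∣ m * q := ⟨j, hq.symm⟩
  refine IsCoprime.dvd_of_dvd_mul_right ?_ h4
  rw [Int.isCoprime_iff_gcd_eq_one]
  have : Odd q := by rwa [Int.not_even_iff_odd] at hodd
  have := this.natAbs
  have h5 : Nat.Coprime (2^2) q.natAbs := (Nat.Coprime.pow_left 2 (Nat.coprime_two_left.2 this))
  simpa [Int.gcd] using h5

theorem L1b (cs : CoxeterSystem M G) (cs' : CoxeterSystem M' G) [Finite G] (hM : Matching M) (hE : StrongEven M) : StrongEven M' := by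
  have hM' : Matching M' := L1a cs cs' hM
  intro a b hab
  by_cases h2 : M' a b = 2
  · exact Or.inl h2
  right
  have hn : ¬ Commute (cs'.simple a) (cs'.simple b) := fun h => h2 (two_of_comm cs' hab h)
  obtain ⟨x, hx1, hx2⟩ := propQ cs hM hE (g := cs'.simple a) (by simp) hn
  obtain ⟨i, hi⟩ := b_comm cs' hM' hab h2 x
  rw [hi] at hx1 hx2
  have h3 := (r_comm_iff cs' _).1 (hx1 (cs'.simple a))
  rw [Ne, ← orderOf_dvd_iff_zpow_eq_one, orderOf_simple_mul] at hx2
  rw [← orderOf_dvd_iff_zpow_eq_one, orderOf_simple_mul] at h3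
  have := four_dvd (j := i) (by convert h3 using 1; ring) hx2
  exact_mod_cast this

/-! odd dihedral -/
theorem dih_two {s t : B} (hst : ∀ x, x = s ∨ x = t) (g : G) :
    ∃ j : ℤ, g = (cs.simple s * cs.simple t) ^ j ∨
      g = (cs.simple s * cs.simple t) ^ j * cs.simple s := by
  have h1 : ∀ k ∈ (⊥ : Subgroup G), ∀ x, Commute k x := by
    intro k hk x; rw [Subgroup.mem_bot.1 hk]; exact Commute.one_left _
  obtain ⟨j, k, hk, h⟩ := dih_decomp (b := cs.simple s) (c := cs.simple t) (by simp) (by simp)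
    (⊥ : Subgroup G) (fun k hk => h1 k hk _) (fun k hk => h1 k hk _) (Set.range cs.simple)
    (by rintro _ ⟨x, rfl⟩; rcases hst x with rfl | rfl <;> simp) (g := g)
    (by rw [cs.subgroup_closure_range_simple]; trivial)
  rw [Subgroup.mem_bot.1 hk, mul_one, mul_one] at h
  exact ⟨j, h⟩

theorem odd_two {s t : B} (ho : Odd (M s t)) {j : ℤ}
    (h : (cs.simple s * cs.simple t) ^ (2 * j) = 1) : (cs.simple s * cs.simple t) ^ j = 1 := by
  rw [← orderOf_dvd_iff_zpow_eq_one, orderOf_simple_mul] at h ⊢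
  refine IsCoprime.dvd_of_dvd_mul_left ?_ h
  rw [Int.isCoprime_iff_gcd_eq_one]
  have : Nat.Coprime (M s t) 2 := Nat.coprime_two_right.2 ho
  simpa [Int.gcd] using this

theorem odd_comm_inv (cs : CoxeterSystem M G) {s t : B} (hst : ∀ x, x = s ∨ x = t) (ho : Odd (M s t)) {x y : G}
    (hx : x * x = 1) (hy : y * y = 1) (hx1 : x ≠ 1) (hy1 : y ≠ 1) (hxy : Commute x y) : x = y := by
  have key : ∀ g : G, g * g = 1 → g ≠ 1 → ∃ j : ℤ,
      g = (cs.simple s * cs.simple t) ^ j * cs.simple s := by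
    intro g hg hg1
    obtain ⟨j, h | h⟩ := dih_two cs hst g
    · exfalso; apply hg1
      rw [h]; apply odd_two cs ho
      rw [two_mul, zpow_add, ← h, hg]
    · exact ⟨j, h⟩
  obtain ⟨i, hi⟩ := key x hx hx1
  obtain ⟨j, hj⟩ := key y hy hy1
  have e : x * y = (cs.simple s * cs.simple t) ^ (i - j) := by
    rw [hi, hj, mul_assoc, ← mul_assoc (cs.simple s), conj_r]
    simp [zpow_sub, mul_assoc]
  have h1 : (cs.simple s * cs.simple t) ^ (i - j) = 1 := by
    apply odd_two cs ho
    rw [two_mul, zpow_add, ← e]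
    nth_rw 2 [hxy.eq]
    rw [mul_assoc, ← mul_assoc y, hy, one_mul, hx]
  rw [h1] at e
  have : x = y⁻¹ := eq_inv_of_mul_eq_one_left e
  rw [this]; exact (eq_inv_of_mul_eq_one_left hy).symm

theorem odd_center (cs : CoxeterSystem M G) {s t : B} (hne : s ≠ t) (hst : ∀ x, x = s ∨ x = t) (ho : Odd (M s t)) {z : G}
    (hz : ∀ g, Commute z g) : z = 1 := by
  obtain ⟨j, h | h⟩ := dih_two cs hst z
  · have := hz (cs.simple s)
    rw [h, r_comm_iff] at this
    rw [h]; exact odd_two cs ho this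
  · exfalso
    have hzz : z * z = 1 := by rw [h]; exact refl_sq cs j
    have hz1 : z ≠ 1 := by
      rintro rfl
      have : (cs.simple s * cs.simple t) ^ j = cs.simple s := by
        have := eq_inv_of_mul_eq_one_left h.symm
        simpa using this
      have h3 : cs.simple s = 1 := by
        rw [← this]; apply odd_two cs ho
        rw [two_mul, zpow_add, this]; simp
      have h4 := cs.length_simple s
      rw [h3] at h4; simp at h4
    have hs1 : ∀ x, cs.simple x ≠ 1 := by
      intro x h3
      have h4 := cs.length_simple x
      rw [h3] at h4; simp at h4
    have e1 := odd_comm_inv cs hst ho hzz (cs.simple_mul_simple_self s) hz1 (hs1 s) (hz _)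
    have e2 := odd_comm_inv cs hst ho hzz (cs.simple_mul_simple_self t) hz1 (hs1 t) (hz _)
    exact hne (simple_inj cs (e1.symm.trans e2))

theorem odd_dvd (cs : CoxeterSystem M G) (cs' : CoxeterSystem M' G) {s t : B} {s' t' : B'} (hst' : ∀ x, x = s' ∨ x = t') (hne : s ≠ t)
    (ho : Odd (M s t)) : M s t ∣ M' s' t' := by
  obtain ⟨j, h | h⟩ := dih_two cs' hst' (cs.simple s * cs.simple t)
  · rw [← orderOf_simple_mul cs, ← orderOf_simple_mul cs', h]
    exact orderOf_dvd_of_mem_zpowers ⟨j, rfl⟩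
  · exfalso
    have h1 : (cs.simple s * cs.simple t) ^ (2 * (1:ℤ)) = 1 := by
      rw [two_mul, zpow_add, zpow_one, h]; exact refl_sq cs' j
    have := odd_two cs ho h1
    rw [zpow_one, ← orderOf_eq_one_iff, orderOf_simple_mul] at this
    exact M.off_diagonal s t hne this

theorem L1c (cs : CoxeterSystem M G) (cs' : CoxeterSystem M' G) [Finite G] {s t : B} (hne : s ≠ t) (hst : ∀ x, x = s ∨ x = t) (ho : Odd (M s t)) :
    ∃ s' t' : B', s' ≠ t' ∧ (∀ x, x = s' ∨ x = t') ∧ M' s' t' = M s t := by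
  have hM : Matching M := by
    intro a b c h1 h2 h3
    exfalso
    rcases hst a with rfl | rfl <;> rcases hst b with rfl | rfl <;> rcases hst c with rfl | rfl <;>
      simp_all
  have hM' : Matching M' := L1a cs cs' hM
  have hs1 : ∀ x, cs'.simple x ≠ 1 := by
    intro x h3
    have h4 := cs'.length_simple x
    rw [h3] at h4; simp at h4
  have hB : Nonempty B' := by
    by_contra hemp
    rw [not_nonempty_iff] at hemp
    have : cs.simple s = 1 := by
      apply odd_center cs hne hst ho
      intro g
      have : ∀ g : G, g = 1 := by
        intro g
        induction g using cs'.simple_induction_left with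
        | one => rfl
        | mul_simple_left w i ih => exact hemp.elim i
      rw [this g]; exact Commute.one_right _
    have h4 := cs.length_simple s
    rw [this] at h4; simp at h4
  obtain ⟨s'⟩ := hB
  obtain ⟨g, hg⟩ : ∃ g, ¬ Commute g (cs'.simple s') := by
    by_contra! hcon
    exact hs1 s' (odd_center cs hne hst ho (fun g => (hcon g).symm))
  obtain ⟨t', hne', h2⟩ := exists_partner cs' hg
  have hst' : ∀ x, x = s' ∨ x = t' := by
    intro x
    by_contra! hcon
    have := (match_comm cs' hM' hne' h2 hcon.1 hcon.2).1
    exact hcon.1 (simple_inj cs' (odd_comm_inv cs hst ho (cs'.simple_mul_simple_self x)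
      (cs'.simple_mul_simple_self s') (hs1 x) (hs1 s') this))
  have ho' : Odd (M' s' t') := by
    by_contra hev
    rw [Nat.not_odd_iff_even] at hev
    obtain ⟨n, hn⟩ := hev
    have hn0 : n ≠ 0 := by rintro rfl; exact M_fin cs' s' t' (by omega)
    have h3 : (cs'.simple s' * cs'.simple t') ^ (n : ℤ) = 1 := by
      apply odd_center cs hne hst ho
      apply r_central cs' hM' hne' h2
      rw [← orderOf_dvd_iff_zpow_eq_one, orderOf_simple_mul, hn]
      exact ⟨1, by push_cast; ring⟩
    rw [← orderOf_dvd_iff_zpow_eq_one, orderOf_simple_mul, hn] at h3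
    have := Nat.le_of_dvd (by omega) (Int.natCast_dvd_natCast.1 h3)
    omega
  exact ⟨s', t', hne', hst', Nat.dvd_antisymm (odd_dvd cs' cs hst hne' ho')
    (odd_dvd cs cs' hst' hne ho)⟩

end L1
end RG

namespace RG

theorem toAdd_ne {x : Z2} (h : x ≠ 1) : Multiplicative.toAdd x = 1 := by
  revert x; decide

theorem mat_lemma {G Y Y' : Type*} [Group G] [Finite Y] [Finite Y'] (a : Y → G) (a' : Y' → G)
    (κ : Y → (G →* Z2)) (κ' : Y' → (G →* Z2)) (hκ : ∀ y z, κ y (a z) ≠ 1 ↔ z = y)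
    (hκ' : ∀ y z, κ' y (a' z) ≠ 1 ↔ z = y)
    (hg : ∀ f f' : G →* Z2, (∀ y, f (a y) = f' (a y)) → f = f')
    (hg' : ∀ f f' : G →* Z2, (∀ y, f (a' y) = f' (a' y)) → f = f') :
    ∃ ψ : Y' ≃ Y, ∀ y', κ (ψ y') (a' y') ≠ 1 := by
  classical
  have := Fintype.ofFinite Y
  have := Fintype.ofFinite Y'
  have d : ∀ y z, Multiplicative.toAdd (κ y (a z)) = if z = y then 1 else 0 := by
    intro y z
    split_ifs with h
    · exact toAdd_ne ((hκ y z).2 h)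
    · have := not_not.1 (mt (hκ y z).1 h); rw [this]; rfl
  have d' : ∀ y z, Multiplicative.toAdd (κ' y (a' z)) = if z = y then 1 else 0 := by
    intro y z
    split_ifs with h
    · exact toAdd_ne ((hκ' y z).2 h)
    · have := not_not.1 (mt (hκ' y z).1 h); rw [this]; rfl
  let P : Matrix Y Y' (ZMod 2) := fun y y' => Multiplicative.toAdd (κ y (a' y'))
  let Q : Matrix Y' Y (ZMod 2) := fun y' y => Multiplicative.toAdd (κ' y' (a y))
  have hPQ : P * Q = 1 := by
    ext y z
    rw [Matrix.mul_apply]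
    let F : G →* Z2 := MonoidHom.mk'
      (fun g => Multiplicative.ofAdd (∑ y', P y y' * Multiplicative.toAdd (κ' y' g))) (by
        intro g h
        simp only [map_mul, toAdd_mul, mul_add, Finset.sum_add_distrib, ofAdd_add])
    have : F = κ y := by
      apply hg'
      intro z'
      apply Multiplicative.toAdd.injective
      simp [F, d', P]
    have h1 := congrArg (fun f : G →* Z2 => Multiplicative.toAdd (f (a z))) this
    simp only [F, MonoidHom.mk'_apply, toAdd_ofAdd, d] at h1
    rw [h1, Matrix.one_apply]
    simp [eq_comm]
  have hQP : Q * P = 1 := by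
    ext y z
    rw [Matrix.mul_apply]
    let F : G →* Z2 := MonoidHom.mk'
      (fun g => Multiplicative.ofAdd (∑ y', Q y y' * Multiplicative.toAdd (κ y' g))) (by
        intro g h
        simp only [map_mul, toAdd_mul, mul_add, Finset.sum_add_distrib, ofAdd_add])
    have : F = κ' y := by
      apply hg
      intro z'
      apply Multiplicative.toAdd.injective
      simp [F, d, Q]
    have h1 := congrArg (fun f : G →* Z2 => Multiplicative.toAdd (f (a' z))) this
    simp only [F, MonoidHom.mk'_apply, toAdd_ofAdd, d'] at h1
    rw [h1, Matrix.one_apply]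
    simp [eq_comm]
  have hcard : Fintype.card Y' = Fintype.card Y := by
    have e := Matrix.toLin'OfInv hPQ hQP
    have := e.finrank_eq
    simpa using this.symm
  let e : Y' ≃ Y := Fintype.equivOfCardEq hcard
  have hdet : (P.submatrix e id).det ≠ 0 := by
    intro h0
    have h1 : P.submatrix e id * Q.submatrix id e = 1 := by
      have h2 : P.submatrix e id * Q.submatrix id e = (P * Q).submatrix e e := by
        rw [← Matrix.submatrix_mul_equiv P Q e (Equiv.refl Y') e]
        rfl
      rw [h2, hPQ, Matrix.submatrix_one_equiv]
    have h2 := congrArg Matrix.det h1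
    rw [Matrix.det_mul, h0, zero_mul, Matrix.det_one] at h2
    exact zero_ne_one h2
  rw [Matrix.det_apply] at hdet
  obtain ⟨σ, -, hσ⟩ := Finset.exists_ne_zero_of_sum_ne_zero hdet
  refine ⟨σ.trans e, fun y' hy => ?_⟩
  apply hσ
  rw [Finset.prod_eq_zero (Finset.mem_univ y'), smul_zero]
  have hy2 : κ (e (σ y')) (a' y') = 1 := hy
  show Multiplicative.toAdd (κ (e (σ y')) (a' y')) = 0
  rw [hy2]; rfl

theorem cyc_inv {G : Type*} [Group G] {ρ : G} {i j : ℤ} (hi : ρ ^ i ≠ 1) (hj : ρ ^ j ≠ 1)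
    (hi2 : ρ ^ (2 * i) = 1) (hj2 : ρ ^ (2 * j) = 1) : ρ ^ i = ρ ^ j := by
  rw [Ne, ← orderOf_dvd_iff_zpow_eq_one] at hi hj
  rw [← orderOf_dvd_iff_zpow_eq_one] at hi2 hj2
  have h : (orderOf ρ : ℤ) ∣ i - j := by
    obtain ⟨p, hp⟩ := hi2
    obtain ⟨q, hq⟩ := hj2
    have hpo : Odd p := by
      rw [← Int.not_even_iff_odd]
      rintro ⟨x, rfl⟩
      exact hi ⟨x, by linarith⟩
    have hqo : Odd q := by
      rw [← Int.not_even_iff_odd]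
      rintro ⟨x, rfl⟩
      exact hj ⟨x, by linarith⟩
    obtain ⟨x, rfl⟩ := hpo
    obtain ⟨y, rfl⟩ := hqo
    exact ⟨x - y, by linarith⟩
  rw [orderOf_dvd_iff_zpow_eq_one, zpow_sub] at h
  exact mul_inv_eq_one.1 h

section L2
variable {B B' G : Type*} [Group G] {M : CoxeterMatrix B} {M' : CoxeterMatrix B'}

theorem kap_K (cs : CoxeterSystem M G) {b c : B} {κ : G →* Z2}
    (hκ : ∀ x, x ≠ b → κ (cs.simple x) = 1) {k : G} (hk : k ∈ Par cs ({b, c} : Set B)ᶜ) :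
    κ k = 1 := by
  refine Par_induction cs (p := fun k => κ k = 1) (map_one _) ?_ hk
  intro w _ i hi ih
  simp only [Set.mem_compl_iff, Set.mem_insert_iff, Set.mem_singleton_iff, not_or] at hi
  rw [map_mul, ih, hκ i hi.1, mul_one]

theorem refl_form [Finite G] (cs : CoxeterSystem M G) (cs' : CoxeterSystem M' G)
    (hM : Matching M) (hE : StrongEven M) (hM' : Matching M') {b' c' : B'} (hbc' : b' ≠ c')
    (h2' : M' b' c' ≠ 2) {b c : B} (hbc : b ≠ c) (h2 : M b c ≠ 2) (κ : G →* Z2)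
    (hκ : ∀ x, x ≠ b → κ (cs.simple x) = 1) (hb : κ (cs'.simple b') ≠ 1) :
    ∃ j : ℤ, ∃ k ∈ Par cs ({b, c} : Set B)ᶜ, (∀ g, Commute k g) ∧
      cs'.simple b' = (cs.simple b * cs.simple c) ^ j * cs.simple b * k := by
  have hgg : cs'.simple b' * cs'.simple b' = 1 := by simp
  -- involutions
  have inv_gen : ∀ (b c : B), b ≠ c → M b c ≠ 2 → ∀ (j : ℤ), ∀ k ∈ Par cs ({b, c} : Set B)ᶜ,
      cs'.simple b' = (cs.simple b * cs.simple c) ^ j * cs.simple b * k →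
      ∃ i : ℤ, (cs'.simple b' * cs'.simple c') ^ i ∈ Par cs {b, c} ∧
        (cs'.simple b' * cs'.simple c') ^ i ≠ 1 ∧
        (cs'.simple b' * cs'.simple c') ^ (2 * i) = 1 := by
    intro b c hbc h2 j k hk h
    obtain ⟨n, hn⟩ := (hE b c hbc).resolve_left h2
    have hn0 : n ≠ 0 := by rintro rfl; exact M_fin cs b c (by omega)
    have h3 := refl_conj cs hM hbc h2 hk h n
    obtain ⟨i, hi⟩ := b_comm cs' hM' hbc' h2' ((cs.simple b * cs.simple c) ^ (n : ℤ))
    rw [h3] at hi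
    refine ⟨2 * i, ?_, ?_, ?_⟩
    · rw [← hi]; exact r_mem cs b c _
    · rw [← hi, Ne, ← orderOf_dvd_iff_zpow_eq_one, orderOf_simple_mul, hn]
      intro hd
      have hd : ((4 * n : ℕ) : ℤ) ∣ ((2 * n : ℕ) : ℤ) := by
        push_cast at hd ⊢
        rw [mul_neg, dvd_neg] at hd
        exact hd
      have := Nat.le_of_dvd (by omega) (Int.natCast_dvd_natCast.1 hd)
      omega
    · rw [mul_comm, zpow_mul, ← hi, ← zpow_mul, ← orderOf_dvd_iff_zpow_eq_one,
        orderOf_simple_mul, hn]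
      exact ⟨-1, by push_cast; ring⟩
  obtain ⟨j, k, hk, h | h⟩ := frame_decomp cs hM hbc h2 (cs'.simple b')
  · exfalso
    apply hb
    have h3 := sq_first cs hM hbc h2 hk h hgg
    rw [← orderOf_dvd_iff_zpow_eq_one, orderOf_simple_mul] at h3
    obtain ⟨n, hn⟩ := (hE b c hbc).resolve_left h2
    rw [hn] at h3
    obtain ⟨q, hq⟩ := h3
    have hj : Even j := ⟨n * q, by push_cast at hq; linarith⟩
    rw [h, map_mul, map_zpow, Z2_zpow_even _ hj, kap_K cs hκ hk, mul_one]
  · refine ⟨j, k, hk, ?_, h⟩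
    have hK := match_K cs hM hbc h2 hk
    apply central_of cs
    intro d
    by_cases hdb : d = b
    · rw [hdb]; exact hK.1
    by_cases hdc : d = c
    · rw [hdc]; exact hK.2
    have hd := match_comm cs hM hbc h2 hdb hdc
    have hcomm : Commute (cs'.simple b') (cs.simple d) := by
      by_contra hnc
      obtain ⟨e, hde, h2e⟩ := exists_partner cs hnc
      have heb : e ≠ b := by
        rintro rfl; exact h2e (two_of_comm cs hde hd.1)
      have hec : e ≠ c := by
        rintro rfl; exact h2e (two_of_comm cs hde hd.2)
      obtain ⟨j2, k2, hk2, h5 | h5⟩ := frame_decomp cs hM hde h2e (cs'.simple b')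
      · exact hnc (sq_first_comm cs hM hde h2e hk2 h5 hgg)
      · obtain ⟨i1, p1, q1, s1⟩ := inv_gen b c hbc h2 j k hk h
        obtain ⟨i2, p2, q2, s2⟩ := inv_gen d e hde h2e j2 k2 hk2 h5
        have e12 := cyc_inv q1 q2 s1 s2
        apply q1
        apply Par_disj cs p1
        rw [e12]
        apply Par_mono cs _ p2
        rintro x (rfl | rfl)
        · simp [hdb, hdc]
        · simp [heb, hec]
    have e : k = ((cs.simple b * cs.simple c) ^ j * cs.simple b)⁻¹ * cs'.simple b' := by
      rw [h]; group
    rw [e]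
    apply Commute.mul_left _ hcomm
    apply Commute.inv_left
    exact (((hd.1.mul_right hd.2).zpow_right j).mul_right hd.1).symm

theorem m_eq [Finite G] (cs : CoxeterSystem M G) (cs' : CoxeterSystem M' G)
    (hM : Matching M) (hE : StrongEven M) (hM' : Matching M') (hE' : StrongEven M')
    {b' c' : B'} (hbc' : b' ≠ c')
    (h2' : M' b' c' ≠ 2) {b c : B} (hbc : b ≠ c) (h2 : M b c ≠ 2) (κ : G →* Z2)
    (hκ : ∀ x, x ≠ b → κ (cs.simple x) = 1) (hb : κ (cs'.simple b') ≠ 1) :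
    M b c = M' b' c' := by
  obtain ⟨j, k, hk, hkc, h⟩ := refl_form cs cs' hM hE hM' hbc' h2' hbc h2 κ hκ hb
  have hK := match_K cs hM hbc h2 hk
  apply Nat.dvd_antisymm
  · have h3 := refl_conj cs hM hbc h2 hk h 1
    obtain ⟨i, hi⟩ := b_comm cs' hM' hbc' h2' ((cs.simple b * cs.simple c) ^ (1 : ℤ))
    rw [h3] at hi
    obtain ⟨n, hn⟩ := (hE' b' c' hbc').resolve_left h2'
    have h4 : (cs.simple b * cs.simple c) ^ (2 * -1 * (2 * n : ℤ)) = 1 := by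
      rw [zpow_mul, hi, ← zpow_mul, ← orderOf_dvd_iff_zpow_eq_one, orderOf_simple_mul, hn]
      exact ⟨i, by push_cast; ring⟩
    rw [← orderOf_dvd_iff_zpow_eq_one, orderOf_simple_mul] at h4
    have h5 : (M b c : ℤ) ∣ (M' b' c' : ℤ) := by
      rw [hn, ← dvd_neg]
      have e : -((4 * n : ℕ) : ℤ) = 2 * -1 * (2 * (n : ℤ)) := by push_cast; ring
      rw [e]; exact h4
    exact_mod_cast h5
  · -- commutator
    obtain ⟨i, hi⟩ : ∃ i : ℤ, (cs'.simple b' * cs'.simple c') ^ (2 : ℤ) =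
        (cs.simple b * cs.simple c) ^ (2 * i) := by
      have e : (cs'.simple b' * cs'.simple c') ^ (2 : ℤ) =
          cs'.simple b' * cs'.simple c' * (cs'.simple b')⁻¹ * (cs'.simple c')⁻¹ := by
        rw [zpow_two, cs'.inv_simple, cs'.inv_simple]; simp only [mul_assoc]
      have gen : ∀ (i : ℤ) (y : G), Commute (cs'.simple b') y →
          cs'.simple c' = (cs.simple b * cs.simple c) ^ i * y →
          cs'.simple b' * cs'.simple c' * (cs'.simple b')⁻¹ * (cs'.simple c')⁻¹ =
          (cs.simple b * cs.simple c) ^ (2 * -i) := by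
        intro i y hy hc
        rw [← refl_conj cs hM hbc h2 hk h i, hc, mul_inv_rev]
        have : y * (cs'.simple b')⁻¹ * y⁻¹ = (cs'.simple b')⁻¹ := by
          rw [← (hy.inv_left).eq]; simp
        calc _ = cs'.simple b' * (cs.simple b * cs.simple c) ^ i *
              (y * (cs'.simple b')⁻¹ * y⁻¹) * ((cs.simple b * cs.simple c) ^ i)⁻¹ := by
              simp only [mul_assoc]
          _ = _ := by rw [this]
      have kcomm : ∀ k2 ∈ Par cs ({b, c} : Set B)ᶜ, Commute (cs'.simple b') k2 := by
        intro k2 hk2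
        have hK2 := match_K cs hM hbc h2 hk2
        rw [h]
        exact Commute.mul_left (((hK2.1.mul_right hK2.2).zpow_right j).mul_right hK2.1).symm
          (hkc k2)
      obtain ⟨i, k2, hk2, h5 | h5⟩ := frame_decomp cs hM hbc h2 (cs'.simple c')
      · exact ⟨-i, by rw [e, gen i k2 (kcomm k2 hk2) h5]⟩
      · refine ⟨-(i - j), ?_⟩
        rw [e]
        apply gen (i - j) (cs'.simple b' * (k⁻¹ * k2))
        · exact (Commute.refl _).mul_right
            (((hkc _).symm.inv_right).mul_right (kcomm k2 hk2))
        · rw [h5, h, zpow_sub]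
          group
    obtain ⟨n, hn⟩ := (hE b c hbc).resolve_left h2
    have h4 : (cs'.simple b' * cs'.simple c') ^ ((2:ℤ) * (2 * n : ℤ)) = 1 := by
      rw [zpow_mul, hi, ← zpow_mul, ← orderOf_dvd_iff_zpow_eq_one, orderOf_simple_mul, hn]
      exact ⟨i, by push_cast; ring⟩
    rw [← orderOf_dvd_iff_zpow_eq_one, orderOf_simple_mul] at h4
    have h5 : (M' b' c' : ℤ) ∣ (M b c : ℤ) := by
      rw [hn]
      have e : ((4 * n : ℕ) : ℤ) = 2 * (2 * (n : ℤ)) := by push_cast; ring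
      rw [e]; exact h4
    exact_mod_cast h5

def Sgl (M : CoxeterMatrix B) : Set B := {b | ∀ c, b ≠ c → M b c = 2}

theorem sgl_of_central [Finite G] (cs : CoxeterSystem M G) (hM : Matching M) (hE : StrongEven M)
    {b : B} (κ : G →* Z2) (hκ : ∀ x, x ≠ b → κ (cs.simple x) = 1) {z : G}
    (hz : ∀ g, Commute z g) (hzκ : κ z ≠ 1) : b ∈ Sgl M := by
  by_contra hb
  simp only [Sgl, Set.mem_ofPred_eq] at hb
  push Not at hb
  obtain ⟨c, hbc, h2⟩ := hb
  obtain ⟨n, hn⟩ := (hE b c hbc).resolve_left h2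
  have hn0 : n ≠ 0 := by rintro rfl; exact M_fin cs b c (by omega)
  obtain ⟨j, k, hk, h | h⟩ := frame_decomp cs hM hbc h2 z
  · have hK := match_K cs hM hbc h2 hk
    have h3 : Commute ((cs.simple b * cs.simple c) ^ j) (cs.simple b) := by
      have e : (cs.simple b * cs.simple c) ^ j = z * k⁻¹ := by rw [h]; group
      rw [e]; exact (hz _).mul_left hK.1.inv_left
    rw [r_comm_iff, ← orderOf_dvd_iff_zpow_eq_one, orderOf_simple_mul, hn] at h3
    obtain ⟨q, hq⟩ := h3
    have hj : Even j := ⟨n * q, by push_cast at hq; linarith⟩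
    apply hzκ
    rw [h, map_mul, map_zpow, Z2_zpow_even _ hj, kap_K cs hκ hk, mul_one]
  · have h3 := refl_conj cs hM hbc h2 hk h 1
    rw [(hz _).eq, mul_inv_cancel_right, mul_inv_cancel, eq_comm,
      ← orderOf_dvd_iff_zpow_eq_one, orderOf_simple_mul, hn] at h3
    have hd : ((4 * n : ℕ) : ℤ) ∣ ((2 : ℕ) : ℤ) := by
      rw [← dvd_neg]; simpa using h3
    have := Nat.le_of_dvd (by omega) (Int.natCast_dvd_natCast.1 hd)
    omega

theorem sgl_central (cs : CoxeterSystem M G) {b : B} (hb : b ∈ Sgl M) (g : G) :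
    Commute (cs.simple b) g := by
  apply central_of cs
  intro c
  by_cases hbc : b = c
  · rw [hbc]
  · exact comm_of_two cs (hb c hbc)

theorem exists_kap (cs : CoxeterSystem M G) (hE : StrongEven M) :
    ∃ κ : B → (G →* Z2), ∀ b c, κ b (cs.simple c) ≠ 1 ↔ c = b := by
  classical
  have hl : ∀ b : B, M.IsLiftable (fun c => (Multiplicative.ofAdd (if c = b then 1 else 0) : Z2)) := by
    intro b i j
    by_cases hij : i = j
    · subst hij; simp [Z2_sq]
    · have : Even (M i j) := by
        rcases hE i j hij with h | h
        · rw [h]; decide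
        · exact (even_iff_two_dvd.2 (Dvd.dvd.trans (by norm_num) h))
      obtain ⟨n, hn⟩ := this
      rw [hn, pow_add, Z2_sq]
  refine ⟨fun b => cs.lift ⟨_, hl b⟩, fun b c => ?_⟩
  rw [cs.lift_apply_simple (hl b)]
  split_ifs with h
  · simp only [h, iff_true]; decide
  · simp [h]

theorem L2 [Finite G] [Finite B] [Finite B'] (cs : CoxeterSystem M G) (cs' : CoxeterSystem M' G)
    (hM : Matching M) (hE : StrongEven M) (κ : B → (G →* Z2))
    (hκ : ∀ b c, κ b (cs.simple c) ≠ 1 ↔ c = b) (ψ : B' ≃ B)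
    (hψ : ∀ b', κ (ψ b') (cs'.simple b') ≠ 1) (b' c' : B') : M (ψ b') (ψ c') = M' b' c' := by
  have hM' : Matching M' := L1a cs cs' hM
  have hE' : StrongEven M' := L1b cs cs' hM hE
  have hκ1 : ∀ b x, x ≠ b → κ b (cs.simple x) = 1 := fun b x h => not_not.1 (mt (hκ b x).1 h)
  obtain ⟨κ', hκ'⟩ := exists_kap cs' hE'
  have hκ1' : ∀ b x, x ≠ b → κ' b (cs'.simple x) = 1 := fun b x h => not_not.1 (mt (hκ' b x).1 h)
  obtain ⟨ψ2, hψ2⟩ := mat_lemma cs'.simple cs.simple κ' κ hκ' hκ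
    (fun f f' h => cs'.ext_simple h) (fun f f' h => cs.ext_simple h)
  have hs1 : ψ '' (Sgl M') ⊆ Sgl M := by
    rintro _ ⟨x, hx, rfl⟩
    exact sgl_of_central cs hM hE (κ (ψ x)) (hκ1 _) (sgl_central cs' hx) (hψ x)
  have hs2 : ψ2 '' (Sgl M) ⊆ Sgl M' := by
    rintro _ ⟨x, hx, rfl⟩
    exact sgl_of_central cs' hM' hE' (κ' (ψ2 x)) (hκ1' _) (sgl_central cs hx) (hψ2 x)
  have hseq : ψ '' (Sgl M') = Sgl M := by
    apply Set.eq_of_subset_of_ncard_le hs1 _ (Set.toFinite _)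
    rw [Set.ncard_image_of_injective _ ψ.injective]
    have := Set.ncard_le_ncard hs2 (Set.toFinite _)
    rwa [Set.ncard_image_of_injective _ ψ2.injective] at this
  have hnon : ∀ x c, x ≠ c → M' x c ≠ 2 → ∃ d, ψ x ≠ d ∧ M (ψ x) d ≠ 2 := by
    intro x c hxc hx2
    by_contra! hcon
    have : ψ x ∈ Sgl M := hcon
    rw [← hseq] at this
    obtain ⟨y, hy, hxy⟩ := this
    rw [ψ.injective hxy] at hy
    exact hx2 (hy c hxc)
  have main : ∀ x y, x ≠ y → M' x y ≠ 2 → M (ψ x) (ψ y) = M' x y := by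
    intro x y hxy hx2
    obtain ⟨c, hbc, h2⟩ := hnon x y hxy hx2
    have hy2 : M' y x ≠ 2 := by rwa [M'.symmetric]
    obtain ⟨e, hde, h2e⟩ := hnon y x (Ne.symm hxy) hy2
    have hm := m_eq cs cs' hM hE hM' hE' hxy hx2 hbc h2 (κ (ψ x)) (hκ1 _) (hψ x)
    have : ψ y = c := by
      by_contra hyc
      have hyb : ψ y ≠ ψ x := fun h => hxy (ψ.injective h).symm
      have mc := match_comm cs hM hbc h2 hyb hyc
      have heb : e ≠ ψ x := by
        rintro rfl; exact h2e (two_of_comm cs hde mc.1)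
      have hec : e ≠ c := by
        rintro rfl; exact h2e (two_of_comm cs hde mc.2)
      have me := match_comm cs hM hbc h2 heb hec
      obtain ⟨j, k, hk, hkc, h⟩ := refl_form cs cs' hM hE hM' hxy hx2 hbc h2 (κ (ψ x)) (hκ1 _) (hψ x)
      obtain ⟨j2, k2, hk2, hkc2, h5⟩ := refl_form cs cs' hM hE hM' (Ne.symm hxy) hy2 hde h2e
        (κ (ψ y)) (hκ1 _) (hψ y)
      apply hx2
      apply two_of_comm cs' hxy
      rw [h5]
      apply Commute.mul_right _ (hkc2 _).symm
      rw [h]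
      apply Commute.mul_left _ (hkc _)
      have a1 : Commute (cs.simple (ψ x)) ((cs.simple (ψ y) * cs.simple e) ^ j2 * cs.simple (ψ y)) :=
        ((mc.1.symm.mul_right me.1.symm).zpow_right j2).mul_right mc.1.symm
      have a2 : Commute (cs.simple c) ((cs.simple (ψ y) * cs.simple e) ^ j2 * cs.simple (ψ y)) :=
        ((mc.2.symm.mul_right me.2.symm).zpow_right j2).mul_right mc.2.symm
      exact ((a1.mul_left a2).zpow_left j).mul_left a1
    rw [this]; exact hm
  by_cases hbc : b' = c'
  · subst hbc; simp
  by_cases h2 : M' b' c' = 2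
  · rw [h2]
    by_contra hne
    -- psi b' is not single, so b' is not single
    have hns : b' ∉ Sgl M' := by
      intro hs
      have : ψ b' ∈ Sgl M := hs1 ⟨b', hs, rfl⟩
      exact hne (this _ (fun h => hbc (ψ.injective h)))
    simp only [Sgl, Set.mem_ofPred_eq] at hns
    push Not at hns
    obtain ⟨e', hbe, h2e⟩ := hns
    have hm := main b' e' hbe h2e
    have hec : e' ≠ c' := by rintro rfl; exact h2e h2
    rcases hM (ψ c') (ψ b') (ψ e') (fun h => hbc (ψ.injective h).symm)
      (fun h => hbe (ψ.injective h)) (fun h => hec (ψ.injective h).symm) with h | h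
    · rw [M.symmetric] at h; exact hne h
    · exact h2e (hm ▸ h)
  · exact main b' c' hbc h2

end L2
end RG

namespace RG

section glob
variable {B B' W : Type*} [Group W] {M : CoxeterMatrix B} {M' : CoxeterMatrix B'}

/-- Local system: the parabolic of `T'` transported to the parabolic of `T`. -/
theorem locCS (cs : CoxeterSystem M W) (cs' : CoxeterSystem M' W) {T : Set B} {T' : Set B'}
    (h : Cor cs cs' T T') :
    ∃ (cs2 : CoxeterSystem (resM M' T') (Par cs T)) (w : W),
      ∀ t : T', ((cs2.simple t : Par cs T) : W) = w * cs'.simple t * w⁻¹ := by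
  obtain ⟨w, hw⟩ := h
  let e : Par cs' T' ≃* Par cs T :=
    { toFun := fun g => ⟨w * g * w⁻¹, by
        rw [hw]; have := g.2; simpa [mul_assoc] using this⟩
      invFun := fun g => ⟨w⁻¹ * g * w, (hw _).1 g.2⟩
      left_inv := fun g => by ext; simp [mul_assoc]
      right_inv := fun g => by ext; simp [mul_assoc]
      map_mul' := fun g h => by ext; simp [mul_assoc] }
  refine ⟨(parCS cs' T').map e, w, fun t => ?_⟩
  rw [CoxeterSystem.map_simple]
  show w * (((parCS cs' T').simple t : Par cs' T') : W) * w⁻¹ = _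
  rw [parCS_simple]

theorem Z2_conj (f : W →* Z2) (w g : W) : f (w * g * w⁻¹) = f g := by
  simp [mul_comm]

theorem Cor_hom (cs : CoxeterSystem M W) (cs' : CoxeterSystem M' W) {T : Set B} {T' : Set B'}
    (h : Cor cs cs' T T') (f : W →* Z2) (hf : ∀ t ∈ T, f (cs.simple t) = 1) {t' : B'}
    (ht : t' ∈ T') : f (cs'.simple t') = 1 := by
  obtain ⟨w, hw⟩ := h
  have h1 : Par cs T ≤ f.ker := by
    rw [Par, Subgroup.closure_le]
    rintro _ ⟨t, ht, rfl⟩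
    exact hf t ht
  have h2 : w * cs'.simple t' * w⁻¹ ∈ Par cs T := by
    rw [hw]
    have := simple_mem_Par cs' ht
    simpa [mul_assoc] using this
  have h3 : f (w * cs'.simple t' * w⁻¹) = 1 := h1 h2
  rwa [Z2_conj] at h3

def YY (M : CoxeterMatrix B) := Quot (fun s t : B => Odd (M s t))

def pr (M : CoxeterMatrix B) (s : B) : YY M := Quot.mk _ s

theorem pr_surj (M : CoxeterMatrix B) (y : YY M) : ∃ s, pr M s = y := Quot.exists_rep y

instance [Finite B] (M : CoxeterMatrix B) : Finite (YY M) := by unfold YY; infer_instance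

theorem pr_odd {s t : B} (h : Odd (M s t)) : pr M s = pr M t := Quot.sound h

theorem hom_odd (cs : CoxeterSystem M W) (f : W →* Z2) {s t : B} (h : Odd (M s t)) :
    f (cs.simple s) = f (cs.simple t) := by
  have h1 := congrArg f (cs.simple_mul_simple_pow s t)
  rw [map_pow, map_mul, map_one] at h1
  obtain ⟨k, hk⟩ := h
  rw [hk, pow_succ, pow_mul, pow_two, Z2_sq, one_pow, one_mul] at h1
  have h2 := Z2_sq (f (cs.simple t))
  exact mul_right_cancel (h1.trans h2.symm)

theorem hom_pr (cs : CoxeterSystem M W) (f : W →* Z2) {s t : B} (h : pr M s = pr M t) :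
    f (cs.simple s) = f (cs.simple t) := by
  have := congrArg (Quot.lift (fun s => f (cs.simple s)) (fun s t h => hom_odd cs f h)) h
  exact this

theorem exists_x (cs : CoxeterSystem M W) :
    ∃ x : YY M → (W →* Z2), ∀ y s, x y (cs.simple s) ≠ 1 ↔ pr M s = y := by
  classical
  have hl : ∀ y : YY M,
      M.IsLiftable (fun c => (Multiplicative.ofAdd (if pr M c = y then 1 else 0) : Z2)) := by
    intro y i j
    rcases Nat.even_or_odd (M i j) with h | h
    · obtain ⟨k, hk⟩ := h
      rw [hk, pow_add, Z2_sq]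
    · simp only [pr_odd h, Z2_sq, one_pow]
  refine ⟨fun y => cs.lift ⟨_, hl y⟩, fun y s => ?_⟩
  rw [cs.lift_apply_simple]
  by_cases h : pr M s = y
  · simp [h]
  · simp [h]

theorem hom_ext_pr (cs : CoxeterSystem M W) (f f' : W →* Z2) (a : YY M → B)
    (ha : ∀ y, pr M (a y) = y) (h : ∀ y, f (cs.simple (a y)) = f' (cs.simple (a y))) : f = f' := by
  apply cs.ext_simple
  intro s
  have e := ha (pr M s)
  rw [← hom_pr cs f e, ← hom_pr cs f' e, h]

theorem exists_psi [Finite B] [Finite B'] (cs : CoxeterSystem M W) (cs' : CoxeterSystem M' W)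
    (x : YY M → (W →* Z2)) (hx : ∀ y s, x y (cs.simple s) ≠ 1 ↔ pr M s = y) :
    ∃ ψ : YY M' ≃ YY M, ∀ s', x (ψ (pr M' s')) (cs'.simple s') ≠ 1 := by
  obtain ⟨x', hx'⟩ := exists_x cs'
  choose a ha using pr_surj M
  choose a' ha' using pr_surj M'
  obtain ⟨ψ, hψ⟩ := mat_lemma (fun y => cs.simple (a y)) (fun y => cs'.simple (a' y)) x x'
    (fun y z => by rw [hx, ha]) (fun y z => by rw [hx', ha'])
    (fun f f' h => hom_ext_pr cs f f' a ha h) (fun f f' h => hom_ext_pr cs' f f' a' ha' h)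
  refine ⟨ψ, fun s' => ?_⟩
  rw [hom_pr cs' (x (ψ (pr M' s'))) (ha' (pr M' s')).symm]
  exact hψ _

theorem psi_sub (cs : CoxeterSystem M W) (cs' : CoxeterSystem M' W)
    (x : YY M → (W →* Z2)) (hx : ∀ y s, x y (cs.simple s) ≠ 1 ↔ pr M s = y)
    (ψ : YY M' ≃ YY M) (hψ : ∀ s', x (ψ (pr M' s')) (cs'.simple s') ≠ 1)
    {T : Set B} {T' : Set B'} (h : Cor cs cs' T T') : ψ '' (pr M' '' T') ⊆ pr M '' T := by
  rintro _ ⟨_, ⟨s', hs', rfl⟩, rfl⟩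
  by_contra hn
  apply hψ s'
  apply Cor_hom cs cs' h _ _ hs'
  intro t ht
  by_contra hc
  exact hn ⟨t, ht, (hx _ _).1 hc⟩

theorem psi_eq [Finite B] [Finite B'] (cs : CoxeterSystem M W) (cs' : CoxeterSystem M' W)
    (x : YY M → (W →* Z2)) (hx : ∀ y s, x y (cs.simple s) ≠ 1 ↔ pr M s = y)
    (ψ : YY M' ≃ YY M) (hψ : ∀ s', x (ψ (pr M' s')) (cs'.simple s') ≠ 1)
    {T : Set B} {T' : Set B'} (h : Cor cs cs' T T') (y' : YY M') :
    y' ∈ pr M' '' T' ↔ ψ y' ∈ pr M '' T := by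
  obtain ⟨x', hx'⟩ := exists_x cs'
  obtain ⟨ψ2, hψ2⟩ := exists_psi cs' cs x' hx'
  have h1 := psi_sub cs cs' x hx ψ hψ h
  have h2 := psi_sub cs' cs x' hx' ψ2 hψ2 (Cor.symm cs cs' h)
  have e : ψ '' (pr M' '' T') = pr M '' T := by
    apply Set.eq_of_subset_of_ncard_le h1 _ (Set.toFinite _)
    rw [Set.ncard_image_of_injective _ ψ.injective,
      ← Set.ncard_image_of_injective (pr M '' T) ψ2.injective]
    exact Set.ncard_le_ncard h2 (Set.toFinite _)
  rw [← e, ψ.injective.mem_set_image]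

/-- Structural conditions. -/
structure Good (cs : CoxeterSystem M W) : Prop where
  typ : ∀ T, MaxSph cs T → (∃ s t, s ≠ t ∧ T = {s, t} ∧ Odd (M s t)) ∨ StrongEven (resM M T)
  two : ∀ s t u, s ≠ t → t ≠ u → Odd (M s t) → Odd (M t u) → s = u
  three : ∀ s t, s ≠ t → Odd (M s t) → ∀ T₁ T₂, MaxSph cs T₁ → MaxSph cs T₂ →
    (T₁ ∩ {s, t}).Nonempty → (T₂ ∩ {s, t}).Nonempty → T₁ ≠ {s, t} → T₂ ≠ {s, t} → T₁ = T₂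

theorem strong_even_odd {T : Set B} (h : StrongEven (resM M T)) {s t : B} (hs : s ∈ T) (ht : t ∈ T)
    (hne : s ≠ t) : ¬ Odd (M s t) := by
  intro ho
  have := h ⟨s, hs⟩ ⟨t, ht⟩ (by simpa using hne)
  rw [resM_apply] at this
  simp only at this
  rcases this with h | h
  · rw [h] at ho; revert ho; decide
  · rw [← Nat.not_even_iff_odd] at ho
    exact ho ((by decide : Even 4).trans_dvd h)

theorem matching_of (cs : CoxeterSystem M W) {T : Set B} (hT : MaxSph cs T)
    (h : StrongEven (resM M T)) : Matching (resM M T) := by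
  intro a b c hab hbc hac
  by_contra hn
  push Not at hn
  have e1 := (h a b hab).resolve_left hn.1
  have e2 := (h b c hbc).resolve_left hn.2
  rw [resM_apply] at e1 e2
  have n1 := M_ne_zero_of_fin cs hT.1 a.2 b.2
  have n2 := M_ne_zero_of_fin cs hT.1 b.2 c.2
  exact not_fin_of_path cs a.2 b.2 c.2 (by simpa [Subtype.ext_iff] using hab)
    (by simpa [Subtype.ext_iff] using hbc) (by simpa [Subtype.ext_iff] using hac)
    (Or.inr (Nat.le_of_dvd (by omega) e1)) (Or.inr (Nat.le_of_dvd (by omega) e2)) hT.1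

theorem typ_odd (cs : CoxeterSystem M W) (cs' : CoxeterSystem M' W) {T : Set B} {T' : Set B'}
    (hT : MaxSph cs T) (h : Cor cs cs' T T') {s t : B} (hne : s ≠ t) (hTe : T = {s, t})
    (ho : Odd (M s t)) : ∃ s' t', s' ≠ t' ∧ T' = {s', t'} ∧ M' s' t' = M s t := by
  obtain ⟨cs2, -, -⟩ := locCS cs cs' h
  have := hT.1
  have hs : s ∈ T := by rw [hTe]; simp
  have ht : t ∈ T := by rw [hTe]; simp
  obtain ⟨s', t', h1, h2, h3⟩ := L1c (parCS cs T) cs2 (s := ⟨s, hs⟩) (t := ⟨t, ht⟩)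
    (by simpa using hne) (by
      rintro ⟨x, hx⟩
      have hx2 := hx
      rw [hTe] at hx2
      simpa using hx2) (by rw [resM_apply]; exact ho)
  rw [resM_apply, resM_apply] at h3
  refine ⟨s', t', fun h => h1 (Subtype.ext h), ?_, h3⟩
  ext z
  constructor
  · intro hz
    rcases h2 ⟨z, hz⟩ with h | h
    · left; exact congrArg Subtype.val h
    · right; exact congrArg Subtype.val h
  · rintro (h | h)
    · rw [h]; exact s'.2
    · rw [Set.mem_singleton_iff.1 h]; exact t'.2

theorem typ_even (cs : CoxeterSystem M W) (cs' : CoxeterSystem M' W) {T : Set B} {T' : Set B'}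
    (hT : MaxSph cs T) (h : Cor cs cs' T T') (hE : StrongEven (resM M T)) :
    StrongEven (resM M' T') := by
  obtain ⟨cs2, -, -⟩ := locCS cs cs' h
  have := hT.1
  exact L1b (parCS cs T) cs2 (matching_of cs hT hE) hE

theorem odd_max [Finite B] (cs : CoxeterSystem M W)
    (typ : ∀ T, MaxSph cs T → (∃ s t, s ≠ t ∧ T = {s, t} ∧ Odd (M s t)) ∨ StrongEven (resM M T))
    {s t : B} (hne : s ≠ t) (ho : Odd (M s t)) : MaxSph cs {s, t} := by
  have h0 : M s t ≠ 0 := by intro h; rw [h] at ho; revert ho; decide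
  obtain ⟨U, hU, hs⟩ := ext_max cs (Par_pair_finite cs h0)
  have hsU : s ∈ U := hs (by simp)
  have htU : t ∈ U := hs (by simp)
  rcases typ U hU with ⟨a, b, hab, rfl, -⟩ | h
  · have : ({a, b} : Set B) = {s, t} := by
      rcases hsU with rfl | hsU <;> rcases htU with rfl | htU
      · exact absurd rfl hne
      · rw [Set.mem_singleton_iff.1 htU]
      · rw [Set.mem_singleton_iff.1 hsU, Set.pair_comm]
      · rw [Set.mem_singleton_iff.1 hsU, Set.mem_singleton_iff.1 htU] at hne
        exact absurd rfl hne
    rwa [← this]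
  · exact absurd ho (strong_even_odd h hsU htU hne)

theorem pr_eq (cs : CoxeterSystem M W)
    (two : ∀ s t u, s ≠ t → t ≠ u → Odd (M s t) → Odd (M t u) → s = u)
    {s t : B} : pr M s = pr M t ↔ s = t ∨ Odd (M s t) := by
  constructor
  · intro h
    have key : ∀ a b : B, Odd (M a b) → ({u | a = u ∨ Odd (M a u)} : Set B) =
        {u | b = u ∨ Odd (M b u)} := by
      intro a b hab
      by_cases e : a = b
      · rw [e]
      have hba : Odd (M b a) := by rw [M.symmetric b a] ; exact hab
      ext u
      simp only [Set.mem_ofPred_eq]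
      constructor
      · rintro (rfl | h)
        · exact Or.inr hba
        · by_cases hu : a = u
          · subst hu; exact Or.inr hba
          · left; exact two b a u (Ne.symm e) hu hba h
      · rintro (rfl | h)
        · exact Or.inr hab
        · by_cases hu : b = u
          · subst hu; exact Or.inr hab
          · left; exact two a b u e hu hab h
    have h2 := congrArg (Quot.lift (fun a => ({u | a = u ∨ Odd (M a u)} : Set B)) key) h
    have h3 : ({u | s = u ∨ Odd (M s u)} : Set B) = {u | t = u ∨ Odd (M t u)} := h2
    have : t ∈ ({u | s = u ∨ Odd (M s u)} : Set B) := by rw [h3]; exact Or.inl rfl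
    exact this
  · rintro (rfl | h)
    · rfl
    · exact pr_odd h

end glob
end RG

namespace RG

section glob2
variable {B B' W : Type*} [Group W] {M : CoxeterMatrix B} {M' : CoxeterMatrix B'}

theorem good_transfer [Finite B] [Finite B'] (cs : CoxeterSystem M W) (cs' : CoxeterSystem M' W)
    (hG : Good cs) : Good cs' := by
  obtain ⟨x, hx⟩ := exists_x cs
  obtain ⟨ψ, hψ⟩ := exists_psi cs cs' x hx
  have hpe := fun {T : Set B} {T' : Set B'} (h : Cor cs cs' T T') (y' : YY M') =>
    psi_eq cs cs' x hx ψ hψ h y'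
  have cor : ∀ T', MaxSph cs' T' → ∃ T, MaxSph cs T ∧ Cor cs cs' T T' := by
    intro T' hT'
    obtain ⟨T, hT, h⟩ := Cor_exists cs' cs hT'
    exact ⟨T, hT, Cor.symm cs' cs h⟩
  have typ : ∀ T', MaxSph cs' T' →
      (∃ s t, s ≠ t ∧ T' = {s, t} ∧ Odd (M' s t)) ∨ StrongEven (resM M' T') := by
    intro T' hT'
    obtain ⟨T, hT, h⟩ := cor T' hT'
    rcases hG.typ T hT with ⟨s, t, hne, he, ho⟩ | hE
    · obtain ⟨s', t', h1, h2, h3⟩ := typ_odd cs cs' hT h hne he ho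
      exact Or.inl ⟨s', t', h1, h2, by rw [h3]; exact ho⟩
    · exact Or.inr (typ_even cs cs' hT h hE)
  -- odd pairs correspond to odd pairs
  have oddcor : ∀ s' t', s' ≠ t' → Odd (M' s' t') → ∃ s t, s ≠ t ∧ Odd (M s t) ∧
      MaxSph cs {s, t} ∧ Cor cs cs' {s, t} {s', t'} := by
    intro s' t' hne ho
    have h1 := odd_max cs' typ hne ho
    obtain ⟨T, hT, h⟩ := cor _ h1
    obtain ⟨s, t, h2, h3, h4⟩ := typ_odd cs' cs h1 (Cor.symm cs cs' h) hne rfl ho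
    refine ⟨s, t, h2, by rw [h4]; exact ho, by rwa [← h3], by rwa [← h3]⟩
  -- meeting
  have meet : ∀ s' t' s t, s' ≠ t' → Odd (M' s' t') → s ≠ t → Odd (M s t) →
      Cor cs cs' {s, t} {s', t'} → ∀ T T', Cor cs cs' T T' → (T' ∩ {s', t'}).Nonempty →
      (T ∩ {s, t}).Nonempty := by
    rintro s' t' s t hne' ho' hne ho h T T' hT ⟨z', hz1, hz2⟩
    obtain ⟨a, ha, hae⟩ := (hpe h (pr M' z')).1 ⟨z', hz2, rfl⟩
    obtain ⟨b, hb, hbe⟩ := (hpe hT (pr M' z')).1 ⟨z', hz1, rfl⟩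
    have e := (pr_eq cs hG.two).1 (hae.trans hbe.symm)
    refine ⟨b, hb, ?_⟩
    rcases e with rfl | e
    · exact ha
    · by_cases hab : a = b
      · exact hab ▸ ha
      have ho2 : Odd (M t s) := by rw [M.symmetric t s]; exact ho
      rcases ha with rfl | ha
      · right; exact (hG.two t a b hne.symm hab ho2 e).symm
      · rw [Set.mem_singleton_iff] at ha
        subst ha
        left; exact (hG.two s a b hne hab ho e).symm
  refine ⟨typ, ?_, ?_⟩
  · intro a b c hab hbc o1 o2
    obtain ⟨s, t, n1, o3, m1, c1⟩ := oddcor a b hab o1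
    obtain ⟨u, v, n2, o4, m2, c2⟩ := oddcor b c hbc o2
    have hm := meet a b s t hab o1 n1 o3 c1 {u, v} {b, c} c2 ⟨b, by simp, by simp⟩
    have he : ({s, t} : Set B) = {u, v} := by
      by_contra hn
      obtain ⟨z, hz1, hz2⟩ := hm
      have o3' : Odd (M t s) := by rw [M.symmetric t s]; exact o3
      have o4' : Odd (M v u) := by rw [M.symmetric v u]; exact o4
      apply hn
      rcases hz1 with rfl | hz1 <;> rcases hz2 with rfl | hz2
      · rw [hG.two t z v n1.symm n2 o3' o4]
      · rw [Set.mem_singleton_iff] at hz2; subst hz2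
        rw [hG.two s z v n1 n2 o3 o4, Set.pair_comm]
      · rw [Set.mem_singleton_iff] at hz1; subst hz1
        rw [hG.two t z u n1.symm n2.symm o3' o4', Set.pair_comm]
      · rw [Set.mem_singleton_iff] at hz1 hz2; subst hz1; subst hz2
        rw [hG.two s z u n1 n2.symm o3 o4']
    have he' : ({a, b} : Set B') = {b, c} := by
      refine Cor_unique cs cs' (T := {s, t}) (odd_max cs' typ hab o1) (odd_max cs' typ hbc o2) c1 ?_
      rw [he]; exact c2
    have : a ∈ ({b, c} : Set B') := by rw [← he']; simp
    rcases this with h | h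
    · exact absurd h hab
    · exact h
  · intro s' t' hne' ho' T1' T2' m1' m2' i1 i2 n1 n2
    obtain ⟨s, t, hne, ho, m, c⟩ := oddcor s' t' hne' ho'
    obtain ⟨T1, m1, c1⟩ := cor T1' m1'
    obtain ⟨T2, m2, c2⟩ := cor T2' m2'
    have m' := odd_max cs' typ hne' ho'
    have e := hG.three s t hne ho T1 T2 m1 m2 (meet s' t' s t hne' ho' hne ho c T1 T1' c1 i1)
      (meet s' t' s t hne' ho' hne ho c T2 T2' c2 i2)
      (by rintro rfl; exact n1 (Cor_unique cs cs' m1' m' c1 c))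
      (by rintro rfl; exact n2 (Cor_unique cs cs' m2' m' c2 c))
    subst e
    exact Cor_unique cs cs' m1' m2' c1 c2

theorem pair_equiv {F F' : Type*} (s t : F) (s' t' : F') (hne : s ≠ t) (hne' : s' ≠ t')
    (h : ∀ x, x = s ∨ x = t) (h' : ∀ x, x = s' ∨ x = t') :
    ∃ e : F' ≃ F, e s' = s ∧ e t' = t := by
  classical
  refine ⟨Equiv.ofBijective (fun x => if x = s' then s else t) ⟨?_, ?_⟩, ?_, ?_⟩
  · intro a b hab
    have hab : (if a = s' then s else t) = (if b = s' then s else t) := hab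
    have hb : ∀ x, x = t' → x ≠ s' := fun x hx h => hne' (h.symm.trans hx)
    rcases h' a with h1 | h1 <;> rcases h' b with h2 | h2
    · rw [h1, h2]
    · rw [if_pos h1, if_neg (hb b h2)] at hab; exact absurd hab hne
    · rw [if_neg (hb a h1), if_pos h2] at hab; exact absurd hab.symm hne
    · rw [h1, h2]
  · intro a
    rcases h a with h1 | h1
    · exact ⟨s', by rw [h1]; exact if_pos rfl⟩
    · exact ⟨t', by rw [h1]; exact if_neg hne'.symm⟩
  · exact if_pos rfl
  · exact if_neg hne'.symm

theorem mem_of_meet (cs : CoxeterSystem M W) {s t : B} (hm : MaxSph cs {s, t}) {T : Set B}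
    (hT : MaxSph cs T) (hn : T ≠ {s, t}) (hs : s ∈ T) : t ∉ T := by
  intro ht
  exact hn (hm.2 T hT.1 (by rintro x (rfl | rfl) <;> assumption))

/-- fibrewise bijections -/
theorem fib_equiv [Finite B] [Finite B'] (cs : CoxeterSystem M W) (cs' : CoxeterSystem M' W)
    (hG : Good cs) (hG' : Good cs') (ψ : YY M' ≃ YY M)
    (hpe : ∀ T T', Cor cs cs' T T' → ∀ y', y' ∈ pr M' '' T' ↔ ψ y' ∈ pr M '' T) (y' : YY M') :
    ∃ e : {s' // pr M' s' = y'} ≃ {s // pr M s = ψ y'}, ∀ T T', MaxSph cs T → MaxSph cs' T' →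
      Cor cs cs' T T' → ∀ s', s'.1 ∈ T' ↔ (e s').1 ∈ T := by
  obtain ⟨s', hs'⟩ := pr_surj M' y'
  obtain ⟨s, hs⟩ := pr_surj M (ψ y')
  by_cases hc : ∃ t', s' ≠ t' ∧ Odd (M' s' t')
  · obtain ⟨t', hne', ho'⟩ := hc
    have m' := odd_max cs' hG'.typ hne' ho'
    obtain ⟨T0, m, c⟩ := Cor_exists cs' cs m'
    obtain ⟨a, b, hab, rfl, ho⟩ := typ_odd cs' cs m' c hne' rfl ho'
    have c := Cor.symm cs' cs c
    rw [← ho] at ho'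
    have pt' : pr M' t' = y' := by
      rw [← hs']; exact (pr_odd (by rw [← ho]; exact ho')).symm
    have pab : pr M a = pr M b := pr_odd ho'
    have pa : pr M a = ψ y' := by
      obtain ⟨z, hz, hz2⟩ := (hpe _ _ c y').1 ⟨s', by simp, hs'⟩
      rcases hz with rfl | hz
      · exact hz2
      · rw [Set.mem_singleton_iff] at hz; subst hz; rw [pab]; exact hz2
    have pb : pr M b = ψ y' := pab ▸ pa
    have oo' : Odd (M' s' t') := by rw [← ho]; exact ho'
    have fib' : ∀ z, pr M' z = y' → z = s' ∨ z = t' := by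
      intro z hz
      rcases (pr_eq cs' hG'.two).1 (hz.trans hs'.symm) with h | h
      · exact Or.inl h
      · by_cases hzs : z = s'
        · exact Or.inl hzs
        · right; exact hG'.two z s' t' hzs hne' h oo'
    have fib : ∀ z, pr M z = ψ y' → z = a ∨ z = b := by
      intro z hz
      rcases (pr_eq cs hG.two).1 (hz.trans pa.symm) with h | h
      · exact Or.inl h
      · by_cases hzs : z = a
        · exact Or.inl hzs
        · right; exact hG.two z a b hzs hab h ho'
    -- it suffices to find a good naming
    have suff : ∀ u v u' v', u ≠ v → u' ≠ v' → (∀ z, pr M z = ψ y' → z = u ∨ z = v) →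
        (∀ z, pr M' z = y' → z = u' ∨ z = v') → pr M u = ψ y' → pr M v = ψ y' →
        pr M' u' = y' → pr M' v' = y' →
        (∀ T T', MaxSph cs T → MaxSph cs' T' → Cor cs cs' T T' →
          (u' ∈ T' ↔ u ∈ T) ∧ (v' ∈ T' ↔ v ∈ T)) →
        ∃ e : {s' // pr M' s' = y'} ≃ {s // pr M s = ψ y'}, ∀ T T', MaxSph cs T →
          MaxSph cs' T' → Cor cs cs' T T' → ∀ s', s'.1 ∈ T' ↔ (e s').1 ∈ T := by
      intro u v u' v' huv huv' f f' pu pv pu' pv' H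
      obtain ⟨e, e1, e2⟩ := pair_equiv (F := {s // pr M s = ψ y'}) (F' := {s' // pr M' s' = y'})
        ⟨u, pu⟩ ⟨v, pv⟩ ⟨u', pu'⟩ ⟨v', pv'⟩ (by simpa using huv) (by simpa using huv')
        (fun x => by
          rcases f x.1 x.2 with h | h
          · left; exact Subtype.ext h
          · right; exact Subtype.ext h)
        (fun x => by
          rcases f' x.1 x.2 with h | h
          · left; exact Subtype.ext h
          · right; exact Subtype.ext h)
      refine ⟨e, fun T T' mT mT' cT x => ?_⟩
      obtain ⟨H1, H2⟩ := H T T' mT mT' cT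
      rcases f' x.1 x.2 with h | h
      · have : x = ⟨u', pu'⟩ := Subtype.ext h
        subst this; rw [e1]; exact H1
      · have : x = ⟨v', pv'⟩ := Subtype.ext h
        subst this; rw [e2]; exact H2
    -- unmet pairs
    have unmet : ∀ T T', Cor cs cs' T T' → s' ∉ T' → t' ∉ T' → a ∉ T ∧ b ∉ T := by
      intro T T' cT h1 h2
      have : ψ y' ∉ pr M '' T := by
        rw [← hpe T T' cT]
        rintro ⟨z, hz, hz2⟩
        rcases fib' z hz2 with rfl | rfl
        · exact h1 hz
        · exact h2 hz
      exact ⟨fun h => this ⟨a, h, pa⟩, fun h => this ⟨b, h, pb⟩⟩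
    by_cases hex : ∃ T1', MaxSph cs' T1' ∧ T1' ≠ {s', t'} ∧ (T1' ∩ {s', t'}).Nonempty
    · obtain ⟨T1', m1', n1', i1'⟩ := hex
      obtain ⟨T1, m1, c1⟩ := Cor_exists cs' cs m1'
      have c1 := Cor.symm cs' cs c1
      have n1 : T1 ≠ {a, b} := by
        rintro rfl; exact n1' (Cor_unique cs cs' m1' m' c1 c)
      have i1 : a ∈ T1 ∨ b ∈ T1 := by
        have : y' ∈ pr M' '' T1' := by
          obtain ⟨z, hz1, rfl | hz2⟩ := i1'
          · exact ⟨_, hz1, hs'⟩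
          · rw [Set.mem_singleton_iff] at hz2; subst hz2
            exact ⟨_, hz1, pt'⟩
        rw [hpe _ _ c1] at this
        obtain ⟨z, hz, hz2⟩ := this
        rcases fib z hz2 with rfl | rfl
        · exact Or.inl hz
        · exact Or.inr hz
      have good : ∀ u v u' v', ({u, v} : Set B) = {a, b} → ({u', v'} : Set B') = {s', t'} →
          u ∈ T1 → u' ∈ T1' → ∀ T T', MaxSph cs T → MaxSph cs' T' → Cor cs cs' T T' →
          (u' ∈ T' ↔ u ∈ T) ∧ (v' ∈ T' ↔ v ∈ T) := by
        intro u v u' v' e e' hu hu' T T' mT mT' cT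
        by_cases hT : T' = {s', t'}
        · have : T = {a, b} := by
            subst hT
            exact Cor_unique cs' cs mT m (Cor.symm cs cs' cT) (Cor.symm cs cs' c)
          rw [hT, this, ← e, ← e']; simp
        · by_cases hi : (T' ∩ {s', t'}).Nonempty
          · have : T' = T1' := hG'.three s' t' hne' oo' T' T1' mT' m1' hi i1' hT n1'
            subst this
            have : T = T1 := Cor_unique cs' cs mT m1 (Cor.symm cs cs' cT) (Cor.symm cs cs' c1)
            subst this
            have h1 : v ∉ T := mem_of_meet cs (by rw [e]; exact m) mT (by rw [e]; exact n1) hu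
            have h2 : v' ∉ T' :=
              mem_of_meet cs' (by rw [e']; exact m') mT' (by rw [e']; exact hT) hu'
            simp [hu, hu', h1, h2]
          · have h1 : s' ∉ T' := fun h => hi ⟨s', h, by simp⟩
            have h2 : t' ∉ T' := fun h => hi ⟨t', h, by simp⟩
            obtain ⟨h3, h4⟩ := unmet T T' cT h1 h2
            have hu : ∀ z ∈ ({u, v} : Set B), z ∉ T := by
              rw [e]; rintro z (rfl | rfl) <;> assumption
            have hu' : ∀ z ∈ ({u', v'} : Set B'), z ∉ T' := by
              rw [e']; rintro z (rfl | rfl) <;> assumption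
            simp [hu u (by simp), hu v (by simp), hu' u' (by simp), hu' v' (by simp)]
      have i1'' : s' ∈ T1' ∨ t' ∈ T1' := by
        obtain ⟨z, hz1, rfl | hz2⟩ := i1'
        · exact Or.inl hz1
        · rw [Set.mem_singleton_iff] at hz2; subst hz2; exact Or.inr hz1
      rcases i1 with h1 | h1 <;> rcases i1'' with h2 | h2
      · exact suff a b s' t' hab hne' fib fib' pa pb hs' pt'
          (good a b s' t' rfl rfl h1 h2)
      · exact suff a b t' s' hab hne'.symm fib (fun z hz => (fib' z hz).symm) pa pb pt' hs'
          (good a b t' s' rfl (Set.pair_comm _ _) h1 h2)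
      · exact suff b a s' t' hab.symm hne' (fun z hz => (fib z hz).symm) fib' pb pa hs' pt'
          (good b a s' t' (Set.pair_comm _ _) rfl h1 h2)
      · exact suff b a t' s' hab.symm hne'.symm (fun z hz => (fib z hz).symm)
          (fun z hz => (fib' z hz).symm) pb pa pt' hs'
          (good b a t' s' (Set.pair_comm _ _) (Set.pair_comm _ _) h1 h2)
    · refine suff a b s' t' hab hne' fib fib' pa pb hs' pt' ?_
      intro T T' mT mT' cT
      by_cases hT : T' = {s', t'}
      · have : T = {a, b} := by
          subst hT
          exact Cor_unique cs' cs mT m (Cor.symm cs cs' cT) (Cor.symm cs cs' c)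
        rw [hT, this]; simp
      · have hi : ¬ (T' ∩ {s', t'}).Nonempty := fun h => hex ⟨T', mT', hT, h⟩
        have h1 : s' ∉ T' := fun h => hi ⟨s', h, by simp⟩
        have h2 : t' ∉ T' := fun h => hi ⟨t', h, by simp⟩
        obtain ⟨h3, h4⟩ := unmet T T' cT h1 h2
        simp [h1, h2, h3, h4]
  · push Not at hc
    have fib' : ∀ z, pr M' z = y' → z = s' := by
      intro z hz
      by_contra hn
      rcases (pr_eq cs' hG'.two).1 (hs'.trans hz.symm) with h | h
      · exact hn h.symm
      · exact hc z (Ne.symm hn) h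
    have fib : ∀ z, pr M z = ψ y' → z = s := by
      intro z hz
      by_contra hn
      rcases (pr_eq cs hG.two).1 (hz.trans hs.symm) with h | h
      · exact hn h
      · have m := odd_max cs hG.typ hn h
        obtain ⟨T', m', c⟩ := Cor_exists cs cs' m
        obtain ⟨a', b', hab, rfl, ho⟩ := typ_odd cs cs' m c hn rfl h
        have ho' : Odd (M' a' b') := by rw [ho]; exact h
        have : y' ∈ pr M' '' {a', b'} := by
          rw [hpe _ _ c]; exact ⟨z, by simp, hz⟩
        obtain ⟨u, hu, hu2⟩ := this
        have e : pr M' a' = y' ∧ pr M' b' = y' := by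
          rcases hu with rfl | hu
          · exact ⟨hu2, by rw [← pr_odd ho']; exact hu2⟩
          · rw [Set.mem_singleton_iff] at hu; subst hu
            exact ⟨by rw [pr_odd ho']; exact hu2, hu2⟩
        exact hab ((fib' _ e.1).trans (fib' _ e.2).symm)
    refine ⟨⟨fun _ => ⟨s, hs⟩, fun _ => ⟨s', hs'⟩, fun z => Subtype.ext (fib' _ z.2).symm,
      fun z => Subtype.ext (fib _ z.2).symm⟩, fun T T' mT mT' cT z => ?_⟩
    have hz := fib' _ z.2
    rw [hz]
    show s' ∈ T' ↔ s ∈ T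
    constructor
    · intro h
      obtain ⟨u, hu, hu2⟩ := (hpe _ _ cT y').1 ⟨s', h, hs'⟩
      rwa [← fib u hu2]
    · intro h
      obtain ⟨u, hu, hu2⟩ := (hpe _ _ cT y').2 ⟨s, h, hs⟩
      rwa [← fib' u hu2]

theorem core [Finite B] [Finite B'] (cs : CoxeterSystem M W) (cs' : CoxeterSystem M' W)
    (hG : Good cs) : ∃ Ψ : B' ≃ B, ∀ s' t', M (Ψ s') (Ψ t') = M' s' t' := by
  have hG' := good_transfer cs cs' hG
  obtain ⟨x, hx⟩ := exists_x cs
  obtain ⟨ψ, hψ⟩ := exists_psi cs cs' x hx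
  have hpe : ∀ T T', Cor cs cs' T T' → ∀ y', y' ∈ pr M' '' T' ↔ ψ y' ∈ pr M '' T :=
    fun T T' h y' => psi_eq cs cs' x hx ψ hψ h y'
  choose e he using fib_equiv cs cs' hG hG' ψ hpe
  let Ψ : B' ≃ B := (Equiv.sigmaFiberEquiv (pr M')).symm.trans
    ((Equiv.sigmaCongr ψ e).trans (Equiv.sigmaFiberEquiv (pr M)))
  have hΨ : ∀ s', Ψ s' = (e (pr M' s') ⟨s', rfl⟩).1 := fun s' => rfl
  have hpr : ∀ s', pr M (Ψ s') = ψ (pr M' s') := fun s' => by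
    rw [hΨ]; exact (e (pr M' s') ⟨s', rfl⟩).2
  have hmem : ∀ T T', MaxSph cs T → MaxSph cs' T' → Cor cs cs' T T' →
      ∀ s', s' ∈ T' ↔ Ψ s' ∈ T := by
    intro T T' mT mT' cT s'
    rw [hΨ]
    exact he (pr M' s') T T' mT mT' cT ⟨s', rfl⟩
  refine ⟨Ψ, fun s' t' => ?_⟩
  by_cases hst : s' = t'
  · subst hst; rw [M.diagonal, M'.diagonal]
  by_cases h0 : M' s' t' = 0
  · rw [h0]
    by_contra h1
    obtain ⟨T, mT, hT⟩ := ext_max cs (Par_pair_finite cs h1)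
    obtain ⟨T', mT', cT⟩ := Cor_exists cs cs' mT
    exact M_ne_zero_of_fin cs' mT'.1 ((hmem T T' mT mT' cT s').2 (hT (by simp)))
      ((hmem T T' mT mT' cT t').2 (hT (by simp))) h0
  · obtain ⟨T', mT', hT'⟩ := ext_max cs' (Par_pair_finite cs' h0)
    obtain ⟨T, mT, cT⟩ := Cor_exists cs' cs mT'
    have cT := Cor.symm cs' cs cT
    have hs : s' ∈ T' := hT' (by simp)
    have ht : t' ∈ T' := hT' (by simp)
    have hs2 := (hmem T T' mT mT' cT s').1 hs
    have ht2 := (hmem T T' mT mT' cT t').1 ht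
    have hne2 : Ψ s' ≠ Ψ t' := fun h => hst (Ψ.injective h)
    rcases hG.typ T mT with ⟨a, b, hab, hTe, ho⟩ | hE
    · obtain ⟨a', b', hab', hTe', ho'⟩ := typ_odd cs cs' mT cT hab hTe ho
      have g : M (Ψ s') (Ψ t') = M a b := by
        rw [hTe] at hs2 ht2
        generalize Ψ s' = p at *
        generalize Ψ t' = q at *
        rcases hs2 with rfl | hs2 <;> rcases ht2 with rfl | ht2
        · exact absurd rfl hne2
        · rw [Set.mem_singleton_iff.1 ht2]
        · rw [Set.mem_singleton_iff.1 hs2]; exact M.symmetric _ _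
        · exact absurd (hs2.trans ht2.symm) hne2
      have g' : M' s' t' = M' a' b' := by
        rw [hTe'] at hs ht
        rcases hs with rfl | hs <;> rcases ht with rfl | ht
        · exact absurd rfl hst
        · rw [Set.mem_singleton_iff.1 ht]
        · rw [Set.mem_singleton_iff.1 hs]; exact M'.symmetric _ _
        · exact absurd (hs.trans ht.symm) hst
      rw [g, g', ho']
    · obtain ⟨cs2, w, hw⟩ := locCS cs cs' cT
      have := mT.1
      have r := L2 (parCS cs T) cs2 (matching_of cs mT hE) hE
        (fun b => (x (pr M b)).comp (Par cs T).subtype) (by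
          intro b c
          rw [MonoidHom.comp_apply, Subgroup.subtype_apply, parCS_simple, hx, pr_eq cs hG.two]
          constructor
          · rintro (h | h)
            · exact Subtype.ext h
            · by_contra hn
              exact strong_even_odd hE c.2 b.2 (fun h => hn (Subtype.ext h)) h
          · rintro rfl; exact Or.inl rfl)
        (Ψ.subtypeEquiv (hmem T T' mT mT' cT)) (by
          intro b'
          rw [MonoidHom.comp_apply, Subgroup.subtype_apply, hw, Z2_conj]
          show x (pr M (Ψ b')) _ ≠ 1
          rw [hpr]
          exact hψ b') ⟨s', hs⟩ ⟨t', ht⟩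
      rw [resM_apply, resM_apply] at r
      exact r

end glob2
end RG

theorem RG.par_coe {W : Type*} [Group W] {S : Set W} {M : CoxeterMatrix S} (cs : CoxeterSystem M W)
    (hs : ∀ s : S, cs.simple s = (s : W)) (T : Set S) :
    RG.Par cs T = Subgroup.closure (Subtype.val '' T) := by
  unfold RG.Par
  congr 1
  exact Set.image_congr fun s _ => hs s

theorem RG.sph_iff {W : Type*} [Group W] {S : Set W} {M : CoxeterMatrix S} (cs : CoxeterSystem M W)
    (hs : ∀ s : S, cs.simple s = (s : W)) (T : Set S) :
    Finite (RG.Par cs T) ↔ IsSpherical S (Subtype.val '' T) := by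
  rw [RG.par_coe cs hs]
  constructor
  · intro h
    exact ⟨by rintro _ ⟨t, -, rfl⟩; exact t.2, Set.toFinite _⟩
  · intro h
    exact h.2.to_subtype

theorem RG.max_iff {W : Type*} [Group W] {S : Set W} {M : CoxeterMatrix S} (cs : CoxeterSystem M W)
    (hs : ∀ s : S, cs.simple s = (s : W)) (T : Set S) :
    RG.MaxSph cs T ↔ IsMaxSpherical S (Subtype.val '' T) := by
  unfold RG.MaxSph IsMaxSpherical
  rw [RG.sph_iff cs hs]
  refine and_congr_right fun _ => ⟨fun h U hU hTU => ?_, fun h U hU hTU => ?_⟩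
  · have e : Subtype.val '' (Subtype.val ⁻¹' U : Set S) = U := by
      rw [Subtype.image_preimage_coe, Set.inter_eq_right]
      exact hU.1
    have := h (Subtype.val ⁻¹' U) (by rw [RG.sph_iff cs hs, e]; exact hU)
      (fun t ht => hTU ⟨t, ht, rfl⟩)
    rw [← this, e]
  · have := h (Subtype.val '' U) ((RG.sph_iff cs hs U).1 hU) (Set.image_mono hTU)
    exact Set.image_injective.2 Subtype.val_injective this

theorem RG.good_of {W : Type*} [Group W] {S : Set W} {M : CoxeterMatrix S} (cs : CoxeterSystem M W)
    (hs : ∀ s : S, cs.simple s = (s : W)) (hc : Conds S) : RG.Good cs := by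
  obtain ⟨c0, c1, c2, c3⟩ := hc
  have ho : ∀ s t : S, orderOf ((s : W) * t) = M s t := by
    intro s t
    rw [← RG.orderOf_simple_mul cs, hs, hs]
  have hpair : ∀ s t : S, s ≠ t → Odd (M s t) → RG.MaxSph cs {s, t} := by
    intro s t hne hodd
    rw [RG.max_iff cs hs, Set.image_pair]
    exact c1 s s.2 t t.2 (fun h => hne (Subtype.ext h)) (by rw [ho]; exact hodd)
  refine ⟨fun T hT => ?_, fun s t u h1 h2 o1 o2 => ?_, ?_⟩
  · by_cases h : ∃ s ∈ T, ∃ t ∈ T, s ≠ t ∧ Odd (M s t)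
    · obtain ⟨s, hsT, t, htT, hne, hodd⟩ := h
      refine Or.inl ⟨s, t, hne, ?_, hodd⟩
      exact (hpair s t hne hodd).2 T hT.1 (by rintro x (rfl | rfl) <;> assumption)
    · right
      intro a b hab
      rw [RG.resM_apply, ← ho]
      refine c0 _ a.1.2 _ b.1.2 (fun h => hab (Subtype.ext (Subtype.ext h))) ?_
      rw [ho, ← Nat.not_odd_iff_even]
      intro hodd
      exact h ⟨a, a.2, b, b.2, fun h => hab (Subtype.ext h), hodd⟩
  · by_contra h3
    exact c2 ⟨s, s.2, t, t.2, u, u.2, fun h => h1 (Subtype.ext h), fun h => h2 (Subtype.ext h),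
      fun h => h3 (Subtype.ext h), by rw [ho]; exact o1, by rw [ho]; exact o2⟩
  · intro s t hne hodd T1 T2 m1 m2 i1 i2 n1 n2
    have hm := hpair s t hne hodd
    have img : ∀ T : Set S, (T ∩ {s, t}).Nonempty →
        (Subtype.val '' T ∩ {(s : W), (t : W)}).Nonempty := by
      rintro T ⟨z, hz, hz2⟩
      refine ⟨z, ⟨z, hz, rfl⟩, ?_⟩
      rcases hz2 with rfl | hz2
      · exact Or.inl rfl
      · rw [Set.mem_singleton_iff] at hz2; subst hz2; exact Or.inr rfl
    have inj : Function.Injective (fun T : Set S => (Subtype.val '' T : Set W)) :=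
      Set.image_injective.2 Subtype.val_injective
    rcases c3 s s.2 t t.2 (fun h => hne (Subtype.ext h)) (by rw [ho]; exact hodd)
      (Subtype.val '' T1) (Subtype.val '' T2) (Subtype.val '' ({s, t} : Set S))
      ⟨(RG.max_iff cs hs _).1 m1, img _ i1⟩ ⟨(RG.max_iff cs hs _).1 m2, img _ i2⟩
      ⟨(RG.max_iff cs hs _).1 hm, img _ ⟨s, by simp, by simp⟩⟩ with h | h | h
    · exact inj h
    · exact absurd (inj h) n1
    · exact absurd (inj h) n2

/-- Main theorem: a Coxeter system satisfying conditions (0)–(3) gives a rigid Coxeter group. -/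
theorem main_rigid {W : Type} [Group W] (S : Set W) (hS : IsCoxGenSet S) (hc : Conds S) :
    ∀ S' : Set W, IsCoxGenSet S' →
      ∃ ψ : S ≃ S', ∀ s t : S,
        orderOf ((s : W) * (t : W)) = orderOf ((ψ s : W) * (ψ t : W)) := by
  intro S' hS'
  obtain ⟨hf, M, cs, hs⟩ := hS
  obtain ⟨hf', M', cs', hs'⟩ := hS'
  have := hf.to_subtype
  have := hf'.to_subtype
  obtain ⟨Ψ, hΨ⟩ := RG.core cs cs' (RG.good_of cs hs hc)
  refine ⟨Ψ.symm, fun s t => ?_⟩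
  rw [← hs s, ← hs t, ← hs' (Ψ.symm s), ← hs' (Ψ.symm t), RG.orderOf_simple_mul,
    RG.orderOf_simple_mul, ← hΨ, Equiv.apply_symm_apply, Equiv.apply_symm_apply]
end

section
/- Let φ: W → W' be an isomorphism between Coxeter groups with Coxeter systems (W,S) and (W',S'). For each maximal spherical subset T ⊆ S, there exists a unique maximal spherical subset T' ⊆ S' such that φ(W_T) = w' W'_{T'} (w')^{-1} for some w' ∈ W'. -/
open Subgroup

namespace CoxAux

variable {B : Type} (M : CoxeterMatrix B)

/-- simple root -/
noncomputable def sr (i : B) : B →₀ ℝ := Finsupp.single i 1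

/-- the constant `2 cos (π / m)` -/
noncomputable def cc (i j : B) : ℝ := 2 * Real.cos (Real.pi / (M i j : ℝ))

theorem cc_symm (i j : B) : cc M i j = cc M j i := by
  unfold cc; rw [M.symmetric]

theorem cc_self (i : B) : cc M i i = -2 := by
  simp [cc]

/-- coroot functional -/
noncomputable def kk (i : B) : (B →₀ ℝ) →ₗ[ℝ] ℝ :=
  Finsupp.linearCombination ℝ (fun j => - cc M i j)

theorem kk_sr (i j : B) : kk M i (sr j) = - cc M i j := by
  simp [kk, sr]

/-- reflection -/
noncomputable def rf (i : B) : Module.End ℝ (B →₀ ℝ) :=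
  LinearMap.id - (kk M i).smulRight (sr i)

theorem rf_apply (i : B) (v : B →₀ ℝ) : rf M i v = v - kk M i v • sr i := by
  simp [rf]

theorem rf_sr (i j : B) : rf M i (sr j) = sr j + cc M i j • sr i := by
  rw [rf_apply, kk_sr]; simp

theorem rf_sr_self (i : B) : rf M i (sr i) = - sr i := by
  rw [rf_sr, cc_self]; module

theorem rf_mul_self (i : B) : rf M i * rf M i = 1 := by
  ext1 v
  apply LinearMap.ext
  intro x
  simp only [LinearMap.comp_apply, Module.End.mul_apply, Module.End.one_apply]
  rw [rf_apply M i (Finsupp.lsingle v x), map_sub, map_smul, rf_sr_self, rf_apply]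
  module

/-- Chebyshev-like sequence -/
def uu (c : ℝ) : ℕ → ℝ
  | 0 => 0
  | 1 => 1
  | n + 2 => c * uu c (n + 1) - uu c n

theorem uu_two (n : ℕ) : uu 2 n = n ∧ uu 2 (n + 1) = n + 1 := by
  induction n with
  | zero => simp [uu]
  | succ n ih =>
    refine ⟨by push_cast; exact ih.2, ?_⟩
    rw [uu, ih.1, ih.2]; push_cast; ring

theorem uu_sin (θ : ℝ) (n : ℕ) : uu (2 * Real.cos θ) n * Real.sin θ = Real.sin (n * θ) ∧
    uu (2 * Real.cos θ) (n + 1) * Real.sin θ = Real.sin ((n + 1 : ℕ) * θ) := by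
  induction n with
  | zero => simp [uu]
  | succ n ih =>
    refine ⟨ih.2, ?_⟩
    rw [uu, sub_mul, mul_assoc, ih.1, ih.2]
    have h1 : ((n + 1 + 1 : ℕ) : ℝ) * θ = ((n + 1 : ℕ) : ℝ) * θ + θ := by push_cast; ring
    have h2 : (n : ℝ) * θ = ((n + 1 : ℕ) : ℝ) * θ - θ := by push_cast; ring
    rw [h1, h2, Real.sin_add, Real.sin_sub]; ring

theorem sin_pos_of {m : ℕ} (hm : 2 ≤ m) : 0 < Real.sin (Real.pi / m) := by
  have hm' : (2 : ℝ) ≤ m := by exact_mod_cast hm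
  apply Real.sin_pos_of_pos_of_lt_pi
  · have := Real.pi_pos; positivity
  · rw [div_lt_iff₀ (by linarith)]
    nlinarith [Real.pi_pos]

theorem uu_nonneg (m n : ℕ) (hm1 : m ≠ 1) (h : m = 0 ∨ n ≤ m) :
    0 ≤ uu (2 * Real.cos (Real.pi / m)) n := by
  rcases Nat.eq_zero_or_pos m with rfl | hm
  · simp only [Nat.cast_zero, div_zero, Real.cos_zero, mul_one]
    rw [(uu_two n).1]; positivity
  · have hn : n ≤ m := by omega
    have hs := sin_pos_of (m := m) (by omega)
    have h1 := (uu_sin (Real.pi / m) n).1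
    have h2 : 0 ≤ Real.sin (n * (Real.pi / m)) := by
      apply Real.sin_nonneg_of_nonneg_of_le_pi
      · have := Real.pi_pos; positivity
      · have hm' : (0 : ℝ) < m := by exact_mod_cast hm
        have hn' : (n : ℝ) ≤ m := by exact_mod_cast hn
        rw [← mul_div_assoc, div_le_iff₀ hm']
        nlinarith [Real.pi_pos]
    rw [← h1] at h2
    exact nonneg_of_mul_nonneg_left h2 hs

theorem rf_pow (i j : B) (k : ℕ) : ((rf M i * rf M j) ^ k) (sr i) =
    uu (cc M i j) (2 * k + 1) • sr i + uu (cc M i j) (2 * k) • sr j := by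
  induction k with
  | zero => simp [uu]
  | succ k ih =>
    rw [pow_succ', Module.End.mul_apply, ih, Module.End.mul_apply]
    simp only [map_add, map_smul, rf_sr, cc_self, cc_symm M j i]
    rw [show 2 * (k + 1) + 1 = (2 * k + 1) + 2 by ring, show 2 * (k + 1) = 2 * k + 2 by ring,
      uu, show 2 * k + 1 + 1 = 2 * k + 2 by ring, uu]
    module

theorem rf_pow_fix (i j : B) (hm : 2 ≤ M i j) : ((rf M i * rf M j) ^ (M i j)) (sr i) = sr i := by
  rw [rf_pow]
  have hs := sin_pos_of hm
  have h := uu_sin (Real.pi / M i j) (2 * M i j)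
  have hm' : (M i j : ℝ) ≠ 0 := by positivity
  have e1 : ((2 * M i j : ℕ) : ℝ) * (Real.pi / M i j) = 2 * Real.pi := by
    push_cast; field_simp
  have e2 : ((2 * M i j + 1 : ℕ) : ℝ) * (Real.pi / M i j) = Real.pi / M i j + 2 * Real.pi := by
    push_cast; field_simp; ring
  rw [e1, e2, Real.sin_two_pi, Real.sin_add_two_pi] at h
  have h1 : uu (cc M i j) (2 * M i j) = 0 := by
    rcases mul_eq_zero.mp h.1 with h | h
    · exact h
    · exact absurd h hs.ne'
  have h2 : uu (cc M i j) (2 * M i j + 1) = 1 := mul_right_cancel₀ hs.ne' (by rw [one_mul]; exact h.2)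
  rw [h1, h2]; simp

theorem rf_pow_fix' (i j : B) (hm : 2 ≤ M i j) : ((rf M i * rf M j) ^ (M i j)) (sr j) = sr j := by
  have h1 : (rf M i * rf M j) * (rf M j * rf M i) = 1 := by
    rw [mul_assoc, ← mul_assoc (rf M j), rf_mul_self, one_mul, rf_mul_self]
  have h2 : (rf M j * rf M i) * (rf M i * rf M j) = 1 := by
    rw [mul_assoc, ← mul_assoc (rf M i), rf_mul_self, one_mul, rf_mul_self]
  have hc : Commute (rf M i * rf M j) (rf M j * rf M i) := h1.trans h2.symm
  have h3 := hc.mul_pow (M i j)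
  rw [h1, one_pow] at h3
  have h4 := rf_pow_fix M j i (by rwa [M.symmetric])
  rw [M.symmetric] at h4
  have h5 := congrArg (fun F => F (sr j)) h3
  simp only [Module.End.mul_apply, Module.End.one_apply] at h5
  rw [h4] at h5
  exact h5.symm

theorem rf_liftable : M.IsLiftable (rf M) := by
  intro i j
  by_cases hij : i = j
  · subst hij; rw [rf_mul_self, one_pow]
  rcases Nat.lt_or_ge (M i j) 2 with h | h
  · have := M.off_diagonal i j hij
    have h0 : M i j = 0 := by omega
    rw [h0, pow_zero]
  · have hs := sin_pos_of h
    have hd : 4 - cc M i j ^ 2 ≠ 0 := by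
      have : 4 - cc M i j ^ 2 = 4 * Real.sin (Real.pi / M i j) ^ 2 := by
        rw [Real.sin_sq, cc]; ring
      rw [this]; positivity
    apply LinearMap.ext
    intro v
    rw [Module.End.one_apply]
    set c := cc M i j with hc
    set a := (2 * kk M i v + c * kk M j v) / (4 - c ^ 2) with ha
    set b := (c * kk M i v + 2 * kk M j v) / (4 - c ^ 2) with hb
    set p := v - a • sr i - b • sr j with hp
    have hv : v = p + a • sr i + b • sr j := by rw [hp]; module
    have hpi : kk M i p = 0 := by
      rw [hp]; simp only [map_sub, map_smul, kk_sr, cc_self, smul_eq_mul, ← hc]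
      rw [ha, hb]; field_simp; ring
    have hpj : kk M j p = 0 := by
      rw [hp]; simp only [map_sub, map_smul, kk_sr, cc_self, smul_eq_mul, cc_symm M j i, ← hc]
      rw [ha, hb]; field_simp; ring
    have hpp : ∀ n : ℕ, ((rf M i * rf M j) ^ n) p = p := by
      intro n
      induction n with
      | zero => simp
      | succ n ih =>
        rw [pow_succ, Module.End.mul_apply, Module.End.mul_apply, rf_apply M j, hpj, zero_smul, sub_zero,
          rf_apply M i, hpi, zero_smul, sub_zero, ih]
    rw [hv, map_add, map_add, map_smul, map_smul, hpp, rf_pow_fix M i j h, rf_pow_fix' M i j h]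

variable {M} {W : Type} [Group W] (cs : CoxeterSystem M W)

/-- geometric representation -/
noncomputable def rho : W →* Module.End ℝ (B →₀ ℝ) := cs.lift ⟨rf M, rf_liftable M⟩

theorem rho_simple (i : B) : rho cs (cs.simple i) = rf M i :=
  cs.lift_apply_simple _ i

theorem rho_mul (v w : W) (x : B →₀ ℝ) : rho cs (v * w) x = rho cs v (rho cs w x) := by
  rw [map_mul, Module.End.mul_apply]

theorem rho_alt (i j : B) (k : ℕ) : rho cs (cs.wordProd (CoxeterSystem.alternatingWord i j k)) (sr i) =
    if Even k then uu (cc M i j) (k + 1) • sr i + uu (cc M i j) k • sr j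
    else uu (cc M i j) k • sr i + uu (cc M i j) (k + 1) • sr j := by
  induction k with
  | zero => simp [uu, CoxeterSystem.alternatingWord]
  | succ k ih =>
    rw [CoxeterSystem.alternatingWord_succ', cs.wordProd_cons, rho_mul, ih, rho_simple]
    by_cases hk : Even k
    · have hk' : ¬ Even (k + 1) := by simpa [Nat.even_add_one] using hk
      simp only [hk, hk', if_true, if_false, map_add, map_smul, rf_sr, cc_self, cc_symm M j i]
      rw [uu]; module
    · have hk' : Even (k + 1) := by simpa [Nat.even_add_one] using hk
      simp only [hk, hk', if_true, if_false, map_add, map_smul, rf_sr, cc_self]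
      rw [uu]; module

theorem sr_nonneg (i : B) : 0 ≤ sr i := by
  unfold sr; exact Finsupp.single_nonneg.mpr zero_le_one

theorem key (w : W) (i : B) (h : ¬ cs.IsRightDescent w i) : 0 ≤ rho cs w (sr i) := by
  induction hn : cs.length w using Nat.strong_induction_on generalizing w i with
  | _ n ih =>
  subst hn
  by_cases hw : w = 1
  · subst hw; simpa using sr_nonneg i
  obtain ⟨j, hj⟩ := cs.exists_rightDescent_of_ne_one hw
  have hij : i ≠ j := by rintro rfl; exact h hj
  let P : ℕ → Prop := fun k => ∃ v, w = v * cs.wordProd (CoxeterSystem.alternatingWord i j k) ∧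
    cs.length w = cs.length v + k
  have hP0 : P 0 := ⟨w, by simp [CoxeterSystem.alternatingWord], by simp⟩
  have hP1 : P 1 := ⟨w * cs.simple j, by simp [CoxeterSystem.alternatingWord],
    (cs.isRightDescent_iff.mp hj).symm⟩
  have hPm : M i j ≠ 0 → ¬ P (M i j) := by
    rintro hm ⟨v, hv, hl⟩
    have hb := cs.wordProd_braidWord_eq i j
    unfold CoxeterSystem.braidWord at hb
    rw [M.symmetric j i] at hb
    obtain ⟨m, hm'⟩ := Nat.exists_eq_succ_of_ne_zero hm
    rw [hb, hm', Nat.succ_eq_add_one, CoxeterSystem.alternatingWord_succ, cs.wordProd_concat] at hv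
    apply h
    unfold CoxeterSystem.IsRightDescent
    have : w * cs.simple i = v * cs.wordProd (CoxeterSystem.alternatingWord i j m) := by
      rw [hv]; simp [mul_assoc]
    rw [this]
    have h1 := cs.length_mul_le v (cs.wordProd (CoxeterSystem.alternatingWord i j m))
    have h2 := cs.length_wordProd_le (CoxeterSystem.alternatingWord i j m)
    rw [CoxeterSystem.length_alternatingWord] at h2
    omega
  have hex : ∃ n, ¬ P n := by
    refine ⟨cs.length w + 1, ?_⟩
    rintro ⟨v, -, hl⟩
    omega
  classical
  have hnP := Nat.find_spec hex
  have hmin := fun k => Nat.find_min (H := hex) (m := k)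
  have hle := fun hm => Nat.find_min' hex (hPm hm)
  set N := Nat.find hex with hN
  obtain ⟨k, hk⟩ : ∃ k, N = k + 1 + 1 := by
    rcases hN' : N with _ | _ | k
    · rw [hN'] at hnP; exact absurd hP0 hnP
    · rw [hN'] at hnP; exact absurd hP1 hnP
    · exact ⟨k, rfl⟩
  have hPk : P (k + 1) := not_not.mp (hmin (k + 1) (by omega))
  rw [hk] at hnP
  obtain ⟨v, hv, hl⟩ := hPk
  have hA : ¬ cs.IsRightDescent v (if Even (k + 1) then j else i) := by
    intro hd
    apply hnP
    refine ⟨v * cs.simple (if Even (k + 1) then j else i), ?_, ?_⟩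
    · rw [CoxeterSystem.alternatingWord_succ' i j (k + 1), cs.wordProd_cons, mul_assoc,
        cs.simple_mul_simple_cancel_left]
      exact hv
    · have := cs.isRightDescent_iff.mp hd
      omega
  have hB : ¬ cs.IsRightDescent v (if Even k then j else i) := by
    intro hd
    have hv' := hv
    rw [CoxeterSystem.alternatingWord_succ' i j k, cs.wordProd_cons, ← mul_assoc] at hv'
    have h1 := cs.length_mul_le (v * cs.simple (if Even k then j else i))
      (cs.wordProd (CoxeterSystem.alternatingWord i j k))
    have h2 := cs.length_wordProd_le (CoxeterSystem.alternatingWord i j k)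
    rw [CoxeterSystem.length_alternatingWord] at h2
    rw [← hv'] at h1
    have := cs.isRightDescent_iff.mp hd
    omega
  have hvi : ¬ cs.IsRightDescent v i ∧ ¬ cs.IsRightDescent v j := by
    by_cases hk : Even k
    · have hk' : ¬ Even (k + 1) := by simpa [Nat.even_add_one] using hk
      simp only [hk, hk', if_true, if_false] at hA hB
      exact ⟨hA, hB⟩
    · have hk' : Even (k + 1) := by simpa [Nat.even_add_one] using hk
      simp only [hk, hk', if_true, if_false] at hA hB
      exact ⟨hB, hA⟩
  have hpi := ih (cs.length v) (by omega) v i hvi.1 rfl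
  have hpj := ih (cs.length v) (by omega) v j hvi.2 rfl
  have hne1 := M.off_diagonal i j hij
  have hu1 : 0 ≤ uu (cc M i j) (k + 1) := uu_nonneg _ _ hne1 (by
    by_cases hm : M i j = 0
    · exact Or.inl hm
    · have := hle hm; right; omega)
  have hu2 : 0 ≤ uu (cc M i j) (k + 1 + 1) := uu_nonneg _ _ hne1 (by
    by_cases hm : M i j = 0
    · exact Or.inl hm
    · have := hle hm; right; omega)
  rw [hv, rho_mul, rho_alt]
  split_ifs
  · rw [map_add, map_smul, map_smul]
    exact add_nonneg (smul_nonneg hu2 hpi) (smul_nonneg hu1 hpj)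
  · rw [map_add, map_smul, map_smul]
    exact add_nonneg (smul_nonneg hu1 hpi) (smul_nonneg hu2 hpj)

theorem key' (w : W) (i : B) (h : cs.IsRightDescent w i) : rho cs w (sr i) ≤ 0 := by
  have h1 := key cs (w * cs.simple i) i (cs.isRightDescent_iff_not_isRightDescent_mul.mp h)
  rw [rho_mul, rho_simple, rf_sr_self, map_neg] at h1
  simpa using h1

theorem rho_inv_apply (w : W) (x : B →₀ ℝ) : rho cs w⁻¹ (rho cs w x) = x := by
  rw [← rho_mul]; simp

theorem rho_eq_zero (w : W) (x : B →₀ ℝ) (h : rho cs w x = 0) : x = 0 := by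
  rw [← rho_inv_apply cs w x, h, map_zero]

theorem sr_ne_zero (i : B) : sr i ≠ 0 := by
  unfold sr; simp

/-- the roots -/
def Rt : Set (B →₀ ℝ) := {v | ∃ w i, v = rho cs w (sr i)}

/-- the positive roots -/
def Ps : Set (B →₀ ℝ) := {v | v ∈ Rt cs ∧ 0 ≤ v}

theorem sr_mem (i : B) : sr i ∈ Ps cs := ⟨⟨1, i, by simp⟩, sr_nonneg i⟩

theorem Rt_ne {v : B →₀ ℝ} (h : v ∈ Rt cs) : v ≠ 0 := by
  obtain ⟨w, i, rfl⟩ := h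
  intro h
  exact sr_ne_zero i (rho_eq_zero cs w _ h)

theorem Rt_dich {v : B →₀ ℝ} (h : v ∈ Rt cs) : 0 ≤ v ∨ v ≤ 0 := by
  obtain ⟨w, i, rfl⟩ := h
  by_cases hd : cs.IsRightDescent w i
  · exact Or.inr (key' cs w i hd)
  · exact Or.inl (key cs w i hd)

theorem Rt_rho {v : B →₀ ℝ} (h : v ∈ Rt cs) (w : W) : rho cs w v ∈ Rt cs := by
  obtain ⟨w', i, rfl⟩ := h
  exact ⟨w * w', i, by rw [rho_mul]⟩

theorem Rt_neg {v : B →₀ ℝ} (h : v ∈ Rt cs) : -v ∈ Rt cs := by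
  obtain ⟨w', i, rfl⟩ := h
  exact ⟨w' * cs.simple i, i, by rw [rho_mul, rho_simple, rf_sr_self, map_neg]⟩

variable (M) in
/-- twice the canonical form -/
noncomputable def bf : (B →₀ ℝ) →ₗ[ℝ] ((B →₀ ℝ) →ₗ[ℝ] ℝ) :=
  Finsupp.linearCombination ℝ (kk M)

theorem bf_sr_left (i : B) (v : B →₀ ℝ) : bf M (sr i) v = kk M i v := by
  simp [bf, sr]

theorem bf_sr_right (i : B) (v : B →₀ ℝ) : bf M v (sr i) = kk M i v := by
  induction v using Finsupp.induction_linear with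
  | zero => simp
  | add f g hf hg => rw [map_add, map_add, LinearMap.add_apply, hf, hg]
  | single a b =>
    have : Finsupp.single a b = b • (sr a : B →₀ ℝ) := by simp [sr]
    rw [this, map_smul, map_smul, LinearMap.smul_apply, bf_sr_left, kk_sr, kk_sr, cc_symm]

theorem bf_rf (i : B) (v : B →₀ ℝ) : bf M (rf M i v) (rf M i v) = bf M v v := by
  rw [rf_apply]
  simp only [map_sub, map_smul, LinearMap.sub_apply, LinearMap.smul_apply, bf_sr_left, bf_sr_right,
    kk_sr, cc_self, smul_eq_mul]
  ring

theorem bf_rho (w : W) (v : B →₀ ℝ) : bf M (rho cs w v) (rho cs w v) = bf M v v := by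
  induction w using cs.simple_induction_left with
  | one => simp
  | mul_simple_left w i ih => rw [rho_mul, rho_simple, bf_rf, ih]

theorem Rt_norm {v : B →₀ ℝ} (h : v ∈ Rt cs) : bf M v v = 2 := by
  obtain ⟨w, i, rfl⟩ := h
  rw [bf_rho, bf_sr_left, kk_sr, cc_self, neg_neg]

/-- a simple reflection permutes the positive roots apart from the simple root -/
theorem Ps_rf {v : B →₀ ℝ} (h : v ∈ Ps cs) (i : B) : v = sr i ∨ rf M i v ∈ Ps cs := by
  have hr : rf M i v ∈ Rt cs := by rw [← rho_simple cs]; exact Rt_rho cs h.1 _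
  rcases Rt_dich cs hr with h1 | h1
  · exact Or.inr ⟨hr, h1⟩
  left
  have hz : ∀ j, j ≠ i → v j = 0 := by
    intro j hj
    have h2 := h1 j
    have h3 := h.2 j
    rw [rf_apply] at h2
    have h4 : (sr i : B →₀ ℝ) j = 0 := by
      unfold sr; exact Finsupp.single_eq_of_ne hj
    rw [Finsupp.sub_apply, Finsupp.smul_apply, h4, smul_zero, sub_zero] at h2
    exact le_antisymm h2 h3
  have hv : v = v i • sr i := by
    ext j
    by_cases hj : j = i
    · subst hj; simp [sr]
    · rw [hz j hj]; simp [sr, Finsupp.single_apply, Ne.symm hj]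
  have hn := Rt_norm cs h.1
  rw [hv] at hn
  simp only [map_smul, LinearMap.smul_apply, bf_sr_left, kk_sr, cc_self, smul_eq_mul] at hn
  have h0 : 0 ≤ v i := h.2 i
  have h1 : v i = 1 := by nlinarith
  rw [hv, h1, one_smul]

theorem fin_neg (w : W) : {v | v ∈ Ps cs ∧ rho cs w v ≤ 0}.Finite := by
  induction w using cs.simple_induction_right with
  | one =>
    convert Set.finite_empty
    ext v
    simp only [map_one, Module.End.one_apply, Set.mem_ofPred_eq, Set.mem_empty_iff_false, iff_false]
    rintro ⟨h1, h2⟩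
    exact Rt_ne cs h1.1 (le_antisymm h2 h1.2)
  | mul_simple_right w i ih =>
    apply ((ih.image (rf M i)).insert (sr i)).subset
    rintro v ⟨h1, h2⟩
    rcases Ps_rf cs h1 i with h | h
    · exact Or.inl h
    · right
      refine ⟨rf M i v, ⟨h, ?_⟩, ?_⟩
      · rwa [rho_mul, rho_simple] at h2
      · rw [← Module.End.mul_apply, rf_mul_self]; rfl

/-- functional with finitely many nonpositive positive roots -/
def Good (y : (B →₀ ℝ) →ₗ[ℝ] ℝ) : Prop := {v | v ∈ Ps cs ∧ y v ≤ 0}.Finite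

theorem dom_nonneg {y : (B →₀ ℝ) →ₗ[ℝ] ℝ} (hy : ∀ i, 0 ≤ y (sr i)) {v : B →₀ ℝ} (hv : 0 ≤ v) :
    0 ≤ y v := by
  rw [← Finsupp.sum_single v, Finsupp.sum, map_sum]
  apply Finset.sum_nonneg
  intro i _
  have : Finsupp.single i (v i) = v i • (sr i : B →₀ ℝ) := by simp [sr]
  rw [this, map_smul]
  exact mul_nonneg (hv i) (hy i)

theorem dom_nonpos {y : (B →₀ ℝ) →ₗ[ℝ] ℝ} (hy : ∀ i, 0 ≤ y (sr i)) {v : B →₀ ℝ} (hv : v ≤ 0) :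
    y v ≤ 0 := by
  have := dom_nonneg hy (v := -v) (by simpa using hv)
  rw [map_neg] at this; linarith

/-- the functional with given values on simple roots -/
noncomputable def fn (a : B → ℝ) : (B →₀ ℝ) →ₗ[ℝ] ℝ := Finsupp.linearCombination ℝ a

theorem fn_sr (a : B → ℝ) (i : B) : fn a (sr i) = a i := by simp [fn, sr]

theorem fn_one_pos {v : B →₀ ℝ} (hv : 0 ≤ v) (h : v ≠ 0) : 0 < fn (fun _ => 1) v := by
  obtain ⟨i, hi⟩ := Finsupp.ne_iff.mp h
  simp only [fn, Finsupp.linearCombination_apply, Finsupp.sum, smul_eq_mul, mul_one]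
  apply Finset.sum_pos'
  · intro j _; exact hv j
  · exact ⟨i, by simpa using hi, lt_of_le_of_ne (hv i) (Ne.symm hi)⟩

/-- averaged functional -/
noncomputable def av (H : Subgroup W) [Fintype H] : (B →₀ ℝ) →ₗ[ℝ] ℝ :=
  ∑ h : H, (fn (fun _ => 1)).comp (rho cs (h : W))

theorem av_apply (H : Subgroup W) [Fintype H] (v : B →₀ ℝ) :
    av cs H v = ∑ h : H, fn (fun _ => 1) (rho cs (h : W) v) := by
  simp [av]

theorem av_inv (H : Subgroup W) [Fintype H] (k : W) (hk : k ∈ H) (v : B →₀ ℝ) :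
    av cs H (rho cs k v) = av cs H v := by
  rw [av_apply, av_apply]
  apply Fintype.sum_equiv (Equiv.mulRight (⟨k, hk⟩ : H))
  intro h
  simp [Equiv.coe_mulRight]

theorem av_good (H : Subgroup W) [Fintype H] (g : W) : Good cs ((av cs H).comp (rho cs g)) := by
  apply (Set.finite_iUnion (fun h : H => fin_neg cs ((h : W) * g))).subset
  rintro v ⟨h1, h2⟩
  rw [Set.mem_iUnion]
  by_contra hcon
  push Not at hcon
  rw [LinearMap.comp_apply, av_apply] at h2
  have : 0 < ∑ h : H, fn (fun _ => 1) (rho cs (h : W) (rho cs g v)) := by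
    apply Finset.sum_pos
    · intro h _
      rw [← rho_mul]
      have hr := Rt_rho cs h1.1 ((h : W) * g)
      rcases Rt_dich cs hr with h3 | h3
      · exact fn_one_pos h3 (Rt_ne cs hr)
      · exact absurd ⟨h1, h3⟩ (hcon h)
    · exact ⟨1, Finset.mem_univ _⟩
  linarith

/-- the standard parabolic -/
def pb (T : Set B) : Subgroup W := Subgroup.closure (cs.simple '' T)

theorem rf_fix {y : (B →₀ ℝ) →ₗ[ℝ] ℝ} {i : B} (h : y (sr i) = 0) (v : B →₀ ℝ) :
    y (rf M i v) = y v := by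
  rw [rf_apply, map_sub, map_smul, h]; simp

theorem pb_fix {y : (B →₀ ℝ) →ₗ[ℝ] ℝ} {T : Set B} (h : ∀ i ∈ T, y (sr i) = 0) {w : W}
    (hw : w ∈ pb cs T) : ∀ v, y (rho cs w v) = y v := by
  induction hw using Subgroup.closure_induction with
  | mem x hx =>
    obtain ⟨i, hi, rfl⟩ := hx
    intro v
    rw [rho_simple, rf_fix (h i hi)]
  | one => simp
  | mul x z _ _ hx hz => intro v; rw [rho_mul, hx, hz]
  | inv x _ hx =>
    intro v
    rw [← hx (rho cs x⁻¹ v), ← rho_mul]; simp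

/-- fundamental domain property -/
theorem fund (k : W) {y u : (B →₀ ℝ) →ₗ[ℝ] ℝ} (hy : ∀ i, 0 ≤ y (sr i)) (hu : ∀ i, 0 ≤ u (sr i))
    (h : ∀ v, u v = y (rho cs k v)) : u = y ∧ k ∈ pb cs {i | u (sr i) = 0} := by
  induction hn : cs.length k using Nat.strong_induction_on generalizing k with
  | _ n ih =>
  subst hn
  by_cases hk : k = 1
  · subst hk
    exact ⟨LinearMap.ext (by simpa using h), one_mem _⟩
  obtain ⟨s, hs⟩ := cs.exists_rightDescent_of_ne_one hk
  have h1 : u (sr s) ≤ 0 := by rw [h]; exact dom_nonpos hy (key' cs k s hs)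
  have h2 : u (sr s) = 0 := le_antisymm h1 (hu s)
  obtain ⟨h3, h4⟩ := ih _ hs (k * cs.simple s) (fun v => by
    rw [rho_mul, rho_simple, ← h, rf_fix h2]) rfl
  refine ⟨h3, ?_⟩
  have h5 : cs.simple s ∈ pb cs {i | u (sr i) = 0} := Subgroup.subset_closure ⟨s, h2, rfl⟩
  have := mul_mem h4 h5
  simpa using this

theorem zero_off {z : (B →₀ ℝ) →ₗ[ℝ] ℝ} {T : Set B} (h0 : ∀ i ∈ T, z (sr i) = 0)
    (h1 : ∀ i, i ∉ T → 0 < z (sr i)) {v : B →₀ ℝ} (hv : 0 ≤ v) (hz : z v = 0) :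
    ∀ i, i ∉ T → v i = 0 := by
  intro i hi
  have hd : ∀ j, 0 ≤ z (sr j) := by
    intro j
    by_cases hj : j ∈ T
    · exact (h0 j hj).ge
    · exact (h1 j hj).le
  have h2 : 0 ≤ v - v i • sr i := by
    intro j
    by_cases hj : j = i
    · subst hj; simp [sr]
    · simpa [sr, Finsupp.single_apply, Ne.symm hj] using hv j
  have h3 := dom_nonneg hd h2
  rw [map_sub, map_smul, hz, smul_eq_mul] at h3
  have h4 := h1 i hi
  have h5 : 0 ≤ v i := hv i
  nlinarith

theorem nonpos_on {u : (B →₀ ℝ) →ₗ[ℝ] ℝ} {T : Set B} (hu : ∀ i ∈ T, u (sr i) ≤ 0) {v : B →₀ ℝ}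
    (hv : 0 ≤ v) (hT : ∀ i, i ∉ T → v i = 0) : u v ≤ 0 := by
  rw [← Finsupp.sum_single v, Finsupp.sum, map_sum]
  apply Finset.sum_nonpos
  intro i _
  have : Finsupp.single i (v i) = v i • (sr i : B →₀ ℝ) := by simp [sr]
  rw [this, map_smul]
  by_cases hi : i ∈ T
  · exact mul_nonpos_of_nonneg_of_nonpos (hv i) (hu i hi)
  · rw [hT i hi, zero_smul]

/-- finiteness criterion -/
theorem pb_finite [Finite B] {u : (B →₀ ℝ) →ₗ[ℝ] ℝ} (hg : Good cs u) {T : Set B}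
    (hu : ∀ i ∈ T, u (sr i) ≤ 0) : ((pb cs T : Subgroup W) : Set W).Finite := by
  classical
  set z : (B →₀ ℝ) →ₗ[ℝ] ℝ := fn (fun i => if i ∈ T then 0 else 1) with hz
  have hz0 : ∀ i ∈ T, z (sr i) = 0 := fun i hi => by rw [hz, fn_sr, if_pos hi]
  have hz1 : ∀ i, i ∉ T → 0 < z (sr i) := fun i hi => by rw [hz, fn_sr, if_neg hi]; norm_num
  have hzd : ∀ j, 0 ≤ z (sr j) := by
    intro j
    by_cases hj : j ∈ T
    · exact (hz0 j hj).ge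
    · exact (hz1 j hj).le
  set Q : Set (B →₀ ℝ) := {v | v ∈ Rt cs ∧ z v = 0} with hQ
  have hQf : Q.Finite := by
    apply (hg.union (hg.image (fun v => -v))).subset
    rintro v ⟨h1, h2⟩
    rcases Rt_dich cs h1 with h | h
    · exact Or.inl ⟨⟨h1, h⟩, nonpos_on hu h (zero_off hz0 hz1 h h2)⟩
    · right
      have h' : 0 ≤ -v := by simpa using h
      exact ⟨-v, ⟨⟨Rt_neg cs h1, h'⟩, nonpos_on hu h' (zero_off hz0 hz1 h' (by simp [h2]))⟩, by simp⟩
  have hfix := fun w hw => pb_fix cs (y := z) hz0 (w := w) hw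
  have hFin : Finite Q := hQf
  let F : pb cs T → (T → Q) := fun w t => ⟨rho cs w (sr t), ⟨⟨w, t, rfl⟩, by
    rw [hfix w w.2, hz0 _ t.2]⟩⟩
  have hF : Function.Injective F := by
    intro a b hab
    have h1 : ∀ t ∈ T, rho cs ((b : W)⁻¹ * a) (sr t) = sr t := by
      intro t ht
      have := congrArg Subtype.val (congrFun hab ⟨t, ht⟩)
      simp only [F] at this
      rw [rho_mul, this, rho_inv_apply]
    by_contra hne
    have h2 : (b : W)⁻¹ * a ≠ 1 := by
      intro h
      exact hne (Subtype.ext (inv_mul_eq_one.mp h).symm)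
    obtain ⟨s, hs⟩ := cs.exists_rightDescent_of_ne_one h2
    have h3 := key' cs _ s hs
    have hmem : (b : W)⁻¹ * a ∈ pb cs T := mul_mem (inv_mem b.2) a.2
    have h4 : z (sr s) ≤ 0 := by
      rw [← hfix _ hmem]; exact dom_nonpos hzd h3
    have h5 : s ∈ T := by
      by_contra h
      exact absurd (hz1 s h) (not_lt.mpr h4)
    rw [h1 s h5] at h3
    exact sr_ne_zero s (le_antisymm h3 (sr_nonneg s))
  exact Finite.of_injective F hF

/-- existence of a dominant translate -/
theorem exists_dom (x : (B →₀ ℝ) →ₗ[ℝ] ℝ) (hx : ∀ g, Good cs (x.comp (rho cs g))) :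
    ∃ g, ∀ i, 0 ≤ x (rho cs g (sr i)) := by
  let N : W → Set (B →₀ ℝ) := fun g => {v | v ∈ Ps cs ∧ x (rho cs g v) < 0}
  have hN : ∀ g, (N g).Finite := fun g => (hx g).subset (fun v hv => ⟨hv.1, hv.2.le⟩)
  obtain ⟨g, hg⟩ : ∃ g, ∀ g', (N g).ncard ≤ (N g').ncard := by
    exact ⟨Function.argmin (fun g => (N g).ncard),
      fun g' => Function.argmin_le (fun g => (N g).ncard) g'⟩
  refine ⟨g, fun i => ?_⟩
  by_contra hi
  push Not at hi
  have h1 : (N (g * cs.simple i)).ncard < (N g).ncard := by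
    have hinj : Function.Injective (rf M i) := by
      intro a b hab
      have := congrArg (rf M i) hab
      rwa [← Module.End.mul_apply, ← Module.End.mul_apply, rf_mul_self] at this
    rw [← Set.ncard_image_of_injective _ hinj]
    apply Set.ncard_lt_ncard _ (hN g)
    refine (Set.ssubset_iff_of_subset ?_).mpr ⟨sr i, ⟨sr_mem cs i, hi⟩, ?_⟩
    · rintro _ ⟨v, ⟨h1, h2⟩, rfl⟩
      rw [rho_mul, rho_simple] at h2
      rcases Ps_rf cs h1 i with h | h
      · rw [h, rf_sr_self, map_neg, map_neg] at h2
        linarith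
      · exact ⟨h, h2⟩
    · rintro ⟨v, ⟨h1, h2⟩, h3⟩
      have h4 : v = - sr i := by
        apply hinj
        rw [h3, map_neg, rf_sr_self, neg_neg]
      have h5 := h1.2
      rw [h4] at h5
      exact sr_ne_zero i (le_antisymm (by simpa using h5) (sr_nonneg i))
  exact absurd (hg (g * cs.simple i)) (not_le.mpr h1)

/-- every finite subgroup is conjugate into a finite standard parabolic -/
theorem finite_sub [Finite B] (H : Subgroup W) (hH : (H : Set W).Finite) :
    ∃ (g : W) (T : Set B), ((pb cs T : Subgroup W) : Set W).Finite ∧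
      ∀ h ∈ H, g⁻¹ * h * g ∈ pb cs T := by
  haveI : Fintype H := hH.fintype
  obtain ⟨g, hg⟩ := exists_dom cs (av cs H) (av_good cs H)
  refine ⟨g, {i | av cs H (rho cs g (sr i)) = 0}, pb_finite cs (av_good cs H g) (fun i hi => ?_), ?_⟩
  · exact le_of_eq hi
  · intro h hh
    refine (fund cs (g⁻¹ * h * g) (y := (av cs H).comp (rho cs g))
      (u := (av cs H).comp (rho cs g)) hg hg ?_).2
    intro v
    rw [LinearMap.comp_apply, LinearMap.comp_apply, ← rho_mul]
    rw [show g * (g⁻¹ * h * g) = h * g by group, rho_mul cs h g, av_inv cs H h hh]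

theorem pb_coord {T : Set B} {w : W} (hw : w ∈ pb cs T) {i : B} (hi : i ∉ T) (v : B →₀ ℝ) :
    rho cs w v i = v i := by
  classical
  have := pb_fix cs (y := fn (fun j => if j = i then 1 else 0)) (T := T) (fun j hj => by
    rw [fn_sr, if_neg]; rintro rfl; exact hi hj) hw v
  have hc : ∀ x : B →₀ ℝ, fn (fun j => if j = i then 1 else 0) x = x i := by
    intro x
    by_cases hx : x i = 0 <;> simp [fn, Finsupp.linearCombination_apply, hx]
  rwa [hc, hc] at this

theorem max_unique [Finite B] {T T' : Set B} (hT' : ((pb cs T' : Subgroup W) : Set W).Finite)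
    (hmax : ∀ s, s ∉ T → ¬ ((pb cs (insert s T) : Subgroup W) : Set W).Finite) (g : W)
    (hg : ∀ x ∈ pb cs T, g⁻¹ * x * g ∈ pb cs T') : T = T' := by
  haveI : Fintype (pb cs T') := hT'.fintype
  set y := av cs (pb cs T') with hy
  set u := y.comp (rho cs g⁻¹) with hu
  have simple_zero : ∀ (y : (B →₀ ℝ) →ₗ[ℝ] ℝ) (i : B), (∀ v, y (rf M i v) = y v) → y (sr i) = 0 := by
    intro y i h
    have := h (sr i)
    rw [rf_sr_self, map_neg] at this
    linarith
  have hy0 : ∀ i ∈ T', y (sr i) = 0 := by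
    intro i hi
    apply simple_zero
    intro v
    rw [← rho_simple cs]
    exact av_inv cs (pb cs T') _ (Subgroup.subset_closure ⟨i, hi, rfl⟩) v
  have hy1 : ∀ i, i ∉ T' → 0 < y (sr i) := by
    intro i hi
    rw [hy, av_apply]
    apply Finset.sum_pos
    · intro h _
      have hr : rho cs (h : W) (sr i) ∈ Rt cs := ⟨_, _, rfl⟩
      have hc := pb_coord cs h.2 hi (sr i)
      rcases Rt_dich cs hr with h3 | h3
      · exact fn_one_pos h3 (Rt_ne cs hr)
      · have := h3 i
        rw [hc] at this
        simp [sr] at this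
        linarith
    · exact ⟨1, Finset.mem_univ _⟩
  have hu0 : ∀ i ∈ T, u (sr i) = 0 := by
    intro i hi
    apply simple_zero
    intro v
    rw [← rho_simple cs, hu, LinearMap.comp_apply, LinearMap.comp_apply, ← rho_mul]
    have h1 := hg _ (Subgroup.subset_closure ⟨i, hi, rfl⟩ : cs.simple i ∈ pb cs T)
    have h2 : g⁻¹ * cs.simple i = (g⁻¹ * cs.simple i * g) * g⁻¹ := by group
    rw [h2, rho_mul, hy, av_inv cs _ _ h1]
  have hu1 : ∀ i, i ∉ T → 0 < u (sr i) := by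
    intro i hi
    by_contra hcon
    push Not at hcon
    apply hmax i hi
    apply pb_finite cs (av_good cs (pb cs T') g⁻¹)
    rintro j (rfl | hj)
    · exact hcon
    · exact (hu0 j hj).le
  have hyd : ∀ j, 0 ≤ y (sr j) := by
    intro j
    by_cases hj : j ∈ T'
    · exact (hy0 j hj).ge
    · exact (hy1 j hj).le
  have hud : ∀ j, 0 ≤ u (sr j) := by
    intro j
    by_cases hj : j ∈ T
    · exact (hu0 j hj).ge
    · exact (hu1 j hj).le
  have heq := (fund cs g⁻¹ hyd hud (fun v => rfl)).1
  ext i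
  constructor
  · intro hi
    by_contra h
    have h1 := hy1 i h
    rw [← heq, hu0 i hi] at h1
    exact lt_irrefl _ h1
  · intro hi
    by_contra h
    have h1 := hu1 i h
    rw [heq, hy0 i hi] at h1
    exact lt_irrefl _ h1

end CoxAux

/-- Every finite subgroup is contained in a conjugate of a maximal spherical parabolic. -/
theorem cox_finite_sub {W : Type} [Group W] (S : Set W) (hS : IsCoxGenSet S) (H : Subgroup W)
    (hH : (H : Set W).Finite) : ∃ (g : W) (T : Set W), IsMaxSpherical S T ∧
      ∀ h ∈ H, g⁻¹ * h * g ∈ Subgroup.closure T := by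
  obtain ⟨hfin, M, cs, hcs⟩ := hS
  haveI : Finite S := hfin
  obtain ⟨g, T, hT, hg⟩ := CoxAux.finite_sub cs H hH
  have hsph : IsSpherical S (cs.simple '' T) := by
    refine ⟨?_, hT⟩
    rintro _ ⟨i, -, rfl⟩
    rw [hcs]; exact i.2
  have hF : {U | IsSpherical S U}.Finite := hfin.finite_subsets.subset (fun U hU => hU.1)
  obtain ⟨U, hTU, hU⟩ := hF.exists_le_maximal hsph
  refine ⟨g, U, ⟨hU.1, fun V hV hUV => (hU.eq_of_le hV hUV).symm⟩, fun h hh => ?_⟩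
  exact Subgroup.closure_mono hTU (hg h hh)

/-- Maximal spherical parabolics contained in each other up to conjugacy are equal. -/
theorem cox_max_unique {W : Type} [Group W] (S : Set W) (hS : IsCoxGenSet S) (T T' : Set W)
    (hT : IsMaxSpherical S T) (hT' : IsMaxSpherical S T') (g : W)
    (hg : ∀ x ∈ Subgroup.closure T, g⁻¹ * x * g ∈ Subgroup.closure T') : T = T' := by
  obtain ⟨hfin, M, cs, hcs⟩ := hS
  haveI : Finite S := hfin
  have him : ∀ U : Set W, U ⊆ S → cs.simple '' {i : S | (i : W) ∈ U} = U := by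
    intro U hU
    ext x
    constructor
    · rintro ⟨i, hi, rfl⟩
      rw [hcs]; exact hi
    · intro hx
      exact ⟨⟨x, hU hx⟩, hx, hcs _⟩
  have key := CoxAux.max_unique cs (T := {i : S | (i : W) ∈ T}) (T' := {i : S | (i : W) ∈ T'})
    (by unfold CoxAux.pb; rw [him T' hT'.1.1]; exact hT'.1.2) (by
      intro s hs hf
      unfold CoxAux.pb at hf
      rw [Set.image_insert_eq, him T hT.1.1, hcs] at hf
      have := hT.2 (insert (s : W) T) ⟨Set.insert_subset s.2 hT.1.1, hf⟩ (Set.subset_insert _ _)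
      apply hs
      have h2 : (s : W) ∈ insert (s : W) T := Set.mem_insert _ _
      rw [this] at h2
      exact h2) g (by
      unfold CoxAux.pb; rw [him T hT.1.1, him T' hT'.1.1]; exact hg)
  rw [← him T hT.1.1, ← him T' hT'.1.1, key]

/-- Maximal spherical subsets correspond, up to conjugacy, under an isomorphism. -/
theorem max_spherical_conjugate {W W' : Type} [Group W] [Group W'] (S : Set W) (S' : Set W')
    (hS : IsCoxGenSet S) (hS' : IsCoxGenSet S') (φ : W ≃* W')
    (T : Set W) (hT : IsMaxSpherical S T) :
    ∃! T' : Set W', IsMaxSpherical S' T' ∧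
      ∃ w' : W',
        Subgroup.map φ.toMonoidHom (Subgroup.closure T) =
          Subgroup.map (MulAut.conj w').toMonoidHom (Subgroup.closure T') := by
  have hfin : ((Subgroup.map φ.toMonoidHom (Subgroup.closure T) : Subgroup W') : Set W').Finite := by
    rw [Subgroup.coe_map]; exact hT.1.2.image _
  obtain ⟨g, T', hT', hg⟩ := cox_finite_sub S' hS' _ hfin
  have hfin' : ((Subgroup.map φ.symm.toMonoidHom (Subgroup.closure T') : Subgroup W) : Set W).Finite := by
    rw [Subgroup.coe_map]; exact hT'.1.2.image _
  obtain ⟨k, U, hU, hk⟩ := cox_finite_sub S hS _ hfin'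
  have hfor : ∀ x ∈ Subgroup.closure T, g⁻¹ * φ x * g ∈ Subgroup.closure T' := fun x hx =>
    hg _ ⟨x, hx, rfl⟩
  have hback : ∀ x ∈ Subgroup.closure T', k⁻¹ * φ.symm x * k ∈ Subgroup.closure U := fun x hx =>
    hk _ ⟨x, hx, rfl⟩
  have hTU : T = U := by
    apply cox_max_unique S hS T U hT hU (φ.symm g * k)
    intro x hx
    have := hback _ (hfor x hx)
    simp only [map_mul, map_inv, MulEquiv.symm_apply_apply] at this
    convert this using 1
    group
  subst hTU
  refine ⟨T', ⟨hT', g, ?_⟩, ?_⟩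
  · -- cardinality argument
    have hle : Subgroup.map φ.toMonoidHom (Subgroup.closure T) ≤
        Subgroup.map (MulAut.conj g).toMonoidHom (Subgroup.closure T') := by
      rintro _ ⟨x, hx, rfl⟩
      exact ⟨g⁻¹ * φ x * g, hfor x hx, by simp [mul_assoc]⟩
    have hf2 : ((Subgroup.map (MulAut.conj g).toMonoidHom (Subgroup.closure T') : Subgroup W') :
        Set W').Finite := by
      rw [Subgroup.coe_map]; exact hT'.1.2.image _
    apply SetLike.coe_injective
    apply Set.eq_of_subset_of_ncard_le hle _ hf2
    change (MulAut.conj g '' (Subgroup.closure T' : Set W')).ncard ≤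
      (φ '' (Subgroup.closure T : Set W)).ncard
    rw [Set.ncard_image_of_injective _ (MulAut.conj g).injective,
      Set.ncard_image_of_injective _ φ.injective]
    have hinj : Function.Injective (fun x : W' => k⁻¹ * φ.symm x * k) := by
      intro a b hab
      simpa using hab
    rw [← Set.ncard_image_of_injective _ hinj]
    apply Set.ncard_le_ncard _ hT.1.2
    rintro _ ⟨x, hx, rfl⟩
    exact hback x hx
  · rintro V ⟨hV, w', hw'⟩
    symm
    apply cox_max_unique S' hS' T' V hT' hV (φ k * w')
    intro x hx
    have h1 : φ (k⁻¹ * φ.symm x * k) ∈ Subgroup.map φ.toMonoidHom (Subgroup.closure T) :=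
      ⟨_, hback x hx, rfl⟩
    rw [hw'] at h1
    obtain ⟨z, hz, hz'⟩ := h1
    have h2 : (φ k * w')⁻¹ * x * (φ k * w') = z := by
      simp only [MulEquiv.coe_toMonoidHom, MulAut.conj_apply, map_mul, map_inv,
        MulEquiv.apply_symm_apply] at hz'
      have : z = w'⁻¹ * (w' * z * w'⁻¹) * w' := by group
      rw [this, hz']
      group
    rw [h2]; exact hz
end
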